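/- arXiv:1706.05591 — 3 statements merged into one kernel-verified Lean document; each statement's English description precedes it below -/
import Mathlib

section
/- For every complex p with Re p > 0, the Laplace transform of g satisfies ∫₀^∞ e^{-pt} g(t) dt = 1 / ∫₀¹ p^α μ(α) dα (principal branch of the complex power). Consequently, (k * g)(t) = ∫₀ᵗ k(t-τ) g(τ) dτ = 1 for every t > 0. -/
open MeasureTheory Real Set

section

open ProbabilityTheory Filter Topology

/-- The moment `∫ sin (π α) r ^ α dν(α)`. -/
noncomputable def sineMoment (ν : Measure ℝ) (r : ℝ) : ℝ := ∫ α, sin (π * α) * r ^ α ∂ν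

/-- The moment `∫ cos (π α) r ^ α dν(α)`. -/
noncomputable def cosineMoment (ν : Measure ℝ) (r : ℝ) : ℝ := ∫ α, cos (π * α) * r ^ α ∂ν

/-- The density `S / (S² + C²)` of the Stieltjes representation of `1 / ∫ p ^ α dν(α)`. -/
noncomputable def stieltjesDensity (ν : Measure ℝ) (r : ℝ) : ℝ :=
  sineMoment ν r / (sineMoment ν r ^ 2 + cosineMoment ν r ^ 2)

lemma complexMGF_conj (ν : Measure ℝ) (w : ℂ) : complexMGF id ν (starRingEnd ℂ w) =
    starRingEnd ℂ (complexMGF id ν w) := by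
  rw [complexMGF, complexMGF, ← integral_conj]
  simp [← Complex.exp_conj]

section Symbol

variable {ν : Measure ℝ} [IsFiniteMeasure ν]

lemma integrable_exp_mul_of_ae_mem_Ioo (hν : ∀ᵐ α ∂ν, α ∈ Ioo (0 : ℝ) 1) (x : ℝ) :
    Integrable (fun α ↦ rexp (x * α)) ν := by
  refine Integrable.mono' (integrable_const (rexp |x|)) (by fun_prop) ?_
  filter_upwards [hν] with α hα
  rw [norm_eq_abs, abs_exp, exp_le_exp]
  calc x * α ≤ |x * α| := le_abs_self _
    _ = |x| * α := by rw [abs_mul, abs_of_pos hα.1]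
    _ ≤ |x| := mul_le_of_le_one_right (abs_nonneg _) hα.2.le

lemma integrable_cexp_mul_of_ae_mem_Ioo (hν : ∀ᵐ α ∂ν, α ∈ Ioo (0 : ℝ) 1) (w : ℂ) :
    Integrable (fun α : ℝ ↦ Complex.exp (w * α)) ν := by
  refine Integrable.mono' (integrable_exp_mul_of_ae_mem_Ioo hν w.re) (by fun_prop) ?_
  filter_upwards with α
  simp [Complex.norm_exp]

lemma differentiable_complexMGF_of_ae_mem_Ioo (hν : ∀ᵐ α ∂ν, α ∈ Ioo (0 : ℝ) 1) :
    Differentiable ℂ (complexMGF id ν) := by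
  have h : integrableExpSet id ν = univ :=
    eq_univ_of_forall fun x ↦ integrable_exp_mul_of_ae_mem_Ioo hν x
  have := differentiableOn_complexMGF (X := id) (μ := ν)
  simpa [h, differentiableOn_univ] using this

lemma integrable_sin_mul_rpow (hν : ∀ᵐ α ∂ν, α ∈ Ioo (0 : ℝ) 1) {r : ℝ} (hr : 0 < r) :
    Integrable (fun α ↦ sin (π * α) * r ^ α) ν := by
  refine Integrable.mono' (integrable_exp_mul_of_ae_mem_Ioo hν (log r)) (by fun_prop) ?_
  filter_upwards with α
  rw [norm_mul, norm_eq_abs, norm_eq_abs, ← rpow_def_of_pos hr, abs_of_pos (rpow_pos_of_pos hr _)]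
  exact mul_le_of_le_one_left (rpow_pos_of_pos hr _).le (abs_sin_le_one _)

lemma complexMGF_log_add_pi (hν : ∀ᵐ α ∂ν, α ∈ Ioo (0 : ℝ) 1) {r : ℝ} (hr : 0 < r) :
    complexMGF id ν (log r + π * Complex.I) = cosineMoment ν r + sineMoment ν r * Complex.I := by
  have key (α : ℝ) : Complex.exp ((log r + π * Complex.I) * α) =
      ((cos (π * α) * r ^ α : ℝ) : ℂ) + ((sin (π * α) * r ^ α : ℝ) : ℂ) * Complex.I := by
    rw [add_mul, Complex.exp_add, mul_right_comm, Complex.exp_mul_I, rpow_def_of_pos hr]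
    push_cast
    ring
  have h_int := integrable_cexp_mul_of_ae_mem_Ioo hν (log r + π * Complex.I)
  apply Complex.ext
  · simp only [complexMGF, id]
    rw [← RCLike.re_eq_complex_re, ← integral_re h_int]
    simp only [key, RCLike.re_eq_complex_re, Complex.add_re, Complex.ofReal_re,
      Complex.re_ofReal_mul, Complex.I_re, mul_zero, add_zero]
    rfl
  · simp only [complexMGF, id]
    rw [← RCLike.im_eq_complex_im, ← integral_im h_int]
    simp only [key, RCLike.im_eq_complex_im, Complex.add_im, Complex.ofReal_im,
      Complex.im_ofReal_mul, Complex.I_im, mul_one, zero_add]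
    rfl

lemma complexMGF_log_sub_pi (hν : ∀ᵐ α ∂ν, α ∈ Ioo (0 : ℝ) 1) {r : ℝ} (hr : 0 < r) :
    complexMGF id ν (log r - π * Complex.I) = cosineMoment ν r - sineMoment ν r * Complex.I := by
  have := complexMGF_conj ν (log r + π * Complex.I)
  rw [complexMGF_log_add_pi hν hr] at this
  simpa [← sub_eq_add_neg] using this

lemma sin_pi_mul_le_cos_mul {α θ : ℝ} (hα : α ∈ Ioo (0 : ℝ) 1) (hθ : |θ| ≤ π) :
    sin (π * α) ≤ cos ((α - 1 / 2) * θ) := by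
  rw [← cos_abs ((α - 1 / 2) * θ), ← cos_pi_div_two_sub, ← cos_abs (π / 2 - π * α)]
  have h : |π / 2 - π * α| = |α - 1 / 2| * π := by
    rw [show π / 2 - π * α = -((α - 1 / 2) * π) by ring, abs_neg, abs_mul, abs_of_pos pi_pos]
  have hα' : |α - 1 / 2| ≤ 1 := abs_le.2 ⟨by linarith [hα.1], by linarith [hα.2]⟩
  rw [h, abs_mul]
  exact cos_le_cos_of_nonneg_of_le_pi (by positivity)
    (mul_le_of_le_one_left pi_pos.le hα') (by gcongr)

lemma sineMoment_exp_le_norm_complexMGF (hν : ∀ᵐ α ∂ν, α ∈ Ioo (0 : ℝ) 1) (x : ℝ) {θ : ℝ}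
    (hθ : |θ| ≤ π) : sineMoment ν (rexp x) ≤ ‖complexMGF id ν (x + θ * Complex.I)‖ := by
  set w : ℂ := x + θ * Complex.I
  have key (α : ℝ) : Complex.exp (-(θ / 2 : ℝ) * Complex.I) * Complex.exp (w * α) =
      (rexp (x * α) : ℂ) * Complex.exp (((α - 1 / 2) * θ : ℝ) * Complex.I) := by
    rw [Complex.ofReal_exp, ← Complex.exp_add, ← Complex.exp_add]
    congr 1
    simp only [w]
    push_cast
    ring
  have h_int : Integrable (fun α : ℝ ↦ Complex.exp (-(θ / 2 : ℝ) * Complex.I) *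
      Complex.exp (w * α)) ν := (integrable_cexp_mul_of_ae_mem_Ioo hν w).const_mul _
  have hre (α : ℝ) : (Complex.exp (-(θ / 2 : ℝ) * Complex.I) * Complex.exp (w * α)).re =
      rexp (x * α) * cos ((α - 1 / 2) * θ) := by
    rw [key, Complex.re_ofReal_mul, Complex.exp_ofReal_mul_I_re]
  calc sineMoment ν (rexp x)
      ≤ ∫ α, (Complex.exp (-(θ / 2 : ℝ) * Complex.I) * Complex.exp (w * α)).re ∂ν := by
        refine integral_mono_ae (integrable_sin_mul_rpow hν (exp_pos x)) h_int.re ?_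
        filter_upwards [hν] with α hα
        rw [hre, ← exp_mul, mul_comm]
        gcongr
        exact sin_pi_mul_le_cos_mul hα hθ
    _ = (∫ α, Complex.exp (-(θ / 2 : ℝ) * Complex.I) * Complex.exp (w * α) ∂ν).re :=
        integral_re h_int
    _ ≤ ‖∫ α, Complex.exp (-(θ / 2 : ℝ) * Complex.I) * Complex.exp (w * α) ∂ν‖ :=
        Complex.re_le_norm _
    _ = ‖complexMGF id ν w‖ := by
        rw [integral_const_mul, norm_mul, ← Complex.ofReal_neg, Complex.norm_exp_ofReal_mul_I,
          one_mul]
        rfl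

/-- `S(r)` grows at least like a positive power at infinity, and decays at most like a power of
exponent less than one at the origin. -/
lemma exists_mul_min_rpow_le_sineMoment (hν : ∀ᵐ α ∂ν, α ∈ Ioo (0 : ℝ) 1) (hν0 : ν ≠ 0) :
    ∃ a ∈ Ioo (0 : ℝ) 1, ∃ c > 0, ∀ r > 0, c * min (r ^ a) (r ^ (1 - a)) ≤ sineMoment ν r := by
  obtain ⟨n, hn⟩ : ∃ n : ℕ, ν (Icc (1 / (n + 2 : ℝ)) (1 - 1 / (n + 2))) ≠ 0 := by
    by_contra! h
    refine hν0 (Measure.measure_univ_eq_zero.1 ?_)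
    refine measure_mono_null (t := (⋃ n : ℕ, Icc (1 / (n + 2 : ℝ)) (1 - 1 / (n + 2))) ∪
      (Ioo 0 1)ᶜ) ?_ (measure_union_null (measure_iUnion_null h) (ae_iff.1 hν))
    intro α _
    by_cases hα : α ∈ Ioo (0 : ℝ) 1
    · left
      obtain ⟨n, hn⟩ := exists_nat_one_div_lt (lt_min hα.1 (sub_pos.2 hα.2))
      have : 1 / (n + 2 : ℝ) ≤ 1 / (n + 1) := by gcongr; norm_num
      exact mem_iUnion.2 ⟨n, by linarith [min_le_left α (1 - α)],
        by linarith [min_le_right α (1 - α)]⟩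
    · exact Or.inr hα
  set a : ℝ := 1 / (n + 2)
  have ha0 : 0 < a := by positivity
  have ha2 : a ≤ 1 / 2 := by
    simp only [a]; gcongr; linarith [(n.cast_nonneg : (0 : ℝ) ≤ n)]
  have hsin : 0 < sin (π * a) :=
    sin_pos_of_pos_of_lt_pi (by positivity) (by nlinarith [pi_pos])
  refine ⟨a, ⟨ha0, by linarith⟩, sin (π * a) * ν.real (Icc a (1 - a)),
    mul_pos hsin (ENNReal.toReal_pos hn (measure_ne_top _ _)), fun r hr ↦ ?_⟩
  have hnn : ∀ᵐ α ∂ν, 0 ≤ sin (π * α) * r ^ α := by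
    filter_upwards [hν] with α hα
    have : 0 ≤ sin (π * α) := sin_nonneg_of_nonneg_of_le_pi (by nlinarith [pi_pos, hα.1])
      (by nlinarith [pi_pos, hα.2])
    positivity
  calc sin (π * a) * ν.real (Icc a (1 - a)) * min (r ^ a) (r ^ (1 - a))
      = ∫ _ in Icc a (1 - a), sin (π * a) * min (r ^ a) (r ^ (1 - a)) ∂ν := by
        rw [setIntegral_const, smul_eq_mul]; ring
    _ ≤ ∫ α in Icc a (1 - a), sin (π * α) * r ^ α ∂ν := by
        refine setIntegral_mono_on (integrable_const _)
          (integrable_sin_mul_rpow hν hr).integrableOn measurableSet_Icc fun α hα ↦ ?_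
        have h1 : sin (π * a) ≤ sin (π * α) := by
          rcases le_total α (1 / 2) with h | h
          · exact sin_le_sin_of_le_of_le_pi_div_two (by nlinarith [pi_pos])
              (by nlinarith [pi_pos]) (by gcongr; exact hα.1)
          · rw [← sin_pi_sub (π * α)]
            exact sin_le_sin_of_le_of_le_pi_div_two (by nlinarith [pi_pos])
              (by nlinarith [pi_pos]) (by nlinarith [pi_pos, hα.2])
        have h2 : min (r ^ a) (r ^ (1 - a)) ≤ r ^ α := by
          rcases le_total 1 r with h | h
          · exact (min_le_left _ _).trans (rpow_le_rpow_of_exponent_le h hα.1)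
          · exact (min_le_right _ _).trans (rpow_le_rpow_of_exponent_ge hr h hα.2)
        have : 0 ≤ min (r ^ a) (r ^ (1 - a)) := by positivity
        exact mul_le_mul h1 h2 this (hsin.le.trans h1)
    _ ≤ sineMoment ν r := setIntegral_le_integral (integrable_sin_mul_rpow hν hr) hnn

lemma sineMoment_pos (hν : ∀ᵐ α ∂ν, α ∈ Ioo (0 : ℝ) 1) (hν0 : ν ≠ 0) {r : ℝ} (hr : 0 < r) :
    0 < sineMoment ν r := by
  obtain ⟨a, _, c, hc, h⟩ := exists_mul_min_rpow_le_sineMoment hν hν0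
  exact lt_of_lt_of_le (by positivity) (h r hr)

lemma complexMGF_ne_zero (hν : ∀ᵐ α ∂ν, α ∈ Ioo (0 : ℝ) 1) (hν0 : ν ≠ 0) {w : ℂ}
    (hw : |w.im| ≤ π) : complexMGF id ν w ≠ 0 := by
  have := sineMoment_exp_le_norm_complexMGF hν w.re hw
  rw [Complex.re_add_im] at this
  exact norm_pos_iff.1 ((sineMoment_pos hν hν0 (exp_pos _)).trans_le this)

lemma exists_inv_sineMoment_le (hν : ∀ᵐ α ∂ν, α ∈ Ioo (0 : ℝ) 1) (hν0 : ν ≠ 0) :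
    ∃ a ∈ Ioo (0 : ℝ) 1, ∃ c > 0, ∀ r > 0,
      (sineMoment ν r)⁻¹ ≤ c * (r ^ (-a) + r ^ (a - 1)) := by
  obtain ⟨a, ha, c, hc, h⟩ := exists_mul_min_rpow_le_sineMoment hν hν0
  refine ⟨a, ha, c⁻¹, by positivity, fun r hr ↦ ?_⟩
  calc (sineMoment ν r)⁻¹ ≤ (c * min (r ^ a) (r ^ (1 - a)))⁻¹ := by
        gcongr
        exact h r hr
    _ = c⁻¹ * (min (r ^ a) (r ^ (1 - a)))⁻¹ := mul_inv _ _
    _ ≤ c⁻¹ * (r ^ (-a) + r ^ (a - 1)) := by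
        gcongr
        rw [rpow_neg hr.le, ← neg_sub 1 a, rpow_neg hr.le]
        rcases min_choice (r ^ a) (r ^ (1 - a)) with h | h <;> rw [h]
        · exact le_add_of_nonneg_right (by positivity)
        · exact le_add_of_nonneg_left (by positivity)

end Symbol

section Density

variable {ν : Measure ℝ} [IsFiniteMeasure ν]

lemma continuousOn_sineMoment (hν : ∀ᵐ α ∂ν, α ∈ Ioo (0 : ℝ) 1) :
    ContinuousOn (sineMoment ν) (Ioi 0) := by
  have hd := (differentiable_complexMGF_of_ae_mem_Ioo hν).continuous
  have : ContinuousOn (fun r : ℝ ↦ (complexMGF id ν (log r + π * Complex.I)).im) (Ioi 0) := by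
    have := continuousOn_log.mono (fun r (hr : r ∈ Ioi (0 : ℝ)) ↦ (ne_of_gt hr : r ≠ 0))
    fun_prop
  refine this.congr fun r hr ↦ ?_
  simp [complexMGF_log_add_pi hν hr]

lemma continuousOn_cosineMoment (hν : ∀ᵐ α ∂ν, α ∈ Ioo (0 : ℝ) 1) :
    ContinuousOn (cosineMoment ν) (Ioi 0) := by
  have hd := (differentiable_complexMGF_of_ae_mem_Ioo hν).continuous
  have : ContinuousOn (fun r : ℝ ↦ (complexMGF id ν (log r + π * Complex.I)).re) (Ioi 0) := by
    have := continuousOn_log.mono (fun r (hr : r ∈ Ioi (0 : ℝ)) ↦ (ne_of_gt hr : r ≠ 0))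
    fun_prop
  refine this.congr fun r hr ↦ ?_
  simp [complexMGF_log_add_pi hν hr]

lemma continuousOn_stieltjesDensity (hν : ∀ᵐ α ∂ν, α ∈ Ioo (0 : ℝ) 1) (hν0 : ν ≠ 0) :
    ContinuousOn (stieltjesDensity ν) (Ioi 0) := by
  have h1 := continuousOn_sineMoment hν
  have h2 := continuousOn_cosineMoment hν
  refine h1.div (by fun_prop) fun r hr ↦ ?_
  have := sineMoment_pos hν hν0 hr
  positivity

lemma stieltjesDensity_nonneg (hν : ∀ᵐ α ∂ν, α ∈ Ioo (0 : ℝ) 1) (hν0 : ν ≠ 0) {r : ℝ}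
    (hr : 0 < r) : 0 ≤ stieltjesDensity ν r := by
  have := sineMoment_pos hν hν0 hr
  unfold stieltjesDensity
  positivity

lemma stieltjesDensity_le (hν : ∀ᵐ α ∂ν, α ∈ Ioo (0 : ℝ) 1) (hν0 : ν ≠ 0) {r : ℝ}
    (hr : 0 < r) : stieltjesDensity ν r ≤ (sineMoment ν r)⁻¹ := by
  have := sineMoment_pos hν hν0 hr
  rw [stieltjesDensity, div_le_iff₀ (by positivity), mul_add, sq, inv_mul_cancel_left₀ this.ne']
  exact le_add_of_nonneg_right (by positivity)

lemma integrableOn_rpow_div_add {s σ : ℝ} (hs : s ∈ Ioo (-1 : ℝ) 0) (hσ : 0 < σ) :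
    IntegrableOn (fun r : ℝ ↦ r ^ s / (σ + r)) (Ioi 0) := by
  have hc : ContinuousOn (fun r : ℝ ↦ r ^ s / (σ + r)) (Ioi 0) := fun r hr ↦
    ((continuousAt_rpow_const _ _ (Or.inl (ne_of_gt hr))).div (by fun_prop)
      (by have : 0 < r := hr; positivity)).continuousWithinAt
  rw [← Ioc_union_Ioi_eq_Ioi zero_le_one]
  refine IntegrableOn.union ?_ ?_
  · rw [integrableOn_Ioc_iff_integrableOn_Ioo]
    refine Integrable.mono'
      (((intervalIntegral.integrableOn_Ioo_rpow_iff one_pos).2 hs.1).div_const σ)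
      ((hc.mono Ioo_subset_Ioi_self).aestronglyMeasurable measurableSet_Ioo) ?_
    filter_upwards [ae_restrict_mem measurableSet_Ioo] with r hr
    have := hr.1
    rw [norm_of_nonneg (by positivity)]
    gcongr
    linarith
  · refine Integrable.mono'
      (integrableOn_Ioi_rpow_of_lt (show s - 1 < -1 by linarith [hs.2]) one_pos)
      ((hc.mono (Ioi_subset_Ioi zero_le_one)).aestronglyMeasurable measurableSet_Ioi) ?_
    filter_upwards [ae_restrict_mem measurableSet_Ioi] with r hr
    have : 0 < r := one_pos.trans hr
    rw [norm_of_nonneg (by positivity), rpow_sub_one this.ne']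
    gcongr
    linarith

lemma integrableOn_stieltjesDensity_div_add (hν : ∀ᵐ α ∂ν, α ∈ Ioo (0 : ℝ) 1) (hν0 : ν ≠ 0)
    {σ : ℝ} (hσ : 0 < σ) :
    IntegrableOn (fun r : ℝ ↦ stieltjesDensity ν r / (σ + r)) (Ioi 0) := by
  obtain ⟨a, ha, c, hc, h⟩ := exists_inv_sineMoment_le hν hν0
  have hi := ((integrableOn_rpow_div_add (s := -a) ⟨by linarith [ha.2], by linarith [ha.1]⟩ hσ).add
    (integrableOn_rpow_div_add (s := a - 1) ⟨by linarith [ha.1], by linarith [ha.2]⟩ hσ)).const_mul c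
  refine Integrable.mono' hi (ContinuousOn.aestronglyMeasurable ?_ measurableSet_Ioi) ?_
  · refine (continuousOn_stieltjesDensity hν hν0).div (by fun_prop) fun r hr ↦ ?_
    have : 0 < r := hr
    positivity
  · filter_upwards [ae_restrict_mem measurableSet_Ioi] with r hr
    have hr' : 0 < r := hr
    have := stieltjesDensity_nonneg hν hν0 hr'
    rw [norm_of_nonneg (by positivity), Pi.add_apply, ← add_div, ← mul_div_assoc]
    gcongr
    exact (stieltjesDensity_le hν hν0 hr').trans (h r hr')

end Density

section Stieltjes

variable {ν : Measure ℝ} [IsFiniteMeasure ν]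

lemma tendsto_inv_sineMoment_atTop (hν : ∀ᵐ α ∂ν, α ∈ Ioo (0 : ℝ) 1) (hν0 : ν ≠ 0) :
    Tendsto (fun r ↦ (sineMoment ν r)⁻¹) atTop (𝓝 0) := by
  obtain ⟨a, ha, c, hc, h⟩ := exists_inv_sineMoment_le hν hν0
  have hlim : Tendsto (fun r : ℝ ↦ c * (r ^ (-a) + r ^ (a - 1))) atTop (𝓝 0) := by
    have h1 := tendsto_rpow_neg_atTop ha.1
    have h2 := tendsto_rpow_neg_atTop (sub_pos.2 ha.2)
    simpa using (h1.add h2).const_mul c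
  refine squeeze_zero' ?_ ?_ hlim <;> filter_upwards [eventually_gt_atTop 0] with r hr
  · exact inv_nonneg.2 (sineMoment_pos hν hν0 hr).le
  · exact h r hr

lemma tendsto_mul_inv_sineMoment_zero (hν : ∀ᵐ α ∂ν, α ∈ Ioo (0 : ℝ) 1) (hν0 : ν ≠ 0) :
    Tendsto (fun r ↦ r * (sineMoment ν r)⁻¹) (𝓝[>] 0) (𝓝 0) := by
  obtain ⟨a, ha, c, hc, h⟩ := exists_inv_sineMoment_le hν hν0
  have hlim : Tendsto (fun r : ℝ ↦ c * (r ^ (1 - a) + r ^ a)) (𝓝[>] 0) (𝓝 0) := by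
    have h1 : Tendsto (fun r : ℝ ↦ c * (r ^ (1 - a) + r ^ a)) (𝓝 0)
        (𝓝 (c * ((0 : ℝ) ^ (1 - a) + (0 : ℝ) ^ a))) :=
      (((continuousAt_rpow_const _ _ (Or.inr (sub_pos.2 ha.2).le)).add
        (continuousAt_rpow_const _ _ (Or.inr ha.1.le))).const_mul c)
    rw [zero_rpow (sub_pos.2 ha.2).ne', zero_rpow ha.1.ne', add_zero, mul_zero] at h1
    exact h1.mono_left nhdsWithin_le_nhds
  refine squeeze_zero' ?_ ?_ hlim <;> filter_upwards [self_mem_nhdsWithin] with r hr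
  · exact mul_nonneg (le_of_lt hr) (inv_nonneg.2 (sineMoment_pos hν hν0 hr).le)
  · have hr : 0 < r := hr
    calc r * (sineMoment ν r)⁻¹ ≤ r * (c * (r ^ (-a) + r ^ (a - 1))) := by
          gcongr
          exact h r hr
      _ = c * (r ^ (1 - a) + r ^ a) := by
          rw [rpow_sub hr a, rpow_sub hr 1, rpow_neg hr.le, rpow_one]
          field_simp

lemma eq_of_cexp_eq_of_abs_im {w z : ℂ} (h : Complex.exp w = Complex.exp z) (hw : |w.im| ≤ π)
    (hz : |z.im| < π) : w = z := by
  obtain ⟨n, hn⟩ := Complex.exp_eq_exp_iff_exists_int.1 h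
  have him : w.im = z.im + n * (2 * π) := by simpa using congrArg Complex.im hn
  have hn0 : n = 0 := by
    rw [abs_le] at hw
    rw [abs_lt] at hz
    have h1 : (n : ℝ) < 1 := by nlinarith [pi_pos]
    have h2 : (-1 : ℝ) < n := by nlinarith [pi_pos]
    have h1' : n < 1 := by exact_mod_cast h1
    have h2' : -1 < n := by exact_mod_cast h2
    omega
  simpa [hn0] using hn

/-- Analytic extension through `z` of `w ↦ exp w / (exp w - exp z) * (F w - F z)`. -/
noncomputable def expCauchyQuotient (F : ℂ → ℂ) (z w : ℂ) : ℂ :=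
  Complex.exp w * (dslope F z w / dslope Complex.exp z w)

lemma expCauchyQuotient_of_ne (F : ℂ → ℂ) {z w : ℂ} (h : w ≠ z) :
    expCauchyQuotient F z w =
      Complex.exp w / (Complex.exp w - Complex.exp z) * (F w - F z) := by
  have h' : w - z ≠ 0 := sub_ne_zero.2 h
  rw [expCauchyQuotient, dslope_of_ne _ h, dslope_of_ne _ h, slope_def_field, slope_def_field,
    div_div_div_cancel_right₀ h']
  ring

lemma differentiableOn_expCauchyQuotient {F : ℂ → ℂ} {z : ℂ} {s : Set ℂ} (hs : s ∈ 𝓝 z)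
    (hF : DifferentiableOn ℂ F s) (him : ∀ w ∈ s, |w.im| ≤ π) (hz : |z.im| < π) :
    DifferentiableOn ℂ (expCauchyQuotient F z) s := by
  refine Complex.differentiable_exp.differentiableOn.mul (((Complex.differentiableOn_dslope hs).2
    hF).div ((Complex.differentiableOn_dslope hs).2 Complex.differentiable_exp.differentiableOn)
    fun w hw ↦ ?_)
  rcases eq_or_ne w z with rfl | hwz
  · simp [dslope_same, Complex.exp_ne_zero]
  · rw [dslope_of_ne _ hwz, slope_def_field]
    exact div_ne_zero (sub_ne_zero.2 fun h ↦ hwz (eq_of_cexp_eq_of_abs_im h (him w hw) hz))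
      (sub_ne_zero.2 hwz)

lemma norm_exp_div_mul_sub_add_le {E p F F₀ : ℂ} (h : ‖p‖ < ‖E‖) :
    ‖E / (E - p) * (F - F₀) + F₀‖ ≤ (‖F‖ + ‖p * F₀‖ * ‖E‖⁻¹) / (1 - ‖p‖ * ‖E‖⁻¹) := by
  have hE : 0 < ‖E‖ := (norm_nonneg _).trans_lt h
  have hsub : ‖E‖ - ‖p‖ ≤ ‖E - p‖ := norm_sub_norm_le _ _
  have hne : E - p ≠ 0 := norm_pos_iff.1 (by linarith)
  have heq : E / (E - p) * (F - F₀) + F₀ = (E * F - p * F₀) / (E - p) := by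
    field_simp
    ring
  calc ‖E / (E - p) * (F - F₀) + F₀‖ = ‖E * F - p * F₀‖ / ‖E - p‖ := by rw [heq, norm_div]
    _ ≤ (‖E‖ * ‖F‖ + ‖p * F₀‖) / (‖E‖ - ‖p‖) := by
        have : 0 < ‖E‖ - ‖p‖ := by linarith
        gcongr
        exact (norm_sub_le _ _).trans_eq (by rw [norm_mul])
    _ = (‖F‖ + ‖p * F₀‖ * ‖E‖⁻¹) / (1 - ‖p‖ * ‖E‖⁻¹) := by
        have : ‖E‖ - ‖p‖ ≠ 0 := by linarith
        field_simp

lemma norm_exp_div_mul_sub_le {E p F F₀ : ℂ} (h : ‖E‖ < ‖p‖) :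
    ‖E / (E - p) * (F - F₀)‖ ≤ (‖E‖ * ‖F‖ + ‖E‖ * ‖F₀‖) / (‖p‖ - ‖E‖) := by
  have hsub : ‖p‖ - ‖E‖ ≤ ‖E - p‖ := norm_sub_rev E p ▸ norm_sub_norm_le _ _
  have : 0 < ‖p‖ - ‖E‖ := by linarith
  rw [norm_mul, norm_div, div_mul_eq_mul_div, ← mul_add]
  gcongr
  exact norm_sub_le _ _

/-- The jump of the Cauchy integrand across the cut `(-∞, 0)`, in logarithmic coordinates. -/
lemma expCauchyQuotient_jump (hν : ∀ᵐ α ∂ν, α ∈ Ioo (0 : ℝ) 1) (hν0 : ν ≠ 0) {z : ℂ}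
    (hz : |z.im| < π) (hre : 0 < (Complex.exp z).re) (x : ℝ) :
    expCauchyQuotient (fun w ↦ (complexMGF id ν w)⁻¹) z (x + (-π : ℝ) * Complex.I) -
      expCauchyQuotient (fun w ↦ (complexMGF id ν w)⁻¹) z (x + π * Complex.I) =
    2 * Complex.I * (|rexp x| •
      ((stieltjesDensity ν (rexp x) : ℂ) / (Complex.exp z + (rexp x : ℝ)))) := by
  have hx := exp_pos x
  have e1 := complexMGF_log_add_pi hν hx
  have e2 := complexMGF_log_sub_pi hν hx
  rw [log_exp] at e1 e2
  have n1 : (x + (-π : ℝ) * Complex.I : ℂ) ≠ z := fun h ↦ by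
    have : -π = z.im := by simpa using congrArg Complex.im h
    rw [← this, abs_neg, abs_of_pos pi_pos] at hz
    exact hz.false
  have n2 : (x + π * Complex.I : ℂ) ≠ z := fun h ↦ by
    have : π = z.im := by simpa using congrArg Complex.im h
    rw [← this, abs_of_pos pi_pos] at hz
    exact hz.false
  rw [expCauchyQuotient_of_ne _ n1, expCauchyQuotient_of_ne _ n2]
  have x1 : Complex.exp (x + (-π : ℝ) * Complex.I) = -(rexp x : ℝ) := by
    rw [Complex.exp_add]; simp [Complex.exp_neg]
  have x2 : Complex.exp (x + π * Complex.I) = -(rexp x : ℝ) := by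
    rw [Complex.exp_add]; simp
  rw [x1, x2, show (x + (-π : ℝ) * Complex.I : ℂ) = x - π * Complex.I by push_cast; ring, e1, e2]
  have hS := sineMoment_pos hν hν0 hx
  have hsum : Complex.exp z + (rexp x : ℝ) ≠ 0 := fun h ↦ by
    have := congrArg Complex.re h
    rw [Complex.add_re, Complex.ofReal_re, Complex.zero_re] at this
    linarith
  have hsum' : -((rexp x : ℝ) : ℂ) - Complex.exp z ≠ 0 := fun h ↦ hsum (by linear_combination -h)
  have hquot : -((rexp x : ℝ) : ℂ) / (-(rexp x : ℝ) - Complex.exp z) =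
      (rexp x : ℝ) / (Complex.exp z + (rexp x : ℝ)) := by
    rw [div_eq_div_iff hsum' hsum]
    ring
  have hinv : ((cosineMoment ν (rexp x) : ℂ) - sineMoment ν (rexp x) * Complex.I)⁻¹ -
      (cosineMoment ν (rexp x) + sineMoment ν (rexp x) * Complex.I)⁻¹ =
        2 * Complex.I * stieltjesDensity ν (rexp x) := by
    have hne : ((sineMoment ν (rexp x) : ℂ) ^ 2 + (cosineMoment ν (rexp x) : ℂ) ^ 2) ≠ 0 := by
      exact_mod_cast (by positivity :
        sineMoment ν (rexp x) ^ 2 + cosineMoment ν (rexp x) ^ 2 ≠ 0)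
    have hmul : ((cosineMoment ν (rexp x) : ℂ) - sineMoment ν (rexp x) * Complex.I) *
        (cosineMoment ν (rexp x) + sineMoment ν (rexp x) * Complex.I) =
          (sineMoment ν (rexp x) : ℂ) ^ 2 + (cosineMoment ν (rexp x) : ℂ) ^ 2 := by
      linear_combination -(sineMoment ν (rexp x) : ℂ) ^ 2 * Complex.I_sq
    rw [inv_sub_inv (left_ne_zero_of_mul (hmul ▸ hne)) (right_ne_zero_of_mul (hmul ▸ hne)), hmul,
      stieltjesDensity]
    push_cast
    ring
  rw [hquot, abs_of_pos hx, Complex.real_smul]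
  linear_combination ((rexp x : ℝ) : ℂ) / (Complex.exp z + (rexp x : ℝ)) * hinv

/-- Stieltjes representation of `1 / ∫ p ^ α dν(α)`. -/
theorem integral_stieltjesDensity_div_add (hν : ∀ᵐ α ∂ν, α ∈ Ioo (0 : ℝ) 1) (hν0 : ν ≠ 0)
    {p : ℂ} (hp : 0 < p.re) :
    ∫ r in Ioi (0 : ℝ), (stieltjesDensity ν r : ℂ) / (p + r) =
      π * (complexMGF id ν (Complex.log p))⁻¹ := by
  have hp0 : p ≠ 0 := fun h ↦ by simp [h] at hp
  set z := Complex.log p with hz_def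
  have hez : Complex.exp z = p := Complex.exp_log hp0
  have hzim : |z.im| < π := by
    rw [hz_def, Complex.log_im]
    exact (Complex.abs_arg_lt_pi_div_two_iff.2 (Or.inl hp)).trans (by linarith [pi_pos])
  set F : ℂ → ℂ := fun w ↦ (complexMGF id ν w)⁻¹ with hF
  set G : ℝ → ℂ := fun r ↦ (stieltjesDensity ν r : ℂ) / (p + r)
  have hG : IntegrableOn G (Ioi 0) := by
    refine Integrable.mono' (integrableOn_stieltjesDensity_div_add hν hν0 hp)
      (ContinuousOn.aestronglyMeasurable ?_ measurableSet_Ioi) ?_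
    · have := continuousOn_stieltjesDensity hν hν0
      refine ContinuousOn.div (by fun_prop) (by fun_prop) fun r hr h ↦ ?_
      have hr : 0 < r := hr
      have := congrArg Complex.re h
      simp at this
      linarith
    · filter_upwards [ae_restrict_mem measurableSet_Ioi] with r hr
      have hr : 0 < r := hr
      have hd := stieltjesDensity_nonneg hν hν0 hr
      rw [norm_div, Complex.norm_of_nonneg hd]
      gcongr
      simpa using Complex.re_le_norm (p + r)
  have himage : rexp '' univ = Ioi 0 := by rw [image_univ, range_exp]
  have hexp : ∀ x ∈ univ, HasDerivWithinAt rexp (rexp x) univ x := fun x _ ↦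
    (hasDerivAt_exp x).hasDerivWithinAt
  have hGexp : Integrable (fun x ↦ |rexp x| • G (rexp x)) := by
    rw [← integrableOn_univ, ← integrableOn_image_iff_integrableOn_abs_deriv_smul
      MeasurableSet.univ hexp exp_injective.injOn G, himage]
    exact hG
  have hGint : ∫ r in Ioi (0 : ℝ), G r = ∫ x, |rexp x| • G (rexp x) := by
    rw [← setIntegral_univ (f := fun x ↦ |rexp x| • G (rexp x)),
      ← integral_image_eq_integral_abs_deriv_smul MeasurableSet.univ hexp exp_injective.injOn G,
      himage]
  have hlim1 : Tendsto (fun R : ℝ ↦ ∫ x in (-R)..R, |rexp x| • G (rexp x)) atTop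
      (𝓝 (∫ r in Ioi (0 : ℝ), G r)) := by
    rw [hGint]
    exact intervalIntegral_tendsto_integral hGexp tendsto_neg_atTop_atBot tendsto_id
  have hFbound (x y : ℝ) (hy : |y| ≤ π) :
      ‖F (x + y * Complex.I)‖ ≤ (sineMoment ν (rexp x))⁻¹ := by
    rw [hF, norm_inv]
    have := sineMoment_pos hν hν0 (exp_pos x)
    gcongr
    exact sineMoment_exp_le_norm_complexMGF hν x hy
  set E₁ : ℝ → ℝ := fun r ↦ ((sineMoment ν r)⁻¹ + ‖p * F z‖ * r⁻¹) / (1 - ‖p‖ * r⁻¹)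
  set E₂ : ℝ → ℝ := fun r ↦ (r * (sineMoment ν r)⁻¹ + r * ‖F z‖) / (‖p‖ - r)
  have hE₁ : Tendsto (fun R ↦ E₁ (rexp R)) atTop (𝓝 0) := by
    have : Tendsto E₁ atTop (𝓝 ((0 + ‖p * F z‖ * 0) / (1 - ‖p‖ * 0))) :=
      ((tendsto_inv_sineMoment_atTop hν hν0).add (tendsto_inv_atTop_zero.const_mul _)).div
        (tendsto_const_nhds.sub (tendsto_inv_atTop_zero.const_mul _)) (by simp)
    simp only [mul_zero, add_zero, zero_div] at this
    exact this.comp tendsto_exp_atTop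
  have hE₂ : Tendsto (fun R ↦ E₂ (rexp (-R))) atTop (𝓝 0) := by
    have hid : Tendsto (fun r : ℝ ↦ r) (𝓝[>] 0) (𝓝 0) := nhdsWithin_le_nhds
    have : Tendsto E₂ (𝓝[>] 0) (𝓝 ((0 + 0 * ‖F z‖) / (‖p‖ - 0))) :=
      ((tendsto_mul_inv_sineMoment_zero hν hν0).add (hid.mul_const _)).div
        (tendsto_const_nhds.sub hid) (by simpa using hp0)
    simp only [zero_mul, add_zero, zero_div] at this
    exact this.comp (tendsto_exp_atBot_nhdsGT.comp tendsto_neg_atTop_atBot)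
  have hbound : ∀ᶠ R : ℝ in atTop,
      ‖2 * Complex.I * (∫ x in (-R)..R, |rexp x| • G (rexp x)) - 2 * Complex.I * (π * F z)‖ ≤
        (E₁ (rexp R) + E₂ (rexp (-R))) * (2 * π) := by
    have hlarge : ∀ᶠ R : ℝ in atTop, ‖p‖ < rexp R := tendsto_exp_atTop.eventually_gt_atTop _
    have hsmall : ∀ᶠ R : ℝ in atTop, rexp (-R) < ‖p‖ :=
      (tendsto_exp_atBot.comp tendsto_neg_atTop_atBot).eventually_lt_const (norm_pos_iff.2 hp0)
    filter_upwards [hlarge, hsmall, eventually_gt_atTop |z.re|] with R hR1 hR2 hR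
    have hR0 : 0 < R := (abs_nonneg _).trans_lt hR
    have hπ : -π ≤ π := by linarith [pi_pos]
    set f := expCauchyQuotient F z
    have hdiff : DifferentiableOn ℂ f (uIcc (-R) R ×ℂ uIcc (-π) π) := by
      rw [uIcc_of_le (by linarith), uIcc_of_le hπ]
      refine differentiableOn_expCauchyQuotient ?_ ?_ (fun w hw ↦ abs_le.2 hw.2) hzim
      · refine mem_of_superset ((isOpen_Ioo.reProdIm isOpen_Ioo).mem_nhds
          (⟨abs_lt.1 hR, abs_lt.1 hzim⟩ : z ∈ Ioo (-R) R ×ℂ Ioo (-π) π)) fun w hw ↦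
          ⟨Ioo_subset_Icc_self hw.1, Ioo_subset_Icc_self hw.2⟩
      · exact (differentiable_complexMGF_of_ae_mem_Ioo hν).differentiableOn.inv
          fun w hw ↦ complexMGF_ne_zero hν hν0 (abs_le.2 hw.2)
    have hhor (y : ℝ) (hy : y ∈ uIcc (-π) π) :
        IntervalIntegrable (fun x : ℝ ↦ f (x + y * Complex.I)) volume (-R) R :=
      (hdiff.continuousOn.comp (by fun_prop) fun x hx ↦
        by simpa [Complex.mem_reProdIm] using ⟨hx, hy⟩).intervalIntegrable
    have hver (x : ℝ) (hx : x ∈ uIcc (-R) R) :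
        IntervalIntegrable (fun y : ℝ ↦ f (x + y * Complex.I)) volume (-π) π :=
      (hdiff.continuousOn.comp (by fun_prop) fun y hy ↦
        by simpa [Complex.mem_reProdIm] using ⟨hx, hy⟩).intervalIntegrable
    have hrect := Complex.integral_boundary_rect_eq_zero_of_differentiableOn f ⟨-R, -π⟩ ⟨R, π⟩ hdiff
    dsimp only at hrect
    have hjump : (∫ x in (-R)..R, f (x + (-π : ℝ) * Complex.I)) -
        ∫ x in (-R)..R, f (x + π * Complex.I) =
          2 * Complex.I * ∫ x in (-R)..R, |rexp x| • G (rexp x) := by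
      rw [← intervalIntegral.integral_sub (hhor _ left_mem_uIcc) (hhor _ right_mem_uIcc),
        ← intervalIntegral.integral_const_mul]
      refine intervalIntegral.integral_congr fun x _ ↦ ?_
      have := expCauchyQuotient_jump hν hν0 hzim (hez ▸ hp) x
      rwa [hez] at this
    have hright : ∫ y in (-π)..π, (f (R + y * Complex.I) + F z) =
        (∫ y in (-π)..π, f (R + y * Complex.I)) + 2 * π * F z := by
      rw [intervalIntegral.integral_add (hver _ right_mem_uIcc) intervalIntegrable_const,
        intervalIntegral.integral_const, Complex.real_smul]
      push_cast
      ring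
    have hnorm (x y : ℝ) : ‖Complex.exp (x + y * Complex.I)‖ = rexp x := by
      simp [Complex.norm_exp]
    have hB₁ : ‖∫ y in (-π)..π, (f (R + y * Complex.I) + F z)‖ ≤ E₁ (rexp R) * (2 * π) := by
      have := intervalIntegral.norm_integral_le_of_norm_le_const (a := -π) (b := π)
        (C := E₁ (rexp R)) (f := fun y : ℝ ↦ f (R + y * Complex.I) + F z) fun y hy ↦ ?_
      · rwa [show π - -π = 2 * π by ring, abs_of_pos (by positivity)] at this
      · rw [uIoc_of_le hπ] at hy
        have hne : (R + y * Complex.I : ℂ) ≠ z := fun h ↦ by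
          have := hnorm R y
          rw [h, hez] at this
          exact hR1.ne this
        have hlt : ‖p‖ < ‖Complex.exp (R + y * Complex.I)‖ := (hnorm R y).symm ▸ hR1
        have hpos : 0 < 1 - ‖p‖ * (rexp R)⁻¹ := by
          rw [sub_pos, ← div_eq_mul_inv, div_lt_one (exp_pos R)]
          exact hR1
        simp only [f]
        rw [expCauchyQuotient_of_ne _ hne, hez]
        refine (norm_exp_div_mul_sub_add_le hlt).trans ?_
        simp only [hnorm, E₁]
        gcongr
        exact hFbound R y (abs_le.2 ⟨hy.1.le, hy.2⟩)
    have hB₂ : ‖∫ y in (-π)..π, f ((-R : ℝ) + y * Complex.I)‖ ≤ E₂ (rexp (-R)) * (2 * π) := by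
      have := intervalIntegral.norm_integral_le_of_norm_le_const (a := -π) (b := π)
        (C := E₂ (rexp (-R))) (f := fun y : ℝ ↦ f ((-R : ℝ) + y * Complex.I)) fun y hy ↦ ?_
      · rwa [show π - -π = 2 * π by ring, abs_of_pos (by positivity)] at this
      · rw [uIoc_of_le hπ] at hy
        have hne : ((-R : ℝ) + y * Complex.I : ℂ) ≠ z := fun h ↦ by
          have := hnorm (-R) y
          rw [h, hez] at this
          exact hR2.ne' this
        have hlt : ‖Complex.exp ((-R : ℝ) + y * Complex.I)‖ < ‖p‖ := (hnorm (-R) y).symm ▸ hR2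
        have hpos : 0 < ‖p‖ - rexp (-R) := sub_pos.2 hR2
        simp only [f]
        rw [expCauchyQuotient_of_ne _ hne, hez]
        refine (norm_exp_div_mul_sub_le hlt).trans ?_
        simp only [hnorm, E₂]
        gcongr
        exact hFbound (-R) y (abs_le.2 ⟨hy.1.le, hy.2⟩)
    rw [hjump, smul_eq_mul, smul_eq_mul] at hrect
    have hsolve : 2 * Complex.I * (∫ x in (-R)..R, |rexp x| • G (rexp x)) -
        2 * Complex.I * (π * F z) =
          Complex.I * (∫ y in (-π)..π, f ((-R : ℝ) + y * Complex.I)) -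
            Complex.I * ∫ y in (-π)..π, (f (R + y * Complex.I) + F z) := by
      rw [hright]
      linear_combination hrect
    rw [hsolve]
    refine (norm_sub_le _ _).trans ?_
    rw [norm_mul, norm_mul, Complex.norm_I, one_mul, one_mul]
    linarith
  have hlim2 : Tendsto (fun R : ℝ ↦ 2 * Complex.I * (∫ x in (-R)..R, |rexp x| • G (rexp x))) atTop
      (𝓝 (2 * Complex.I * (π * F z))) := by
    rw [tendsto_iff_norm_sub_tendsto_zero]
    refine squeeze_zero' (Eventually.of_forall fun _ ↦ norm_nonneg _) hbound ?_
    simpa using (hE₁.add hE₂).mul_const (2 * π)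
  have := tendsto_nhds_unique (hlim1.const_mul (2 * Complex.I)) hlim2
  exact mul_left_cancel₀ (by simp) this

end Stieltjes

/-- The relaxation kernel `t ↦ (1 / π) ∫₀^∞ e ^ (-r t) w(r) dr`, where `w` is the density of the
Stieltjes representation of `1 / ∫ p ^ α dν(α)`. -/
noncomputable def relaxationKernel (ν : Measure ℝ) (t : ℝ) : ℝ :=
  (1 / π) * ∫ r in Ioi (0 : ℝ), rexp (-r * t) * stieltjesDensity ν r

lemma integral_cexp_mul_stieltjesDensity (ν : Measure ℝ) (p : ℂ) (t : ℝ) :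
    ∫ r in Ioi (0 : ℝ), Complex.exp (-(p + r) * t) * (stieltjesDensity ν r : ℂ) =
      π * (Complex.exp (-p * t) * (relaxationKernel ν t : ℂ)) := by
  have h : (relaxationKernel ν t : ℂ) = (π : ℂ)⁻¹ *
      ∫ r in Ioi (0 : ℝ), Complex.exp (-r * t) * (stieltjesDensity ν r : ℂ) := by
    rw [relaxationKernel, one_div]
    push_cast
    rw [← integral_complex_ofReal]
    push_cast
    rfl
  rw [h, mul_left_comm, mul_inv_cancel_left₀ (by exact_mod_cast pi_ne_zero), ← integral_const_mul]
  congr 1 with r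
  rw [← mul_assoc, ← Complex.exp_add]
  ring_nf

section Relaxation

variable {ν : Measure ℝ} [IsFiniteMeasure ν]

lemma integrableOn_exp_mul_stieltjesDensity (hν : ∀ᵐ α ∂ν, α ∈ Ioo (0 : ℝ) 1) (hν0 : ν ≠ 0)
    {t : ℝ} (ht : 0 < t) :
    IntegrableOn (fun r ↦ rexp (-r * t) * stieltjesDensity ν r) (Ioi 0) := by
  have hm := (continuousOn_stieltjesDensity hν hν0).aestronglyMeasurable measurableSet_Ioi
    (μ := volume)
  refine Integrable.mono' ((integrableOn_stieltjesDensity_div_add hν hν0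
    (inv_pos.2 ht)).const_mul t⁻¹) ((by fun_prop : AEStronglyMeasurable
      (fun r : ℝ ↦ rexp (-r * t)) _).mul hm) ?_
  filter_upwards [ae_restrict_mem measurableSet_Ioi] with r (hr : 0 < r)
  have hw := stieltjesDensity_nonneg hν hν0 hr
  rw [norm_of_nonneg (by positivity)]
  have hle : rexp (-r * t) ≤ t⁻¹ / (t⁻¹ + r) := by
    rw [neg_mul, exp_neg, show t⁻¹ / (t⁻¹ + r) = (r * t + 1)⁻¹ by field_simp; ring]
    exact inv_anti₀ (by positivity) (add_one_le_exp _)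
  calc rexp (-r * t) * stieltjesDensity ν r ≤ t⁻¹ / (t⁻¹ + r) * stieltjesDensity ν r := by gcongr
    _ = t⁻¹ * (stieltjesDensity ν r / (t⁻¹ + r)) := by ring

lemma relaxationKernel_nonneg (hν : ∀ᵐ α ∂ν, α ∈ Ioo (0 : ℝ) 1) (hν0 : ν ≠ 0) (t : ℝ) :
    0 ≤ relaxationKernel ν t := by
  refine mul_nonneg (by positivity) (setIntegral_nonneg measurableSet_Ioi fun r hr ↦ ?_)
  exact mul_nonneg (exp_pos _).le (stieltjesDensity_nonneg hν hν0 hr)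

lemma antitoneOn_relaxationKernel (hν : ∀ᵐ α ∂ν, α ∈ Ioo (0 : ℝ) 1) (hν0 : ν ≠ 0) :
    AntitoneOn (relaxationKernel ν) (Ioi 0) := by
  intro s hs t ht hst
  refine mul_le_mul_of_nonneg_left (setIntegral_mono_on
    (integrableOn_exp_mul_stieltjesDensity hν hν0 ht)
    (integrableOn_exp_mul_stieltjesDensity hν hν0 hs) measurableSet_Ioi fun r hr ↦ ?_)
    (by positivity)
  refine mul_le_mul_of_nonneg_right (exp_le_exp.2 ?_) (stieltjesDensity_nonneg hν hν0 hr)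
  nlinarith [mem_Ioi.1 hr]

lemma integrable_prod_exp_mul_stieltjesDensity (hν : ∀ᵐ α ∂ν, α ∈ Ioo (0 : ℝ) 1) (hν0 : ν ≠ 0)
    {p : ℂ} (hp : 0 < p.re) :
    Integrable (Function.uncurry fun r t : ℝ ↦
      Complex.exp (-(p + r) * t) * (stieltjesDensity ν r : ℂ))
      ((volume.restrict (Ioi 0)).prod (volume.restrict (Ioi 0))) := by
  have hm := (continuousOn_stieltjesDensity hν hν0).aestronglyMeasurable measurableSet_Ioi
    (μ := volume)
  have hm' : AEStronglyMeasurable (fun r ↦ (stieltjesDensity ν r : ℂ))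
    (volume.restrict (Ioi 0)) := Complex.continuous_ofReal.comp_aestronglyMeasurable hm
  have hre {r : ℝ} (hr : 0 < r) : (-(p + r)).re < 0 := by simp; linarith
  refine (integrable_prod_iff ?_).2 ⟨?_, ?_⟩
  · refine AEStronglyMeasurable.mul (f := fun x : ℝ × ℝ ↦ Complex.exp (-(p + x.1) * x.2))
      (g := fun x : ℝ × ℝ ↦ (stieltjesDensity ν x.1 : ℂ)) (by fun_prop) hm'.comp_fst
  · filter_upwards [ae_restrict_mem measurableSet_Ioi] with r (hr : 0 < r)
    exact (integrableOn_exp_mul_complex_Ioi (hre hr) 0).mul_const (stieltjesDensity ν r : ℂ)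
  · refine (integrableOn_stieltjesDensity_div_add hν hν0 hp).congr ?_
    filter_upwards [ae_restrict_mem measurableSet_Ioi] with r (hr : 0 < r)
    simp only [Function.uncurry, norm_mul, Complex.norm_exp, Complex.norm_real,
      norm_of_nonneg (stieltjesDensity_nonneg hν hν0 hr), Complex.re_mul_ofReal]
    rw [integral_mul_const, integral_exp_mul_Ioi (hre hr)]
    simp only [mul_zero, exp_zero, Complex.neg_re, Complex.add_re, Complex.ofReal_re, neg_div_neg_eq]
    ring

/-- The Laplace transform of the relaxation kernel converges absolutely on the right half-plane. -/
lemma integrableOn_cexp_mul_relaxationKernel (hν : ∀ᵐ α ∂ν, α ∈ Ioo (0 : ℝ) 1) (hν0 : ν ≠ 0)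
    {p : ℂ} (hp : 0 < p.re) :
    IntegrableOn (fun t : ℝ ↦ Complex.exp (-p * t) * (relaxationKernel ν t : ℂ)) (Ioi 0) := by
  have h := (integrable_prod_exp_mul_stieltjesDensity hν hν0 hp).integral_prod_right
  simp only [Function.uncurry, integral_cexp_mul_stieltjesDensity] at h
  refine (h.const_mul (π : ℂ)⁻¹).congr (Eventually.of_forall fun t ↦ ?_)
  exact inv_mul_cancel_left₀ (by exact_mod_cast pi_ne_zero) _

/-- The Laplace transform of the relaxation kernel. -/
lemma integral_cexp_mul_relaxationKernel (hν : ∀ᵐ α ∂ν, α ∈ Ioo (0 : ℝ) 1) (hν0 : ν ≠ 0)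
    {p : ℂ} (hp : 0 < p.re) :
    ∫ t in Ioi (0 : ℝ), Complex.exp (-p * t) * (relaxationKernel ν t : ℂ) =
      (complexMGF id ν (Complex.log p))⁻¹ := by
  have hπ : (π : ℂ) ≠ 0 := by exact_mod_cast pi_ne_zero
  have h := integral_integral_swap (integrable_prod_exp_mul_stieltjesDensity hν hν0 hp)
  simp only [integral_cexp_mul_stieltjesDensity, integral_const_mul] at h
  refine mul_left_cancel₀ hπ ?_
  rw [← h, ← integral_stieltjesDensity_div_add hν hν0 hp]
  refine setIntegral_congr_fun measurableSet_Ioi fun r (hr : 0 < r) ↦ ?_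
  have hre : (-(p + r)).re < 0 := by simp; linarith
  rw [integral_mul_const, integral_exp_mul_complex_Ioi hre]
  simp only [Complex.ofReal_zero, mul_zero, Complex.exp_zero, neg_div_neg_eq]
  ring

end Relaxation

section GammaIntegral

lemma integral_withDensity_rpow {E : Type*} [NormedAddCommGroup E] [NormedSpace ℝ E] (a : ℝ)
    (f : ℝ → E) :
    ∫ t, f t ∂((volume.restrict (Ioi 0)).withDensity fun t ↦ ENNReal.ofReal (t ^ a)) =
      ∫ t in Ioi (0 : ℝ), t ^ a • f t := by
  rw [integral_withDensity_eq_integral_toReal_smul₀ (by fun_prop) (by simp)]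
  refine setIntegral_congr_fun measurableSet_Ioi fun t (ht : 0 < t) ↦ ?_
  simp [ENNReal.toReal_ofReal (rpow_pos_of_pos ht a).le]

lemma integrableOn_rpow_mul_exp_mul {a : ℝ} (ha : 0 < a) {x : ℝ} (hx : x < 0) :
    IntegrableOn (fun t : ℝ ↦ t ^ (a - 1) * rexp (x * t)) (Ioi 0) := by
  simpa using integrableOn_rpow_mul_exp_neg_mul_rpow (s := a - 1) (p := 1) (b := -x)
    (by linarith) one_pos (by linarith)

lemma integral_rpow_mul_exp_mul {a : ℝ} (ha : 0 < a) {x : ℝ} (hx : x < 0) :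
    ∫ t in Ioi (0 : ℝ), t ^ (a - 1) * rexp (x * t) = (-x) ^ (-a) * Gamma a := by
  have h := Real.integral_rpow_mul_exp_neg_mul_Ioi ha (neg_pos.2 hx)
  simp only [neg_mul, neg_neg, one_div] at h
  rw [h, inv_rpow (neg_pos.2 hx).le, rpow_neg (neg_pos.2 hx).le]

/-- The Laplace transform of a power, on the open right half-plane. -/
lemma integral_rpow_mul_cexp_neg_mul {a : ℝ} (ha : 0 < a) {p : ℂ} (hp : 0 < p.re) :
    ∫ t in Ioi (0 : ℝ), ((t ^ (a - 1) : ℝ) : ℂ) * Complex.exp (-p * t) =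
      p ^ (-a : ℂ) * (Gamma a : ℂ) := by
  set m : Measure ℝ := (volume.restrict (Ioi 0)).withDensity
    fun t ↦ ENNReal.ofReal (t ^ (a - 1)) with hm
  have hset : Iio 0 ⊆ integrableExpSet id m := by
    intro x hx
    change Integrable _ _
    rw [hm, integrable_withDensity_iff_integrable_smul₀' (by fun_prop) (by simp)]
    refine (integrableOn_rpow_mul_exp_mul ha hx).congr_fun (fun t (ht : 0 < t) ↦ ?_)
      measurableSet_Ioi
    simp [ENNReal.toReal_ofReal (rpow_pos_of_pos ht _).le]
  have hopen : IsOpen {s : ℂ | s.re < 0} := isOpen_lt Complex.continuous_re continuous_const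
  have hleft : AnalyticOnNhd ℂ (complexMGF id m) {s | s.re < 0} := by
    refine DifferentiableOn.analyticOnNhd (differentiableOn_complexMGF.mono fun s hs ↦ ?_) hopen
    exact interior_maximal hset isOpen_Iio hs
  have hright : AnalyticOnNhd ℂ (fun s ↦ (-s) ^ (-a : ℂ) * (Gamma a : ℂ)) {s | s.re < 0} := by
    refine DifferentiableOn.analyticOnNhd (fun s (hs : s.re < 0) ↦ ?_) hopen
    have : -s ∈ Complex.slitPlane := Or.inl (by simpa using hs)
    exact (((differentiableAt_id.neg).cpow_const this).mul_const _).differentiableWithinAt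
  have hreal (x : ℝ) (hx : x < 0) : complexMGF id m x = (-x : ℂ) ^ (-a : ℂ) * (Gamma a : ℂ) := by
    rw [complexMGF_ofReal, mgf, hm, integral_withDensity_rpow]
    simp only [smul_eq_mul, id]
    rw [integral_rpow_mul_exp_mul ha hx]
    push_cast
    rw [Complex.ofReal_cpow (by linarith)]
    push_cast
    rfl
  have hfreq : ∃ᶠ s in 𝓝[≠] (-1 : ℂ), complexMGF id m s = (-s) ^ (-a : ℂ) * (Gamma a : ℂ) := by
    have htend : Tendsto (fun x : ℝ ↦ (x : ℂ)) (𝓝[≠] (-1)) (𝓝[≠] (-1)) := by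
      refine tendsto_nhdsWithin_of_tendsto_nhds_of_eventually_within _ ?_ ?_
      · have h := Complex.continuous_ofReal.tendsto (-1)
        rw [Complex.ofReal_neg, Complex.ofReal_one] at h
        exact h.mono_left inf_le_left
      · filter_upwards [self_mem_nhdsWithin] with x hx h
        exact hx (Complex.ofReal_injective (by simpa using h))
    refine htend.frequently (Eventually.frequently ?_)
    filter_upwards [mem_nhdsWithin_of_mem_nhds (Iio_mem_nhds (by norm_num : (-1 : ℝ) < 0))]
      with x hx using hreal x hx
  have h := hleft.eqOn_of_preconnected_of_frequently_eq hright
    (convex_halfSpace_re_lt 0).isPreconnected (by simp : (-1 : ℂ) ∈ {s : ℂ | s.re < 0}) hfreq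
    (show -p ∈ {s : ℂ | s.re < 0} by simpa using hp)
  simp only [neg_neg] at h
  rw [← h, complexMGF, hm, integral_withDensity_rpow]
  simp

lemma integral_cexp_mul_rpow_neg_div_Gamma {α : ℝ} (hα : α < 1) {p : ℂ} (hp : 0 < p.re) :
    ∫ t in Ioi (0 : ℝ), Complex.exp (-p * t) * ((t ^ (-α) / Gamma (1 - α) : ℝ) : ℂ) =
      p⁻¹ * Complex.exp (Complex.log p * α) := by
  have hp0 : p ≠ 0 := by rintro rfl; simp at hp
  have hG : (Gamma (1 - α) : ℂ) ≠ 0 := by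
    exact_mod_cast (Gamma_pos_of_pos (show 0 < 1 - α by linarith)).ne'
  have h := integral_rpow_mul_cexp_neg_mul (sub_pos.2 hα) hp
  have h2 (t : ℝ) : Complex.exp (-p * t) * ((t ^ (-α) / Gamma (1 - α) : ℝ) : ℂ) =
      ((t ^ (1 - α - 1) : ℝ) : ℂ) * Complex.exp (-p * t) * (Gamma (1 - α) : ℂ)⁻¹ := by
    rw [show 1 - α - 1 = -α by ring]
    push_cast
    ring
  simp only [h2]
  rw [integral_mul_const, h, mul_inv_cancel_right₀ hG,
    show (-((1 - α : ℝ) : ℂ)) = -1 + α by push_cast; ring, Complex.cpow_add _ _ hp0,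
    Complex.cpow_neg_one, Complex.cpow_def_of_ne_zero hp0 (α : ℂ)]

end GammaIntegral

/-- The memory kernel `t ↦ ∫ t ^ (-α) / Γ(1 - α) dν(α)`. -/
noncomputable def memoryKernel (ν : Measure ℝ) (t : ℝ) : ℝ := ∫ α, t ^ (-α) / Gamma (1 - α) ∂ν

lemma continuous_inv_Gamma : Continuous fun x : ℝ ↦ (Gamma x)⁻¹ := by
  have h := Complex.continuous_re.comp
    (Complex.differentiable_one_div_Gamma.continuous.comp Complex.continuous_ofReal)
  refine h.congr fun x ↦ ?_
  simp only [Function.comp_apply, Complex.Gamma_ofReal, ← Complex.ofReal_inv, Complex.ofReal_re]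

section Memory

variable {ν : Measure ℝ}

lemma memoryKernel_nonneg (hν : ∀ᵐ α ∂ν, α ∈ Ioo (0 : ℝ) 1) {t : ℝ} (ht : 0 < t) :
    0 ≤ memoryKernel ν t := by
  refine integral_nonneg_of_ae ?_
  filter_upwards [hν] with α hα
  exact div_nonneg (rpow_pos_of_pos ht _).le (Gamma_pos_of_pos (by linarith [hα.2])).le

lemma integral_cexp_mul_rpow_neg_div_Gamma_measure (p : ℂ) (t : ℝ) :
    ∫ α, Complex.exp (-p * t) * ((t ^ (-α) / Gamma (1 - α) : ℝ) : ℂ) ∂ν =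
      Complex.exp (-p * t) * (memoryKernel ν t : ℂ) := by
  rw [integral_const_mul, integral_complex_ofReal, memoryKernel]

variable [IsFiniteMeasure ν]

lemma integrable_rpow_neg_div_Gamma (hν : ∀ᵐ α ∂ν, α ∈ Ioo (0 : ℝ) 1) {t : ℝ} (ht : 0 < t) :
    Integrable (fun α ↦ t ^ (-α) / Gamma (1 - α)) ν := by
  have hc : Continuous fun α : ℝ ↦ (Gamma (1 - α))⁻¹ :=
    continuous_inv_Gamma.comp (continuous_const.sub continuous_id)
  obtain ⟨B, hB⟩ := isCompact_Icc.exists_bound_of_continuousOn (s := Icc (0 : ℝ) 1) hc.continuousOn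
  refine ((integrable_exp_mul_of_ae_mem_Ioo hν (-log t)).bdd_mul hc.aestronglyMeasurable
    (c := B) ?_).congr ?_
  · filter_upwards [hν] with α hα using hB α (Ioo_subset_Icc_self hα)
  · filter_upwards with α
    rw [rpow_def_of_pos ht, div_eq_inv_mul, mul_neg, neg_mul]

lemma antitoneOn_memoryKernel (hν : ∀ᵐ α ∂ν, α ∈ Ioo (0 : ℝ) 1) :
    AntitoneOn (memoryKernel ν) (Ioi 0) := by
  intro s hs t ht hst
  refine integral_mono_ae (integrable_rpow_neg_div_Gamma hν ht)
    (integrable_rpow_neg_div_Gamma hν hs) ?_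
  filter_upwards [hν] with α hα
  have := Gamma_pos_of_pos (show 0 < 1 - α by linarith [hα.2])
  exact div_le_div_of_nonneg_right (rpow_le_rpow_of_nonpos hs hst (by linarith [hα.1])) this.le

lemma integrable_prod_cexp_mul_rpow_neg_div_Gamma (hν : ∀ᵐ α ∂ν, α ∈ Ioo (0 : ℝ) 1)
    {p : ℂ} (hp : 0 < p.re) :
    Integrable (Function.uncurry fun α t : ℝ ↦
      Complex.exp (-p * t) * ((t ^ (-α) / Gamma (1 - α) : ℝ) : ℂ))
      (ν.prod (volume.restrict (Ioi 0))) := by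
  have hnorm {α : ℝ} (hα : α ∈ Ioo (0 : ℝ) 1) {t : ℝ} (ht : 0 < t) :
      ‖Complex.exp (-p * t) * ((t ^ (-α) / Gamma (1 - α) : ℝ) : ℂ)‖ =
        t ^ (1 - α - 1) * rexp (-p.re * t) * (Gamma (1 - α))⁻¹ := by
    have := Gamma_pos_of_pos (show 0 < 1 - α by linarith [hα.2])
    have := rpow_pos_of_pos ht (-α)
    rw [norm_mul, Complex.norm_exp, Complex.norm_real, norm_of_nonneg (by positivity),
      show 1 - α - 1 = -α by ring, Complex.re_mul_ofReal, Complex.neg_re]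
    ring
  have hmeas : Measurable (Function.uncurry fun α t : ℝ ↦
      Complex.exp (-p * t) * ((t ^ (-α) / Gamma (1 - α) : ℝ) : ℂ)) := by
    have hc : Measurable fun x : ℝ × ℝ ↦ (Gamma (1 - x.1))⁻¹ :=
      (continuous_inv_Gamma.comp (continuous_const.sub continuous_fst)).measurable
    simp only [Function.uncurry_def, div_eq_mul_inv]
    fun_prop
  refine (integrable_prod_iff hmeas.aestronglyMeasurable).2 ⟨?_, ?_⟩
  · filter_upwards [hν] with α hα
    refine (integrable_norm_iff (hmeas.comp measurable_prodMk_left).aestronglyMeasurable).1 ?_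
    refine IntegrableOn.congr_fun ((integrableOn_rpow_mul_exp_mul (sub_pos.2 hα.2)
      (neg_neg_iff_pos.2 hp)).mul_const (Gamma (1 - α))⁻¹)
      (fun t ht ↦ (hnorm hα ht).symm) measurableSet_Ioi
  · refine ((integrable_exp_mul_of_ae_mem_Ioo hν (log p.re)).const_mul p.re⁻¹).congr ?_
    filter_upwards [hν] with α hα
    have hG := (Gamma_pos_of_pos (show 0 < 1 - α by linarith [hα.2])).ne'
    simp only [Function.uncurry]
    rw [setIntegral_congr_fun measurableSet_Ioi fun t (ht : 0 < t) ↦ hnorm hα ht, integral_mul_const,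
      integral_rpow_mul_exp_mul (sub_pos.2 hα.2) (neg_neg_iff_pos.2 hp), mul_inv_cancel_right₀ hG,
      neg_neg, ← rpow_def_of_pos hp, show -(1 - α) = -1 + α by ring, rpow_add hp, rpow_neg_one]

/-- The Laplace transform of the memory kernel converges absolutely on the right half-plane. -/
lemma integrableOn_cexp_mul_memoryKernel (hν : ∀ᵐ α ∂ν, α ∈ Ioo (0 : ℝ) 1)
    {p : ℂ} (hp : 0 < p.re) :
    IntegrableOn (fun t : ℝ ↦ Complex.exp (-p * t) * (memoryKernel ν t : ℂ)) (Ioi 0) := by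
  simpa only [IntegrableOn, Function.uncurry, integral_cexp_mul_rpow_neg_div_Gamma_measure] using
    (integrable_prod_cexp_mul_rpow_neg_div_Gamma hν hp).integral_prod_right

/-- The Laplace transform of the memory kernel. -/
lemma integral_cexp_mul_memoryKernel (hν : ∀ᵐ α ∂ν, α ∈ Ioo (0 : ℝ) 1) {p : ℂ} (hp : 0 < p.re) :
    ∫ t in Ioi (0 : ℝ), Complex.exp (-p * t) * (memoryKernel ν t : ℂ) =
      p⁻¹ * complexMGF id ν (Complex.log p) := by
  simp only [← integral_cexp_mul_rpow_neg_div_Gamma_measure]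
  rw [← integral_integral_swap (integrable_prod_cexp_mul_rpow_neg_div_Gamma hν hp), complexMGF,
    ← integral_const_mul]
  refine integral_congr_ae ?_
  filter_upwards [hν] with α hα using integral_cexp_mul_rpow_neg_div_Gamma hα.2 hp

end Memory

section Convolution

/-- The density `t ↦ e ^ (-t) f(t)` of the exponentially tilted measure attached to a nonnegative
function `f` on `(0, ∞)`. -/
noncomputable def tiltedDensity (f : ℝ → ℝ) : ℝ → ENNReal :=
  (Ioi 0).indicator fun t ↦ ENNReal.ofReal (rexp (-t) * f t)

variable {f g : ℝ → ℝ}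

lemma measurable_tiltedDensity (hf : AntitoneOn f (Ioi 0)) : Measurable (tiltedDensity f) := by
  refine measurable_of_restrict_of_restrict_compl (s := Ioi 0) measurableSet_Ioi ?_ ?_
  · have h : Measurable fun x : Ioi (0 : ℝ) ↦ f x :=
      Antitone.measurable fun x y hxy ↦ hf x.2 y.2 hxy
    have h' : Measurable fun x : Ioi (0 : ℝ) ↦ ENNReal.ofReal (rexp (-x) * f x) :=
      ((measurable_subtype_coe.neg.exp).mul h).ennreal_ofReal
    convert! h' using 2 with x
    exact indicator_of_mem x.2 fun t ↦ ENNReal.ofReal (rexp (-t) * f t)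
  · convert! measurable_const (a := (0 : ENNReal)) using 2 with x
    exact indicator_of_notMem x.2 fun t ↦ ENNReal.ofReal (rexp (-t) * f t)

lemma withDensity_tiltedDensity (f : ℝ → ℝ) : volume.withDensity (tiltedDensity f) =
    (volume.restrict (Ioi 0)).withDensity fun t ↦ ENNReal.ofReal (rexp (-t) * f t) :=
  withDensity_indicator measurableSet_Ioi _

lemma isFiniteMeasure_withDensity_tiltedDensity
    (hf : IntegrableOn (fun t ↦ rexp (-t) * f t) (Ioi 0)) :
    IsFiniteMeasure (volume.withDensity (tiltedDensity f)) := by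
  rw [withDensity_tiltedDensity]
  exact isFiniteMeasure_withDensity_ofReal hf.2

lemma charFun_withDensity_tiltedDensity (hf0 : ∀ t, 0 < t → 0 ≤ f t)
    (hf : IntegrableOn (fun t ↦ rexp (-t) * f t) (Ioi 0)) (ξ : ℝ) :
    charFun (volume.withDensity (tiltedDensity f)) ξ =
      ∫ t in Ioi (0 : ℝ), Complex.exp (-(1 - ξ * Complex.I) * t) * (f t : ℂ) := by
  rw [charFun_apply_real, withDensity_tiltedDensity,
    integral_withDensity_eq_integral_toReal_smul₀ hf.1.aemeasurable.ennreal_ofReal (by simp)]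
  refine setIntegral_congr_fun measurableSet_Ioi fun t (ht : 0 < t) ↦ ?_
  have := hf0 t ht
  simp only [Complex.real_smul]
  rw [ENNReal.toReal_ofReal (by positivity), Complex.ofReal_mul, Complex.ofReal_exp,
    mul_right_comm, ← Complex.exp_add]
  push_cast
  ring_nf

/-- The convolution of two tilted densities. -/
lemma lconvolution_tiltedDensity (hg0 : ∀ t, 0 < t → 0 ≤ g t) {x : ℝ} :
    (tiltedDensity g ⋆ₗ tiltedDensity f) x =
      ENNReal.ofReal (rexp (-x)) * ∫⁻ y in Ioo 0 x, ENNReal.ofReal (f (x - y) * g y) := by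
  rw [lconvolution_def, ← lintegral_const_mul' _ _ ENNReal.ofReal_ne_top,
    ← lintegral_indicator measurableSet_Ioo]
  refine lintegral_congr fun y ↦ ?_
  rw [tiltedDensity, tiltedDensity]
  by_cases hy : y ∈ Ioo 0 x
  · have h1 : y ∈ Ioi (0 : ℝ) := hy.1
    have h2 : -y + x ∈ Ioi (0 : ℝ) := by simpa using hy.2
    have := hg0 y hy.1
    rw [indicator_of_mem hy, indicator_of_mem h1, indicator_of_mem h2,
      ← ENNReal.ofReal_mul (by positivity), ← ENNReal.ofReal_mul (by positivity)]
    congr 1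
    rw [mul_mul_mul_comm, ← exp_add, mul_comm (g y), neg_add_eq_sub y x,
      show -y + -(x - y) = -x by ring]
  · rw [indicator_of_notMem hy]
    rw [mem_Ioo, not_and_or, not_lt, not_lt] at hy
    rcases hy with hy | hy
    · rw [indicator_of_notMem (by simpa using hy), zero_mul]
    · rw [indicator_of_notMem (s := Ioi 0) (a := -y + x) (by simpa using hy), mul_zero]

/-- If the product of the Laplace transforms of two nonnegative functions is `1 / p`, then their
convolution is `1` almost everywhere. -/
lemma ae_lintegral_convolution_eq_one (hf0 : ∀ t, 0 < t → 0 ≤ f t) (hg0 : ∀ t, 0 < t → 0 ≤ g t)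
    (hfa : AntitoneOn f (Ioi 0)) (hga : AntitoneOn g (Ioi 0))
    (hf : IntegrableOn (fun t ↦ rexp (-t) * f t) (Ioi 0))
    (hg : IntegrableOn (fun t ↦ rexp (-t) * g t) (Ioi 0))
    (hfg : ∀ p : ℂ, 0 < p.re → (∫ t in Ioi (0 : ℝ), Complex.exp (-p * t) * (f t : ℂ)) *
      (∫ t in Ioi (0 : ℝ), Complex.exp (-p * t) * (g t : ℂ)) = p⁻¹) :
    ∀ᵐ x : ℝ, 0 < x → ∫⁻ y in Ioo 0 x, ENNReal.ofReal (f (x - y) * g y) = 1 := by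
  have h1 : IntegrableOn (fun t : ℝ ↦ rexp (-t) * (1 : ℝ → ℝ) t) (Ioi 0) := by
    simpa using integrableOn_exp_mul_Ioi (a := -1) (by norm_num) 0
  have h1a : AntitoneOn (1 : ℝ → ℝ) (Ioi 0) := fun _ _ _ _ _ ↦ le_rfl
  have := isFiniteMeasure_withDensity_tiltedDensity hf
  have := isFiniteMeasure_withDensity_tiltedDensity hg
  have := isFiniteMeasure_withDensity_tiltedDensity h1
  have hmeas : volume.withDensity (tiltedDensity 1) =
      volume.withDensity (tiltedDensity g ⋆ₗ tiltedDensity f) := by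
    rw [← conv_withDensity_eq_lconvolution (measurable_tiltedDensity hga)
      (measurable_tiltedDensity hfa)]
    refine Measure.ext_of_charFun (funext fun ξ ↦ ?_)
    have hre : 0 < (1 - ξ * Complex.I).re := by simp
    rw [charFun_conv, charFun_withDensity_tiltedDensity hf0 hf,
      charFun_withDensity_tiltedDensity hg0 hg, mul_comm, hfg _ hre,
      charFun_withDensity_tiltedDensity (by simp) h1]
    simp only [Pi.one_apply, Complex.ofReal_one, mul_one]
    rw [integral_exp_mul_complex_Ioi (by simp)]
    simp only [Complex.ofReal_zero, mul_zero, Complex.exp_zero, neg_div_neg_eq, one_div]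
  have hae := (withDensity_eq_iff (measurable_tiltedDensity h1a).aemeasurable
    (measurable_lconvolution volume (measurable_tiltedDensity hga)
      (measurable_tiltedDensity hfa)).aemeasurable ?_).1 hmeas
  · filter_upwards [hae] with x hx hx0
    rw [lconvolution_tiltedDensity hg0, tiltedDensity, indicator_of_mem (mem_Ioi.2 hx0),
      Pi.one_apply, mul_one] at hx
    exact ((ENNReal.mul_right_inj (by simp [exp_pos]) ENNReal.ofReal_ne_top).1
      ((mul_one _).trans hx)).symm
  · rw [← setLIntegral_univ, ← withDensity_apply _ MeasurableSet.univ]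
    exact measure_ne_top _ _

lemma lintegral_convolution_eq_mul {x : ℝ} (hx : 0 < x) :
    ∫⁻ y in Ioo 0 x, ENNReal.ofReal (f (x - y) * g y) = ENNReal.ofReal x *
      ∫⁻ u in Ioo (0 : ℝ) 1, ENNReal.ofReal (f (x * (1 - u)) * g (x * u)) := by
  have himage : (fun u ↦ x * u) '' Ioo 0 1 = Ioo 0 x := by
    simp [image_mul_left_Ioo hx]
  rw [← himage, lintegral_image_eq_lintegral_abs_deriv_mul measurableSet_Ioo (f' := fun _ ↦ x)
    (fun u _ ↦ by simpa using ((hasDerivAt_id u).const_mul x).hasDerivWithinAt)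
    (mul_right_injective₀ hx.ne').injOn, ← lintegral_const_mul' _ _ ENNReal.ofReal_ne_top]
  simp only [abs_of_pos hx, mul_sub, mul_one]

/-- A function antitone on `(0, ∞)` and almost everywhere equal to `1 / x` is everywhere equal
to `1 / x`. -/
lemma eq_ofReal_inv_of_antitoneOn_of_ae_eq {F : ℝ → ENNReal} (hF : AntitoneOn F (Ioi 0))
    (hae : ∀ᵐ x : ℝ, 0 < x → F x = ENNReal.ofReal x⁻¹) {x : ℝ} (hx : 0 < x) :
    F x = ENNReal.ofReal x⁻¹ := by
  have hdense := Measure.dense_of_ae hae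
  have htend : Tendsto (fun y : ℝ ↦ ENNReal.ofReal y⁻¹) (𝓝 x) (𝓝 (ENNReal.ofReal x⁻¹)) :=
    ENNReal.tendsto_ofReal (tendsto_inv₀ hx.ne')
  refine le_antisymm ?_ ?_
  · refine ge_of_tendsto (htend.mono_left (nhdsWithin_le_nhds (s := Iio x))) ?_
    filter_upwards [Ioo_mem_nhdsLT hx] with y hy
    obtain ⟨z, hz, hyz⟩ := hdense.exists_between hy.2
    have hz0 : 0 < z := hy.1.trans hyz.1
    calc F x ≤ F z := hF hz0 hx hyz.2.le
      _ = ENNReal.ofReal z⁻¹ := hz hz0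
      _ ≤ ENNReal.ofReal y⁻¹ := ENNReal.ofReal_le_ofReal (inv_anti₀ hy.1 hyz.1.le)
  · refine le_of_tendsto (htend.mono_left (nhdsWithin_le_nhds (s := Ioi x))) ?_
    filter_upwards [self_mem_nhdsWithin] with y (hy : x < y)
    obtain ⟨z, hz, hyz⟩ := hdense.exists_between hy
    have hz0 : 0 < z := hx.trans hyz.1
    calc ENNReal.ofReal y⁻¹ ≤ ENNReal.ofReal z⁻¹ :=
          ENNReal.ofReal_le_ofReal (inv_anti₀ hz0 hyz.2.le)
      _ = F z := (hz hz0).symm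
      _ ≤ F x := hF hx hz0 hyz.1.le

/-- If the product of the Laplace transforms of two nonnegative antitone functions is `1 / p`, then
their convolution is identically `1`. -/
theorem integral_convolution_eq_one (hf0 : ∀ t, 0 < t → 0 ≤ f t) (hg0 : ∀ t, 0 < t → 0 ≤ g t)
    (hfa : AntitoneOn f (Ioi 0)) (hga : AntitoneOn g (Ioi 0))
    (hf : IntegrableOn (fun t ↦ rexp (-t) * f t) (Ioi 0))
    (hg : IntegrableOn (fun t ↦ rexp (-t) * g t) (Ioi 0))
    (hfg : ∀ p : ℂ, 0 < p.re → (∫ t in Ioi (0 : ℝ), Complex.exp (-p * t) * (f t : ℂ)) *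
      (∫ t in Ioi (0 : ℝ), Complex.exp (-p * t) * (g t : ℂ)) = p⁻¹) {x : ℝ} (hx : 0 < x) :
    ∫ y in (0 : ℝ)..x, f (x - y) * g y = 1 := by
  have hanti : AntitoneOn (fun x ↦ ∫⁻ u in Ioo (0 : ℝ) 1,
      ENNReal.ofReal (f (x * (1 - u)) * g (x * u))) (Ioi 0) := by
    intro x (hx : 0 < x) y (hy : 0 < y) hxy
    refine setLIntegral_mono' measurableSet_Ioo fun u hu ↦ ENNReal.ofReal_le_ofReal ?_
    have hu1 : 0 < 1 - u := by linarith [hu.2]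
    have hu0 : 0 < u := hu.1
    exact mul_le_mul (hfa (mem_Ioi.2 (by positivity)) (mem_Ioi.2 (by positivity)) (by gcongr))
      (hga (mem_Ioi.2 (by positivity)) (mem_Ioi.2 (by positivity)) (by gcongr))
      (hg0 _ (by positivity)) (hf0 _ (by positivity))
  have hone : ∫⁻ y in Ioo 0 x, ENNReal.ofReal (f (x - y) * g y) = 1 := by
    rw [lintegral_convolution_eq_mul hx, eq_ofReal_inv_of_antitoneOn_of_ae_eq hanti ?_ hx,
      ENNReal.ofReal_inv_of_pos hx, ENNReal.mul_inv_cancel (by simpa using hx)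
      ENNReal.ofReal_ne_top]
    filter_upwards [ae_lintegral_convolution_eq_one hf0 hg0 hfa hga hf hg hfg] with y hy hy0
    rw [ENNReal.ofReal_inv_of_pos hy0]
    refine ENNReal.eq_inv_of_mul_eq_one_left ?_
    rw [mul_comm, ← lintegral_convolution_eq_mul hy0, hy hy0]
  have hfm : AEMeasurable (fun y ↦ f (x - y)) (volume.restrict (Ioo 0 x)) :=
    aemeasurable_restrict_of_monotoneOn measurableSet_Ioo fun y hy z hz hyz ↦
      hfa (sub_pos.2 hz.2) (sub_pos.2 hy.2) (by linarith)
  have hgm : AEMeasurable g (volume.restrict (Ioo 0 x)) :=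
    aemeasurable_restrict_of_antitoneOn measurableSet_Ioo (hga.mono Ioo_subset_Ioi_self)
  have hm : AEStronglyMeasurable (fun y ↦ f (x - y) * g y) (volume.restrict (Ioo 0 x)) :=
    (hfm.mul hgm).aestronglyMeasurable
  rw [intervalIntegral.integral_of_le hx.le, integral_Ioc_eq_integral_Ioo,
    integral_eq_lintegral_of_nonneg_ae ?_ hm, hone,
    ENNReal.toReal_one]
  filter_upwards [ae_restrict_mem measurableSet_Ioo] with y hy
  exact mul_nonneg (hf0 _ (sub_pos.2 hy.2)) (hg0 _ hy.1)

end Convolution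

/-- The convolution of the memory kernel with the relaxation kernel is identically `1`. -/
lemma integral_memoryKernel_mul_relaxationKernel {ν : Measure ℝ} [IsFiniteMeasure ν]
    (hν : ∀ᵐ α ∂ν, α ∈ Ioo (0 : ℝ) 1) (hν0 : ν ≠ 0) {t : ℝ} (ht : 0 < t) :
    ∫ τ in (0 : ℝ)..t, memoryKernel ν (t - τ) * relaxationKernel ν τ = 1 := by
  refine integral_convolution_eq_one (fun _ ↦ memoryKernel_nonneg hν)
    (fun t _ ↦ relaxationKernel_nonneg hν hν0 t) (antitoneOn_memoryKernel hν)
    (antitoneOn_relaxationKernel hν hν0) ?_ ?_ (fun p hp ↦ ?_) ht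
  · refine (integrableOn_cexp_mul_memoryKernel hν (p := 1) (by simp)).re.congr
      (Eventually.of_forall fun t ↦ ?_)
    simp [← Complex.ofReal_neg, ← Complex.ofReal_exp]
  · refine (integrableOn_cexp_mul_relaxationKernel hν hν0 (p := 1) (by simp)).re.congr
      (Eventually.of_forall fun t ↦ ?_)
    simp [← Complex.ofReal_neg, ← Complex.ofReal_exp]
  · rw [integral_cexp_mul_memoryKernel hν hp, integral_cexp_mul_relaxationKernel hν hν0 hp,
      mul_assoc, mul_inv_cancel₀, mul_one]
    exact complexMGF_ne_zero hν hν0 (by rw [Complex.log_im]; exact Complex.abs_arg_le_pi p)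

section Density

/-- The measure on `(0, 1)` with density `μ`. -/
noncomputable def unitIntervalMeasure (μ : ℝ → ℝ) : Measure ℝ :=
  (volume.restrict (Ioo 0 1)).withDensity fun α ↦ ENNReal.ofReal (μ α)

variable {μ : ℝ → ℝ}

lemma ae_mem_Ioo_unitIntervalMeasure (μ : ℝ → ℝ) :
    ∀ᵐ α ∂unitIntervalMeasure μ, α ∈ Ioo (0 : ℝ) 1 :=
  (withDensity_absolutelyContinuous _ _).ae_le (ae_restrict_mem measurableSet_Ioo)

lemma isFiniteMeasure_unitIntervalMeasure (hμ : IntegrableOn μ (Ioo 0 1)) :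
    IsFiniteMeasure (unitIntervalMeasure μ) :=
  isFiniteMeasure_withDensity_ofReal hμ.2

lemma unitIntervalMeasure_ne_zero (hμ : IntegrableOn μ (Ioo 0 1))
    (hμ0 : ∀ α ∈ Ioo (0 : ℝ) 1, 0 ≤ μ α)
    (hne : ¬ ∀ᵐ α ∂volume.restrict (Ioo (0 : ℝ) 1), μ α = 0) : unitIntervalMeasure μ ≠ 0 := by
  intro h
  rw [unitIntervalMeasure, withDensity_eq_zero_iff hμ.1.aemeasurable.ennreal_ofReal] at h
  refine hne ?_
  filter_upwards [h, ae_restrict_mem measurableSet_Ioo] with α hα hα'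
  exact le_antisymm (ENNReal.ofReal_eq_zero.1 hα) (hμ0 α hα')

lemma integral_unitIntervalMeasure {E : Type*} [NormedAddCommGroup E] [NormedSpace ℝ E]
    (hμ : IntegrableOn μ (Ioo 0 1)) (hμ0 : ∀ α ∈ Ioo (0 : ℝ) 1, 0 ≤ μ α) (f : ℝ → E) :
    ∫ α, f α ∂unitIntervalMeasure μ = ∫ α in Ioo (0 : ℝ) 1, μ α • f α := by
  rw [unitIntervalMeasure, integral_withDensity_eq_integral_toReal_smul₀
    hμ.1.aemeasurable.ennreal_ofReal (by simp)]
  refine setIntegral_congr_fun measurableSet_Ioo fun α hα ↦ ?_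
  simp [ENNReal.toReal_ofReal (hμ0 α hα)]

end Density

end

/-- For every complex `p` with `Re p > 0`, the Laplace transform of `g`
satisfies `∫₀^∞ e^{-pt} g(t) dt = 1 / ∫₀¹ p^α μ(α) dα`; consequently `(k * g)(t) = 1`
for every `t > 0`. -/
theorem stmt_5 (μ : ℝ → ℝ)
    (hμ_int : IntegrableOn μ (Ioo 0 1))
    (hμ_nonneg : ∀ α ∈ Ioo (0:ℝ) 1, 0 ≤ μ α)
    (hμ_ne : ¬ (∀ᵐ α ∂(volume.restrict (Ioo (0:ℝ) 1)), μ α = 0))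
    (k : ℝ → ℝ)
    (hk : ∀ t : ℝ, 0 < t → k t = ∫ α in Ioo (0:ℝ) 1, t ^ (-α) * μ α / Real.Gamma (1 - α))
    (S C g : ℝ → ℝ)
    (hS : ∀ r : ℝ, S r = ∫ α in Ioo (0:ℝ) 1, Real.sin (π * α) * r ^ α * μ α)
    (hC : ∀ r : ℝ, C r = ∫ α in Ioo (0:ℝ) 1, Real.cos (π * α) * r ^ α * μ α)
    (hg : ∀ t : ℝ, 0 < t →
      g t = (1/π) * ∫ r in Ioi (0:ℝ), Real.exp (-r * t) * S r / ((S r)^2 + (C r)^2)) :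
    (∀ p : ℂ, 0 < p.re →
      (∫ t in Ioi (0:ℝ), Complex.exp (-p * t) * (g t : ℂ)) =
        1 / ∫ α in Ioo (0:ℝ) 1, p ^ (α : ℂ) * (μ α : ℂ)) ∧
    (∀ t : ℝ, 0 < t → (∫ τ in (0:ℝ)..t, k (t - τ) * g τ) = 1) := by
  set ν := unitIntervalMeasure μ
  have hν := ae_mem_Ioo_unitIntervalMeasure μ
  have := isFiniteMeasure_unitIntervalMeasure hμ_int
  have hν0 := unitIntervalMeasure_ne_zero hμ_int hμ_nonneg hμ_ne
  have hS' : S = sineMoment ν := by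
    funext r
    rw [hS, sineMoment, integral_unitIntervalMeasure hμ_int hμ_nonneg]
    simp only [smul_eq_mul, mul_comm]
  have hC' : C = cosineMoment ν := by
    funext r
    rw [hC, cosineMoment, integral_unitIntervalMeasure hμ_int hμ_nonneg]
    simp only [smul_eq_mul, mul_comm]
  have hg' (t : ℝ) (ht : 0 < t) : g t = relaxationKernel ν t := by
    simp only [hg t ht, relaxationKernel, stieltjesDensity, hS', hC', mul_div_assoc]
  have hk' (t : ℝ) (ht : 0 < t) : k t = memoryKernel ν t := by
    rw [hk t ht, memoryKernel, integral_unitIntervalMeasure hμ_int hμ_nonneg]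
    simp only [smul_eq_mul, mul_comm, mul_div_assoc]
  refine ⟨fun p hp ↦ ?_, fun t ht ↦ ?_⟩
  · have hp0 : p ≠ 0 := by rintro rfl; simp at hp
    rw [setIntegral_congr_fun (g := fun t : ℝ ↦ Complex.exp (-p * t) * (relaxationKernel ν t : ℂ))
      measurableSet_Ioi fun t ht ↦ by simp only [hg' t ht],
      integral_cexp_mul_relaxationKernel hν hν0 hp, one_div, ProbabilityTheory.complexMGF,
      integral_unitIntervalMeasure hμ_int hμ_nonneg]
    simp only [Complex.real_smul, Complex.cpow_def_of_ne_zero hp0, id, mul_comm]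
  · rw [← integral_memoryKernel_mul_relaxationKernel hν hν0 ht,
      intervalIntegral.integral_of_le ht.le, intervalIntegral.integral_of_le ht.le,
      integral_Ioc_eq_integral_Ioo, integral_Ioc_eq_integral_Ioo]
    refine setIntegral_congr_fun measurableSet_Ioo fun τ hτ ↦ ?_
    simp only [hk' _ (sub_pos.2 hτ.2), hg' τ hτ.1, ν]
end

section
/- For every u ∈ AC[0,T], i.e. u(t) = u(0) + ∫₀ᵗ u'(s) ds with u' ∈ L¹(0,T), one has (g * (k * u'))(t) = u(t) - u(0) for every t ∈ [0,T]; that is, I^{(μ)} D^{(μ)} u = u - u(0). -/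
open MeasureTheory Real Set

open ProbabilityTheory Filter Topology
open scoped ENNReal

namespace DistributedOrder

variable {m : Measure ℝ}

lemma integrable_of_continuous [IsFiniteMeasure m] (hm : ∀ᵐ α ∂m, α ∈ Ioo (0 : ℝ) 1)
    {E : Type*} [NormedAddCommGroup E]
    {f : ℝ → E} (hf : ContinuousOn f (Icc 0 1)) : Integrable f m := by
  have h : m.restrict (Icc 0 1) = m :=
    Measure.restrict_eq_self_of_ae_mem (hm.mono fun α h => Ioo_subset_Icc_self h)
  rw [← h]
  exact hf.integrableOn_compact isCompact_Icc

lemma integral_pos_of_pos_on_Ioo [IsFiniteMeasure m] (hm : ∀ᵐ α ∂m, α ∈ Ioo (0 : ℝ) 1)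
    (hm0 : m ≠ 0) {f : ℝ → ℝ} (hf : ContinuousOn f (Icc 0 1)) (hpos : ∀ α ∈ Ioo (0 : ℝ) 1, 0 < f α) :
    0 < ∫ α, f α ∂m := by
  rw [integral_pos_iff_support_of_nonneg_ae (hm.mono fun α h => (hpos α h).le)
    (integrable_of_continuous hm hf), pos_iff_ne_zero]
  intro h
  apply hm0
  rw [← Measure.measure_univ_eq_zero, ← nonpos_iff_eq_zero, ← h]
  exact measure_mono_ae (hm.mono fun α h _ => (hpos α h).ne')

lemma sin_pi_mul_pos {α : ℝ} (h : α ∈ Ioo (0 : ℝ) 1) : 0 < sin (π * α) :=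
  sin_pos_of_pos_of_lt_pi (mul_pos pi_pos h.1) (by nlinarith [pi_pos, h.2])

/-- The imaginary part of `complexMGF id m` on the line `Im z = π`. -/
noncomputable def sinTransform (m : Measure ℝ) (x : ℝ) : ℝ := ∫ α, sin (π * α) * rexp (x * α) ∂m

section

variable [IsFiniteMeasure m]

lemma differentiable_complexMGF_id (hm : ∀ᵐ α ∂m, α ∈ Ioo (0 : ℝ) 1) :
    Differentiable ℂ (complexMGF id m) := by
  have h : integrableExpSet id m = univ := by
    ext x
    simp only [integrableExpSet, mem_ofPred_eq, mem_univ, iff_true]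
    exact integrable_of_continuous hm (by fun_prop)
  have := differentiableOn_complexMGF (X := id) (μ := m)
  simpa [h, differentiableOn_univ] using this

lemma sinTransform_pos (hm : ∀ᵐ α ∂m, α ∈ Ioo (0 : ℝ) 1) (hm0 : m ≠ 0) (x : ℝ) :
    0 < sinTransform m x :=
  integral_pos_of_pos_on_Ioo hm hm0 (by fun_prop)
    fun _ h => mul_pos (sin_pi_mul_pos h) (exp_pos _)

lemma mul_le_sinTransform (hm : ∀ᵐ α ∂m, α ∈ Ioo (0 : ℝ) 1) (x : ℝ) :
    x * ∫ α, sin (π * α) * α ∂m ≤ sinTransform m x := by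
  rw [← integral_const_mul]
  refine integral_mono_ae (integrable_of_continuous hm (by fun_prop))
    (integrable_of_continuous hm (by fun_prop)) (hm.mono fun α h => ?_)
  have := add_one_le_exp (x * α)
  have := sin_pi_mul_pos h
  simp only
  nlinarith

lemma mul_exp_le_sinTransform (hm : ∀ᵐ α ∂m, α ∈ Ioo (0 : ℝ) 1) (x : ℝ) :
    x * rexp (-x) * ∫ α, sin (π * α) * (1 - α) ∂m ≤ sinTransform m (-x) := by
  rw [← integral_const_mul]
  refine integral_mono_ae (integrable_of_continuous hm (by fun_prop))
    (integrable_of_continuous hm (by fun_prop)) (hm.mono fun α h => ?_)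
  have h1 := add_one_le_exp (x * (1 - α))
  have h2 := sin_pi_mul_pos h
  have h3 : rexp (-x * α) = rexp (-x) * rexp (x * (1 - α)) := by
    rw [← Real.exp_add]; ring_nf
  have h4 := mul_pos (exp_pos (-x)) h2
  simp only [h3]
  nlinarith

lemma sinTransform_le_norm (hm : ∀ᵐ α ∂m, α ∈ Ioo (0 : ℝ) 1) (x : ℝ) {y : ℝ} (hy : |y| ≤ π) :
    sinTransform m x ≤ ‖complexMGF id m (x + y * Complex.I)‖ := by
  have h0 : ‖Complex.exp ((-(y / 2) : ℝ) * Complex.I)‖ = 1 := Complex.norm_exp_ofReal_mul_I _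
  calc sinTransform m x
      ≤ ∫ α, (Complex.exp ((-(y / 2) : ℝ) * Complex.I) *
          Complex.exp ((x + y * Complex.I) * (α : ℂ))).re ∂m := by
        refine integral_mono_ae (integrable_of_continuous hm (by fun_prop))
          (integrable_of_continuous hm (by fun_prop)) (hm.mono fun α h => ?_)
        simp only
        rw [← Complex.exp_add, Complex.exp_re]
        have h1 : (((-(y / 2) : ℝ) : ℂ) * Complex.I + (x + y * Complex.I) * (α : ℂ)).re = x * α := by
          simp
        have h2 : (((-(y / 2) : ℝ) : ℂ) * Complex.I + (x + y * Complex.I) * (α : ℂ)).im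
            = y * (α - 1 / 2) := by
          simp; ring
        rw [h1, h2, mul_comm]
        refine mul_le_mul_of_nonneg_left ?_ (exp_pos _).le
        have h3 : sin (π * α) = cos |π * (α - 1 / 2)| := by
          rw [cos_abs, ← cos_sub_pi_div_two]; ring_nf
        rw [h3, ← cos_abs (y * _)]
        refine cos_le_cos_of_nonneg_of_le_pi (abs_nonneg _) ?_ ?_
        · rw [abs_mul, abs_of_pos pi_pos]
          have : |α - 1 / 2| ≤ 1 := abs_le.2 ⟨by linarith [h.1], by linarith [h.2]⟩
          nlinarith [pi_pos]
        · rw [abs_mul, abs_mul, abs_of_pos pi_pos]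
          gcongr
    _ = (Complex.exp ((-(y / 2) : ℝ) * Complex.I) * complexMGF id m (x + y * Complex.I)).re := by
        rw [complexMGF, ← integral_const_mul]
        exact integral_re (𝕜 := ℂ) (f := fun α : ℝ => Complex.exp ((-(y / 2) : ℝ) * Complex.I) *
          Complex.exp ((x + y * Complex.I) * (α : ℂ))) (integrable_of_continuous hm (by fun_prop))
    _ ≤ ‖Complex.exp ((-(y / 2) : ℝ) * Complex.I) * complexMGF id m (x + y * Complex.I)‖ :=
        Complex.re_le_norm _
    _ = _ := by rw [norm_mul, h0, one_mul]

end

lemma complexMGF_id_conj (z : ℂ) :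
    complexMGF id m (starRingEnd ℂ z) = starRingEnd ℂ (complexMGF id m z) := by
  simp only [complexMGF, ← integral_conj, ← Complex.exp_conj, map_mul, Complex.conj_ofReal]

lemma exp_ne_exp_ofReal {w : ℂ} {q : ℝ} (hw : |w.im| ≤ π) (hne : w ≠ q) :
    Complex.exp w ≠ Complex.exp q := by
  intro h
  have him : sin w.im = 0 ∧ 0 < cos w.im := by
    have h1 := congrArg Complex.re h
    have h2 := congrArg Complex.im h
    simp only [Complex.exp_re, Complex.exp_im, Complex.ofReal_re, Complex.ofReal_im, cos_zero,
      sin_zero, mul_one, mul_zero] at h1 h2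
    exact ⟨(mul_eq_zero.1 h2).resolve_left (exp_pos _).ne',
      pos_of_mul_pos_right (h1 ▸ exp_pos q) (exp_pos _).le⟩
  have h3 : w.im = 0 := by
    have hne' : |w.im| ≠ π := fun h' => by
      have := him.2
      rw [← cos_abs, h', cos_pi] at this
      linarith
    have hlt := abs_lt.1 (lt_of_le_of_ne hw hne')
    exact (sin_eq_zero_iff_of_lt_of_lt hlt.1 hlt.2).1 him.1
  have h4 : w = (w.re : ℂ) := Complex.ext (by simp) (by simp [h3])
  rw [h4, ← Complex.ofReal_exp, ← Complex.ofReal_exp] at h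
  exact hne (by rw [h4, exp_injective (Complex.ofReal_injective h)])

section Contour

variable (m) in
/-- The integrand `(1 / H w - 1 / H q) * exp w / (exp w - exp q)`, where `H = complexMGF id m`,
continued analytically across `w = q`. -/
noncomputable def contourIntegrand (q : ℝ) (w : ℂ) : ℂ :=
  Complex.exp w * dslope (fun z => (complexMGF id m z)⁻¹) q w / dslope Complex.exp q w

lemma contourIntegrand_of_ne {q : ℝ} {w : ℂ} (hne : w ≠ q) :
    contourIntegrand m q w = ((complexMGF id m w)⁻¹ - (complexMGF id m q)⁻¹) *
      (Complex.exp w / (Complex.exp w - Complex.exp q)) := by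
  have h : w - q ≠ 0 := sub_ne_zero.2 hne
  rw [contourIntegrand, dslope_of_ne _ hne, dslope_of_ne _ hne, slope_def_field, slope_def_field,
    ← mul_div_assoc, div_div_div_cancel_right₀ h]
  ring

variable [IsFiniteMeasure m]

lemma complexMGF_id_ne_zero (hm : ∀ᵐ α ∂m, α ∈ Ioo (0 : ℝ) 1) (hm0 : m ≠ 0)
    {w : ℂ} (hw : |w.im| ≤ π) : complexMGF id m w ≠ 0 := by
  have h := (sinTransform_pos hm hm0 w.re).trans_le (sinTransform_le_norm hm w.re hw)
  rw [Complex.re_add_im] at h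
  exact norm_pos_iff.1 h

lemma differentiableOn_contourIntegrand (hm : ∀ᵐ α ∂m, α ∈ Ioo (0 : ℝ) 1) (hm0 : m ≠ 0) (q : ℝ) :
    DifferentiableOn ℂ (contourIntegrand m q) {w | |w.im| ≤ π} := by
  have hs : {w : ℂ | |w.im| ≤ π} ∈ 𝓝 (q : ℂ) := by
    have : ∀ᶠ w : ℂ in 𝓝 (q : ℂ), |w.im| < π :=
      (by fun_prop : Continuous fun w : ℂ => |w.im|).continuousAt.eventually_lt
        continuousAt_const (by simp [pi_pos])
    exact this.mono fun w hw => hw.le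
  refine DifferentiableOn.div (Complex.differentiable_exp.differentiableOn.mul
    ((Complex.differentiableOn_dslope hs).2 ?_))
    ((Complex.differentiableOn_dslope hs).2 Complex.differentiable_exp.differentiableOn) ?_
  · exact (differentiable_complexMGF_id hm).differentiableOn.inv
      fun w hw => complexMGF_id_ne_zero hm hm0 hw
  · intro w hw
    rcases eq_or_ne w q with rfl | hne
    · rw [dslope_same, Complex.deriv_exp]
      exact Complex.exp_ne_zero _
    · rw [dslope_of_ne _ hne, slope_def_field]
      exact div_ne_zero (sub_ne_zero.2 (exp_ne_exp_ofReal hw hne)) (sub_ne_zero.2 hne)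

lemma integral_contourIntegrand (hm : ∀ᵐ α ∂m, α ∈ Ioo (0 : ℝ) 1) (hm0 : m ≠ 0) (q R : ℝ) :
    2 * ((∫ x in (-R)..R, -((complexMGF id m (x + π * Complex.I))⁻¹).im *
        (rexp x / (rexp x + rexp q)) : ℝ) : ℂ) =
      (∫ y in (-π)..π, contourIntegrand m q ((-R : ℝ) + y * Complex.I)) -
      ∫ y in (-π)..π, contourIntegrand m q (R + y * Complex.I) := by
  have key := Complex.integral_boundary_rect_eq_zero_of_differentiableOn (contourIntegrand m q)
    ((-R : ℝ) + (-π : ℝ) * Complex.I) ((R : ℝ) + (π : ℝ) * Complex.I)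
    ((differentiableOn_contourIntegrand hm hm0 q).mono ?_)
  swap
  · intro w hw
    have := hw.2
    simp only [Complex.add_im, Complex.ofReal_im, Complex.mul_im, Complex.ofReal_re, Complex.I_im,
      Complex.I_re, mem_preimage, uIcc_of_le (neg_le_self pi_pos.le), mul_one, mul_zero,
      zero_add, add_zero] at this
    exact abs_le.2 this
  simp only [Complex.add_im, Complex.ofReal_im, Complex.mul_im, Complex.ofReal_re, Complex.I_im,
      Complex.I_re, Complex.add_re, Complex.mul_re, mul_one, mul_zero, sub_zero,
      zero_add, add_zero, smul_eq_mul] at key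
  have hcont : ∀ y : ℝ, |y| ≤ π → Continuous fun x : ℝ => contourIntegrand m q (x + y * Complex.I) :=
    fun y hy => (differentiableOn_contourIntegrand hm hm0 q).continuousOn.comp_continuous
      (by fun_prop) (by simpa using hy)
  have hpi : |π| ≤ π := (abs_of_pos pi_pos).le
  have hpi' : |-π| ≤ π := by rw [abs_neg]; exact hpi
  rw [← intervalIntegral.integral_sub ((hcont _ hpi').intervalIntegrable _ _)
    ((hcont _ hpi).intervalIntegrable _ _)] at key
  have hval : ∀ x : ℝ, contourIntegrand m q (x + (-π : ℝ) * Complex.I) -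
      contourIntegrand m q (x + π * Complex.I) =
      2 * Complex.I * ((-((complexMGF id m (x + π * Complex.I))⁻¹).im *
        (rexp x / (rexp x + rexp q)) : ℝ) : ℂ) := by
    intro x
    have hne : ∀ y : ℝ, y ≠ 0 → (x + y * Complex.I : ℂ) ≠ q := fun y hy h => hy (by
      simpa using congrArg Complex.im h)
    rw [contourIntegrand_of_ne (hne _ pi_ne_zero), contourIntegrand_of_ne (hne _ (by simp [pi_ne_zero]))]
    have he : Complex.exp (x + π * Complex.I) = -rexp x := by
      rw [Complex.exp_add, Complex.exp_pi_mul_I]; simp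
    have he' : Complex.exp (x + (-π : ℝ) * Complex.I) = -rexp x := by
      rw [Complex.exp_add]; push_cast; rw [neg_mul, Complex.exp_neg, Complex.exp_pi_mul_I]; simp
    have hc : (x + (-π : ℝ) * Complex.I : ℂ) = starRingEnd ℂ (x + π * Complex.I) := by simp
    rw [he, he', hc, complexMGF_id_conj, ← map_inv₀, ← Complex.ofReal_exp]
    set z := (complexMGF id m (x + π * Complex.I))⁻¹
    have hz : starRingEnd ℂ z - z = -(2 * Complex.I * z.im) := by
      apply Complex.ext <;> simp; ring
    have hk : -(rexp x : ℂ) / (-rexp x - rexp q) = ((rexp x / (rexp x + rexp q) : ℝ) : ℂ) := by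
      push_cast
      rw [show (-Complex.exp x - Complex.exp q : ℂ) = -(Complex.exp x + Complex.exp q) by ring,
        neg_div_neg_eq]
    rw [hk, ← sub_mul, sub_sub_sub_cancel_right, hz]
    push_cast
    ring
  simp_rw [hval] at key
  rw [intervalIntegral.integral_const_mul, intervalIntegral.integral_ofReal] at key
  refine mul_left_cancel₀ Complex.I_ne_zero ?_
  linear_combination key

lemma tendsto_integral_contourIntegrand_left (hm : ∀ᵐ α ∂m, α ∈ Ioo (0 : ℝ) 1) (hm0 : m ≠ 0)
    (q : ℝ) :
    Tendsto (fun R : ℝ => ∫ y in (-π)..π, contourIntegrand m q ((-R : ℝ) + y * Complex.I))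
      atTop (𝓝 0) := by
  set c := ∫ α, sin (π * α) * (1 - α) ∂m
  have hcpos : 0 < c := integral_pos_of_pos_on_Ioo hm hm0 (by fun_prop)
    fun α h => mul_pos (sin_pi_mul_pos h) (by linarith [h.2])
  set d := ‖(complexMGF id m q)⁻¹‖
  have hlim : Tendsto (fun R : ℝ => ((R * c)⁻¹ + d * rexp (-R)) / (rexp q - rexp (-R)) * |π - -π|)
      atTop (𝓝 ((0 + d * 0) / (rexp q - 0) * |π - -π|)) := by
    have he : Tendsto (fun R : ℝ => rexp (-R)) atTop (𝓝 0) := tendsto_exp_neg_atTop_nhds_zero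
    refine Tendsto.mul_const _ (Tendsto.div ?_ (tendsto_const_nhds.sub he) (by simp [exp_ne_zero]))
    exact ((tendsto_id.atTop_mul_const hcpos).inv_tendsto_atTop).add (he.const_mul _)
  simp only [mul_zero, add_zero, zero_div, zero_mul] at hlim
  refine squeeze_zero_norm' ?_ hlim
  filter_upwards [eventually_gt_atTop 0, eventually_gt_atTop (-q)] with R hR hRq
  refine intervalIntegral.norm_integral_le_of_norm_le_const fun y hy => ?_
  have hy' : |y| ≤ π := by
    rw [uIoc_of_le (neg_le_self pi_pos.le)] at hy
    exact abs_le.2 ⟨hy.1.le, hy.2⟩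
  have hexp : ‖Complex.exp ((-R : ℝ) + y * Complex.I)‖ = rexp (-R) := by
    rw [Complex.norm_exp]; simp
  have hexpq : ‖Complex.exp q‖ = rexp q := by
    rw [Complex.norm_exp]; simp
  have hpos : 0 < rexp q - rexp (-R) := sub_pos.2 (exp_lt_exp.2 (by linarith))
  have hden : rexp q - rexp (-R) ≤
      ‖Complex.exp ((-R : ℝ) + y * Complex.I) - Complex.exp q‖ := by
    rw [norm_sub_rev, ← hexp, ← hexpq]
    exact norm_sub_norm_le _ _
  have hne : ((-R : ℝ) + y * Complex.I : ℂ) ≠ q := fun h => by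
    rw [h, sub_self, norm_zero] at hden
    linarith
  have hH := (mul_exp_le_sinTransform hm R).trans (sinTransform_le_norm hm (-R) hy')
  have hH' : ‖(complexMGF id m ((-R : ℝ) + y * Complex.I))⁻¹‖ * rexp (-R) ≤ (R * c)⁻¹ := by
    rw [norm_inv, ← div_eq_inv_mul, div_le_iff₀ (lt_of_lt_of_le (by positivity) hH),
      ← div_eq_inv_mul, le_div_iff₀ (by positivity)]
    linarith
  rw [contourIntegrand_of_ne hne, norm_mul, norm_div, hexp, ← mul_div_assoc]
  refine div_le_div₀ (by positivity) ?_ hpos hden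
  calc _ ≤ (‖(complexMGF id m ((-R : ℝ) + y * Complex.I))⁻¹‖ + d) * rexp (-R) := by
        gcongr; exact norm_sub_le _ _
    _ ≤ _ := by rw [add_mul]; gcongr

lemma tendsto_integral_contourIntegrand_right (hm : ∀ᵐ α ∂m, α ∈ Ioo (0 : ℝ) 1) (hm0 : m ≠ 0)
    (q : ℝ) :
    Tendsto (fun R : ℝ => ∫ y in (-π)..π, contourIntegrand m q (R + y * Complex.I))
      atTop (𝓝 (-(2 * π * (complexMGF id m q)⁻¹))) := by
  set c := ∫ α, sin (π * α) * α ∂m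
  have hcpos : 0 < c := integral_pos_of_pos_on_Ioo hm hm0 (by fun_prop)
    fun α h => mul_pos (sin_pi_mul_pos h) h.1
  set d := ‖(complexMGF id m q)⁻¹‖
  have hlim : Tendsto (fun R : ℝ => ((R * c)⁻¹ + d * rexp q * rexp (-R)) /
      (1 - rexp q * rexp (-R)) * |π - -π|)
      atTop (𝓝 ((0 + d * rexp q * 0) / (1 - rexp q * 0) * |π - -π|)) := by
    have he : Tendsto (fun R : ℝ => rexp (-R)) atTop (𝓝 0) := tendsto_exp_neg_atTop_nhds_zero
    refine Tendsto.mul_const _ (Tendsto.div ?_ (tendsto_const_nhds.sub (he.const_mul _)) (by simp))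
    exact ((tendsto_id.atTop_mul_const hcpos).inv_tendsto_atTop).add (he.const_mul _)
  simp only [mul_zero, add_zero, zero_div, zero_mul] at hlim
  rw [tendsto_iff_norm_sub_tendsto_zero]
  refine squeeze_zero' (Eventually.of_forall fun _ => norm_nonneg _) ?_ hlim
  filter_upwards [eventually_gt_atTop 0, eventually_gt_atTop q] with R hR hRq
  have hcont : Continuous fun y : ℝ => contourIntegrand m q (R + (max (-π) (min π y) : ℝ) * Complex.I) :=
    (differentiableOn_contourIntegrand hm hm0 q).continuousOn.comp_continuous
      (by fun_prop) (by
        intro y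
        simp only [mem_ofPred_eq, Complex.add_im, Complex.ofReal_im, Complex.mul_im,
          Complex.ofReal_re, Complex.I_im, Complex.I_re, mul_one, mul_zero, zero_add, add_zero]
        exact abs_le.2 ⟨le_max_left _ _, max_le (neg_le_self pi_pos.le) (min_le_left _ _)⟩)
  have hint : IntervalIntegrable (fun y : ℝ => contourIntegrand m q (R + y * Complex.I))
      volume (-π) π := by
    refine (hcont.intervalIntegrable _ _).congr fun y hy => ?_
    rw [uIoc_of_le (neg_le_self pi_pos.le)] at hy
    simp only [min_eq_right hy.2, max_eq_right hy.1.le]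
  have hsub : (∫ y in (-π)..π, contourIntegrand m q (R + y * Complex.I)) -
      -(2 * π * (complexMGF id m q)⁻¹) =
      ∫ y in (-π)..π, (contourIntegrand m q (R + y * Complex.I) + (complexMGF id m q)⁻¹) := by
    rw [intervalIntegral.integral_add hint (by simp), intervalIntegral.integral_const, sub_neg_eq_add]
    simp only [sub_neg_eq_add, Complex.real_smul, Complex.ofReal_add]
    ring
  rw [hsub]
  refine intervalIntegral.norm_integral_le_of_norm_le_const fun y hy => ?_
  have hy' : |y| ≤ π := by
    rw [uIoc_of_le (neg_le_self pi_pos.le)] at hy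
    exact abs_le.2 ⟨hy.1.le, hy.2⟩
  have hexp : ‖Complex.exp (R + y * Complex.I)‖ = rexp R := by
    rw [Complex.norm_exp]; simp
  have hexpq : ‖Complex.exp q‖ = rexp q := by
    rw [Complex.norm_exp]; simp
  have hpos : 0 < rexp R - rexp q := sub_pos.2 (exp_lt_exp.2 (by linarith))
  have hden : rexp R - rexp q ≤
      ‖Complex.exp (R + y * Complex.I) - Complex.exp q‖ := by
    rw [← hexp, ← hexpq]
    exact norm_sub_norm_le _ _
  have hsne : Complex.exp (R + y * Complex.I) - Complex.exp q ≠ 0 :=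
    norm_pos_iff.1 (hpos.trans_le hden)
  have hne : (R + y * Complex.I : ℂ) ≠ q := fun h => by
    rw [h, sub_self] at hsne
    exact hsne rfl
  have hH := (mul_le_sinTransform hm R).trans (sinTransform_le_norm hm R hy')
  have hH' : ‖(complexMGF id m (R + y * Complex.I))⁻¹‖ ≤ (R * c)⁻¹ := by
    rw [norm_inv]
    exact inv_anti₀ (by positivity) hH
  have hval : contourIntegrand m q (R + y * Complex.I) + (complexMGF id m q)⁻¹ =
      ((complexMGF id m (R + y * Complex.I))⁻¹ * Complex.exp (R + y * Complex.I) -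
        (complexMGF id m q)⁻¹ * Complex.exp q) /
        (Complex.exp (R + y * Complex.I) - Complex.exp q) := by
    rw [contourIntegrand_of_ne hne]
    generalize (complexMGF id m q)⁻¹ = a
    generalize (complexMGF id m (R + y * Complex.I))⁻¹ = b
    field_simp
    ring
  have hscale : ((R * c)⁻¹ + d * rexp q * rexp (-R)) / (1 - rexp q * rexp (-R)) =
      ((R * c)⁻¹ * rexp R + d * rexp q) / (rexp R - rexp q) := by
    have h1 : rexp (-R) * rexp R = 1 := by rw [← Real.exp_add]; simp
    rw [← mul_div_mul_right _ _ (exp_pos R).ne']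
    congr 1
    · linear_combination d * rexp q * h1
    · linear_combination -rexp q * h1
  rw [hval, hscale, norm_div]
  refine div_le_div₀ (by positivity) ?_ hpos hden
  refine (norm_sub_le _ _).trans ?_
  rw [norm_mul, norm_mul, hexp, hexpq]
  gcongr

lemma tendsto_integral_neg_im_inv (hm : ∀ᵐ α ∂m, α ∈ Ioo (0 : ℝ) 1) (hm0 : m ≠ 0) (q : ℝ) :
    Tendsto (fun R : ℝ => ∫ x in (-R)..R, -((complexMGF id m (x + π * Complex.I))⁻¹).im *
        (rexp x / (rexp x + rexp q))) atTop (𝓝 (π / mgf id m q)) := by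
  have h := ((tendsto_integral_contourIntegrand_left hm hm0 q).sub
    (tendsto_integral_contourIntegrand_right hm hm0 q)).congr
    fun R => (integral_contourIntegrand hm hm0 q R).symm
  have h2 := (Complex.continuous_re.tendsto _).comp (h.const_mul (1 / 2 : ℂ))
  rw [complexMGF_ofReal] at h2
  have e : ((1 / 2 : ℂ) * (0 - -(2 * π * ((mgf id m q : ℝ) : ℂ)⁻¹))).re = π / mgf id m q := by
    rw [← Complex.ofReal_re (π / mgf id m q)]
    congr 1
    push_cast
    ring
  rw [e] at h2
  refine h2.congr fun R => ?_
  simp only [Function.comp]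
  rw [← mul_assoc]
  norm_num

end Contour

section Kernels

variable (m) in
/-- The density of the Stieltjes representation of `p ↦ 1 / ∫ p ^ α ∂m`, up to the factor `π`. -/
noncomputable def stieltjesDensity (r : ℝ) : ℝ :=
  (∫ α, sin (π * α) * r ^ α ∂m) /
    ((∫ α, sin (π * α) * r ^ α ∂m) ^ 2 + (∫ α, cos (π * α) * r ^ α ∂m) ^ 2)

variable (m) in
/-- The kernel of the distributed-order fractional integral. -/
noncomputable def integralKernel (t : ℝ) : ℝ :=
  (1 / π) * ∫ r in Ioi (0 : ℝ), rexp (-r * t) * stieltjesDensity m r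

variable (m) in
/-- The kernel of the distributed-order fractional derivative. -/
noncomputable def derivativeKernel (t : ℝ) : ℝ :=
  ∫ α, t ^ (-α) * (Gamma (1 - α))⁻¹ ∂m

lemma measurable_inv_Gamma : Measurable fun x : ℝ => (Gamma x)⁻¹ := by
  have h : Measurable fun x : ℝ => ((Complex.Gamma x)⁻¹).re :=
    (Complex.continuous_re.comp
      (Complex.differentiable_one_div_Gamma.continuous.comp Complex.continuous_ofReal)).measurable
  convert h using 2 with x
  rw [Complex.Gamma_ofReal, ← Complex.ofReal_inv, Complex.ofReal_re]

lemma ofReal_exp_mul_ofReal_exp {a b : ℝ} : ENNReal.ofReal (rexp a) * ENNReal.ofReal (rexp b) =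
    ENNReal.ofReal (rexp (a + b)) := by
  rw [← ENNReal.ofReal_mul (exp_pos _).le, Real.exp_add]

lemma lintegral_exp_neg_mul_Ioi {a : ℝ} (ha : 0 < a) :
    ∫⁻ t in Ioi (0 : ℝ), ENNReal.ofReal (rexp (-a * t)) = ENNReal.ofReal (1 / a) := by
  rw [← ofReal_integral_eq_lintegral_ofReal (integrableOn_exp_mul_Ioi (by linarith) 0)
    (ae_of_all _ fun _ => (exp_pos _).le), integral_exp_mul_Ioi (by linarith)]
  simp

lemma complexMGF_add_pi_mul_I [IsFiniteMeasure m] (hm : ∀ᵐ α ∂m, α ∈ Ioo (0 : ℝ) 1) (x : ℝ) :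
    complexMGF id m (x + π * Complex.I) =
      ⟨∫ α, cos (π * α) * rexp x ^ α ∂m, ∫ α, sin (π * α) * rexp x ^ α ∂m⟩ := by
  have hi : Integrable (fun α : ℝ => Complex.exp ((x + π * Complex.I) * (α : ℂ))) m :=
    integrable_of_continuous hm (by fun_prop)
  have hre : ∀ α : ℝ, ((x + π * Complex.I) * (α : ℂ)).re = x * α := by intro α; simp
  have him : ∀ α : ℝ, ((x + π * Complex.I) * (α : ℂ)).im = π * α := by intro α; simp
  apply Complex.ext
  · refine (integral_re (𝕜 := ℂ) hi).symm.trans (integral_congr_ae (ae_of_all _ fun α => ?_))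
    simp only [RCLike.re_eq_complex_re, Complex.exp_re, hre, him, ← Real.exp_mul]
    ring
  · refine (integral_im (𝕜 := ℂ) hi).symm.trans (integral_congr_ae (ae_of_all _ fun α => ?_))
    simp only [RCLike.im_eq_complex_im, Complex.exp_im, hre, him, ← Real.exp_mul]
    ring

variable (m) in
lemma measurable_stieltjesDensity [SFinite m] : Measurable (stieltjesDensity m) := by
  have h : ∀ f : ℝ → ℝ, Measurable f → Measurable fun r : ℝ => ∫ α, f α * r ^ α ∂m := fun f hf =>
    (StronglyMeasurable.integral_prod_right'
      (f := fun z : ℝ × ℝ => f z.2 * z.1 ^ z.2) (by fun_prop : Measurable _).stronglyMeasurable).measurable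
  have hs := h (fun α => sin (π * α)) (by fun_prop)
  have hc := h (fun α => cos (π * α)) (by fun_prop)
  unfold stieltjesDensity
  fun_prop

variable (m) in
lemma measurable_integralKernel [SFinite m] : Measurable (integralKernel m) := by
  have := measurable_stieltjesDensity m
  refine Measurable.const_mul ?_ _
  exact (StronglyMeasurable.integral_prod_right'
      (f := fun z : ℝ × ℝ => rexp (-z.2 * z.1) * stieltjesDensity m z.2)
      (by fun_prop : Measurable _).stronglyMeasurable).measurable

variable (m) in
lemma measurable_derivativeKernel [SFinite m] : Measurable (derivativeKernel m) := by
  have := measurable_inv_Gamma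
  refine (StronglyMeasurable.integral_prod_right'
      (f := fun z : ℝ × ℝ => z.1 ^ (-z.2) * (Gamma (1 - z.2))⁻¹)
      (Measurable.stronglyMeasurable ?_)).measurable
  exact (by fun_prop : Measurable fun z : ℝ × ℝ => z.1 ^ (-z.2)).mul
    (this.comp (by fun_prop : Measurable fun z : ℝ × ℝ => 1 - z.2))

lemma stieltjesDensity_nonneg (hm : ∀ᵐ α ∂m, α ∈ Ioo (0 : ℝ) 1) {r : ℝ} (hr : 0 < r) :
    0 ≤ stieltjesDensity m r :=
  div_nonneg (integral_nonneg_of_ae (hm.mono fun _ h =>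
    mul_nonneg (sin_pi_mul_pos h).le (rpow_nonneg hr.le _))) (by positivity)

lemma integralKernel_nonneg (hm : ∀ᵐ α ∂m, α ∈ Ioo (0 : ℝ) 1) (t : ℝ) :
    0 ≤ integralKernel m t :=
  mul_nonneg (by positivity) (setIntegral_nonneg measurableSet_Ioi fun _ hr =>
    mul_nonneg (exp_pos _).le (stieltjesDensity_nonneg hm hr))

lemma derivativeKernel_nonneg (hm : ∀ᵐ α ∂m, α ∈ Ioo (0 : ℝ) 1) {t : ℝ} (ht : 0 < t) :
    0 ≤ derivativeKernel m t :=
  integral_nonneg_of_ae (hm.mono fun α h => mul_nonneg (rpow_nonneg ht.le _)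
    (inv_nonneg.2 (Gamma_pos_of_pos (by linarith [h.2])).le))

variable [IsFiniteMeasure m]

lemma lintegral_stieltjesDensity_div (hm : ∀ᵐ α ∂m, α ∈ Ioo (0 : ℝ) 1) (hm0 : m ≠ 0) {p : ℝ}
    (hp : 0 < p) :
    ∫⁻ r in Ioi (0 : ℝ), ENNReal.ofReal (stieltjesDensity m r / (r + p)) =
      ENNReal.ofReal (π / ∫ α, p ^ α ∂m) := by
  obtain ⟨q, rfl⟩ : ∃ q, rexp q = p := ⟨log p, exp_log hp⟩
  have himg : Ioi (0 : ℝ) = rexp '' univ := by rw [image_univ, range_exp]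
  rw [himg, lintegral_image_eq_lintegral_abs_deriv_mul MeasurableSet.univ
    (fun x _ => (hasDerivAt_exp x).hasDerivWithinAt) exp_injective.injOn, Measure.restrict_univ]
  set φ : ℝ → ℝ := fun x => -((complexMGF id m (x + π * Complex.I))⁻¹).im *
        (rexp x / (rexp x + rexp q)) with hφ
  have hval : ∀ x, ENNReal.ofReal |rexp x| * ENNReal.ofReal (stieltjesDensity m (rexp x) /
      (rexp x + rexp q)) = ENNReal.ofReal (φ x) := by
    intro x
    rw [← ENNReal.ofReal_mul (abs_nonneg _), abs_of_pos (exp_pos x)]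
    congr 1
    simp only [hφ, stieltjesDensity, complexMGF_add_pi_mul_I hm, Complex.inv_im, Complex.normSq_mk]
    ring
  have hφ0 : ∀ x, 0 ≤ φ x := by
    intro x
    have : φ x = rexp x * (stieltjesDensity m (rexp x) / (rexp x + rexp q)) := by
      simp only [hφ, stieltjesDensity, complexMGF_add_pi_mul_I hm, Complex.inv_im, Complex.normSq_mk]
      ring
    rw [this]
    have := stieltjesDensity_nonneg hm (exp_pos x)
    positivity
  have hφc : Continuous φ := by
    have h1 : Continuous fun x : ℝ => (complexMGF id m (x + π * Complex.I))⁻¹ :=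
      ((differentiable_complexMGF_id hm).continuous.comp (by fun_prop)).inv₀ fun x =>
        complexMGF_id_ne_zero hm hm0 (by simp [abs_of_pos pi_pos])
    exact (Complex.continuous_im.comp h1).neg.mul
      (continuous_exp.div (by fun_prop) fun x => by positivity)
  have hlim := tendsto_integral_neg_im_inv hm hm0 q
  have hint : Integrable φ := by
    refine integrable_of_intervalIntegral_norm_tendsto (a := fun R => -R) (b := id) (l := atTop)
      (π / mgf id m q)
      (fun R => (hφc.integrableOn_Icc).mono_set Ioc_subset_Icc_self) tendsto_neg_atTop_atBot
      tendsto_id ?_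
    simp only [Real.norm_of_nonneg (hφ0 _)]
    exact hlim
  have heq : ∫ x, φ x = π / mgf id m q :=
    tendsto_nhds_unique (intervalIntegral_tendsto_integral hint tendsto_neg_atTop_atBot tendsto_id)
      hlim
  simp_rw [hval]
  rw [← ofReal_integral_eq_lintegral_ofReal hint (ae_of_all _ hφ0), heq, mgf]
  simp only [id, ← Real.exp_mul]

lemma integrableOn_exp_mul_stieltjesDensity (hm : ∀ᵐ α ∂m, α ∈ Ioo (0 : ℝ) 1) (hm0 : m ≠ 0)
    {t : ℝ} (ht : 0 < t) :
    IntegrableOn (fun r => rexp (-r * t) * stieltjesDensity m r) (Ioi 0) := by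
  have hmeas := measurable_stieltjesDensity m
  have h1 : IntegrableOn (fun r => stieltjesDensity m r / (r + t⁻¹)) (Ioi 0) := by
    refine ⟨(hmeas.div (by fun_prop)).aestronglyMeasurable, ?_⟩
    rw [hasFiniteIntegral_iff_ofReal, lintegral_stieltjesDensity_div hm hm0 (inv_pos.2 ht)]
    · exact ENNReal.ofReal_lt_top
    · filter_upwards [ae_restrict_mem measurableSet_Ioi] with r hr
      exact div_nonneg (stieltjesDensity_nonneg hm hr) (add_pos hr (inv_pos.2 ht)).le
  refine (h1.const_mul t⁻¹).mono' (by fun_prop) ?_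
  filter_upwards [ae_restrict_mem measurableSet_Ioi] with r (hr : 0 < r)
  have hS := stieltjesDensity_nonneg hm hr
  rw [Real.norm_of_nonneg (by positivity), div_eq_mul_inv, mul_comm (stieltjesDensity m r),
    ← mul_assoc]
  gcongr
  rw [← mul_inv, mul_add, mul_inv_cancel₀ ht.ne', neg_mul, Real.exp_neg, mul_comm t r]
  exact inv_anti₀ (by positivity) (add_one_le_exp _)

lemma lintegral_exp_neg_mul_integralKernel (hm : ∀ᵐ α ∂m, α ∈ Ioo (0 : ℝ) 1) (hm0 : m ≠ 0)
    {p : ℝ} (hp : 0 < p) :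
    ∫⁻ t in Ioi (0 : ℝ), ENNReal.ofReal (rexp (-p * t)) * ENNReal.ofReal (integralKernel m t) =
      ENNReal.ofReal (1 / ∫ α, p ^ α ∂m) := by
  have hmeas := measurable_stieltjesDensity m
  have h1 : ∀ t ∈ Ioi (0 : ℝ), ENNReal.ofReal (rexp (-p * t)) * ENNReal.ofReal (integralKernel m t) =
      ENNReal.ofReal (1 / π) * ∫⁻ r in Ioi (0 : ℝ), ENNReal.ofReal (stieltjesDensity m r) *
        ENNReal.ofReal (rexp (-(r + p) * t)) := by
    intro t ht
    rw [integralKernel, ENNReal.ofReal_mul (by positivity),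
      ofReal_integral_eq_lintegral_ofReal (integrableOn_exp_mul_stieltjesDensity hm hm0 ht),
      mul_left_comm, ← lintegral_const_mul _ (by fun_prop)]
    · congr 1
      refine lintegral_congr fun r => ?_
      rw [ENNReal.ofReal_mul (exp_pos _).le, ← mul_assoc, ofReal_exp_mul_ofReal_exp, mul_comm]
      ring_nf
    · filter_upwards [ae_restrict_mem measurableSet_Ioi] with r hr
      exact mul_nonneg (exp_pos _).le (stieltjesDensity_nonneg hm hr)
  rw [setLIntegral_congr_fun measurableSet_Ioi h1, lintegral_const_mul' _ _ ENNReal.ofReal_ne_top,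
    lintegral_lintegral_swap (by fun_prop)]
  have h2 : ∀ r ∈ Ioi (0 : ℝ), ∫⁻ t in Ioi (0 : ℝ), ENNReal.ofReal (stieltjesDensity m r) *
        ENNReal.ofReal (rexp (-(r + p) * t)) =
      ENNReal.ofReal (stieltjesDensity m r / (r + p)) := by
    intro r (hr : 0 < r)
    rw [lintegral_const_mul' _ _ ENNReal.ofReal_ne_top, lintegral_exp_neg_mul_Ioi (by positivity),
      ← ENNReal.ofReal_mul (stieltjesDensity_nonneg hm hr), mul_one_div]
  rw [setLIntegral_congr_fun measurableSet_Ioi h2, lintegral_stieltjesDensity_div hm hm0 hp,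
    ← ENNReal.ofReal_mul (by positivity)]
  congr 1
  field_simp

lemma lintegral_exp_neg_mul_derivativeKernel (hm : ∀ᵐ α ∂m, α ∈ Ioo (0 : ℝ) 1)
    {p : ℝ} (hp : 0 < p) :
    ∫⁻ t in Ioi (0 : ℝ), ENNReal.ofReal (rexp (-p * t)) * ENNReal.ofReal (derivativeKernel m t) =
      ENNReal.ofReal ((∫ α, p ^ α ∂m) / p) := by
  have hG := measurable_inv_Gamma.comp (by fun_prop : Measurable fun α : ℝ => 1 - α)
  have hG' : Measurable fun z : ℝ × ℝ => (Gamma (1 - z.2))⁻¹ := hG.comp measurable_snd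
  have h1 : ∀ t ∈ Ioi (0 : ℝ), ENNReal.ofReal (rexp (-p * t)) *
      ENNReal.ofReal (derivativeKernel m t) =
      ∫⁻ α, ENNReal.ofReal (rexp (-p * t)) * ENNReal.ofReal (t ^ (-α) * (Gamma (1 - α))⁻¹) ∂m := by
    intro t (ht : 0 < t)
    rw [derivativeKernel, ofReal_integral_eq_lintegral_ofReal,
      lintegral_const_mul' _ _ ENNReal.ofReal_ne_top]
    · refine integrable_of_continuous hm (ContinuousOn.mul ?_ ?_)
      · exact (Real.continuous_const_rpow ht.ne').comp_continuousOn (by fun_prop)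
      · have : Continuous fun α : ℝ => ((Complex.Gamma ((1 - α : ℝ) : ℂ))⁻¹).re :=
          Complex.continuous_re.comp (Complex.differentiable_one_div_Gamma.continuous.comp
            (by fun_prop))
        convert this.continuousOn using 2 with α
        rw [Complex.Gamma_ofReal, ← Complex.ofReal_inv, Complex.ofReal_re]
    · exact hm.mono fun α h => mul_nonneg (rpow_nonneg ht.le _)
        (inv_nonneg.2 (Gamma_pos_of_pos (by linarith [h.2])).le)
  rw [setLIntegral_congr_fun measurableSet_Ioi h1, lintegral_lintegral_swap]
  swap
  · refine Measurable.aemeasurable ?_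
    exact (by fun_prop : Measurable fun z : ℝ × ℝ => ENNReal.ofReal (rexp (-p * z.1))).mul
      ((by fun_prop : Measurable fun z : ℝ × ℝ => z.1 ^ (-z.2)).mul hG').ennreal_ofReal
  have h2 : ∀ᵐ α ∂m, ∫⁻ t in Ioi (0 : ℝ), ENNReal.ofReal (rexp (-p * t)) *
      ENNReal.ofReal (t ^ (-α) * (Gamma (1 - α))⁻¹) = ENNReal.ofReal (p ^ α / p) := by
    filter_upwards [hm] with α hα
    have hpos : 0 < 1 - α := by linarith [hα.2]
    have hΓ := Gamma_pos_of_pos hpos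
    have hval := integral_rpow_mul_exp_neg_mul_Ioi hpos hp
    have hint : IntegrableOn (fun t : ℝ => t ^ (1 - α - 1) * rexp (-(p * t))) (Ioi 0) := by
      by_contra h
      rw [integral_undef h] at hval
      have : 0 < (1 / p) ^ (1 - α) * Gamma (1 - α) := by positivity
      linarith
    calc _ = ∫⁻ t in Ioi (0 : ℝ), ENNReal.ofReal
          (t ^ (1 - α - 1) * rexp (-(p * t)) * (Gamma (1 - α))⁻¹) := by
          refine lintegral_congr fun t => ?_
          rw [← ENNReal.ofReal_mul (exp_pos _).le]
          congr 1
          rw [show 1 - α - 1 = -α by ring, neg_mul]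
          ring
      _ = _ := by
          rw [← ofReal_integral_eq_lintegral_ofReal (hint.mul_const _), integral_mul_const, hval,
            mul_assoc, mul_inv_cancel₀ hΓ.ne', mul_one, one_div, inv_rpow hp.le, ← rpow_neg hp.le,
            neg_sub, rpow_sub hp, rpow_one]
          filter_upwards [ae_restrict_mem measurableSet_Ioi] with t (ht : 0 < t)
          positivity
  rw [lintegral_congr_ae h2, ← integral_div, ofReal_integral_eq_lintegral_ofReal]
  · refine integrable_of_continuous hm ?_
    exact ((Real.continuous_const_rpow hp.ne').div_const _).continuousOn
  · exact ae_of_all _ fun α => by positivity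

end Kernels

section Laplace

lemma mgf_id_withDensity_exp_neg {M : ℝ → ℝ≥0∞} (hM : Measurable M) (hM0 : ∀ x ≤ 0, M x = 0)
    (hL : ∀ p > 0, ∫⁻ x, ENNReal.ofReal (rexp (-p * x)) * M x = ENNReal.ofReal (1 / p)) (q : ℝ) :
    mgf id (volume.withDensity fun x => ENNReal.ofReal (rexp (-x)) * M x) q =
      if q < 1 then 1 / (1 - q) else 0 := by
  rw [mgf, integral_eq_lintegral_of_nonneg_ae (ae_of_all _ fun _ => (exp_pos _).le) (by fun_prop),
    lintegral_withDensity_eq_lintegral_mul _ (by fun_prop) (by fun_prop)]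
  have h : ∀ x, ((fun x => ENNReal.ofReal (rexp (-x)) * M x) * fun x =>
      ENNReal.ofReal (rexp (q * id x))) x = ENNReal.ofReal (rexp (-(1 - q) * x)) * M x := by
    intro x
    simp only [Pi.mul_apply, id]
    rw [mul_right_comm, ofReal_exp_mul_ofReal_exp]
    ring_nf
  simp_rw [h]
  split_ifs with hq
  · rw [hL _ (by linarith), ENNReal.toReal_ofReal (one_div_nonneg.2 (by linarith))]
  · rw [ENNReal.toReal_eq_zero_iff]
    right
    refine ENNReal.eq_top_of_forall_nnreal_le fun c => ?_
    have hc : 0 < (c : ℝ) + 1 := by positivity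
    calc (c : ℝ≥0∞) ≤ ENNReal.ofReal (1 / (1 / ((c : ℝ) + 1))) := by
          rw [one_div_one_div, ← ENNReal.ofReal_coe_nnreal]
          exact ENNReal.ofReal_le_ofReal (by linarith)
      _ = _ := (hL (1 / ((c : ℝ) + 1)) (by positivity)).symm
      _ ≤ _ := lintegral_mono fun x => by
          rcases le_or_gt x 0 with hx | hx
          · simp [hM0 x hx]
          · have : 0 < 1 / ((c : ℝ) + 1) := by positivity
            gcongr
            linarith

/-- A function on the half-line whose Laplace transform is `1 / p` is almost everywhere `1`. -/
lemma ae_eq_one_of_laplace {M : ℝ → ℝ≥0∞} (hM : Measurable M) (hM0 : ∀ x ≤ 0, M x = 0)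
    (hL : ∀ p > 0, ∫⁻ x, ENNReal.ofReal (rexp (-p * x)) * M x = ENNReal.ofReal (1 / p)) :
    ∀ᵐ x, 0 < x → M x = 1 := by
  set N : ℝ → ℝ≥0∞ := (Ioi (0 : ℝ)).indicator 1 with hN
  have hNm : Measurable N := measurable_one.indicator measurableSet_Ioi
  have hN0 : ∀ x ≤ 0, N x = 0 := fun x hx => indicator_of_notMem (by simpa using hx) _
  have hNL : ∀ p > 0, ∫⁻ x, ENNReal.ofReal (rexp (-p * x)) * N x = ENNReal.ofReal (1 / p) := by
    intro p hp
    rw [← lintegral_exp_neg_mul_Ioi hp, ← lintegral_indicator measurableSet_Ioi]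
    refine lintegral_congr fun x => ?_
    by_cases hx : x ∈ Ioi (0 : ℝ) <;> simp [hN, hx]
  have hmass : ∀ L : ℝ → ℝ≥0∞,
      (∀ p > 0, ∫⁻ x, ENNReal.ofReal (rexp (-p * x)) * L x = ENNReal.ofReal (1 / p)) →
      ∫⁻ x, ENNReal.ofReal (rexp (-x)) * L x = 1 := by
    intro L h
    simpa using h 1 one_pos
  have hM1 := hmass M hL
  have hN1 := hmass N hNL
  set ν₁ := volume.withDensity fun x => ENNReal.ofReal (rexp (-x)) * M x with hν₁
  set ν₂ := volume.withDensity fun x => ENNReal.ofReal (rexp (-x)) * N x with hν₂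
  have hp₁ : IsProbabilityMeasure ν₁ := ⟨by rw [hν₁, withDensity_apply _ .univ, setLIntegral_univ, hM1]⟩
  have hp₂ : IsProbabilityMeasure ν₂ := ⟨by rw [hν₂, withDensity_apply _ .univ, setLIntegral_univ, hN1]⟩
  have hmgf : ∀ q, mgf id ν₁ q = if q < 1 then 1 / (1 - q) else 0 :=
    mgf_id_withDensity_exp_neg hM hM0 hL
  have hmgf_eq : mgf id ν₁ = mgf id ν₂ := funext fun q => by
    rw [hmgf, hν₂, mgf_id_withDensity_exp_neg hNm hN0 hNL]
  have hset : Iio (1 : ℝ) ⊆ integrableExpSet id ν₁ := fun q (hq : q < 1) => by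
    by_contra h
    have h0 := hmgf q
    rw [mgf_undef h, if_pos hq] at h0
    have : 0 < 1 / (1 - q) := one_div_pos.2 (by linarith)
    linarith
  have hmem : (0 : ℝ) ∈ interior (integrableExpSet id ν₁) :=
    interior_mono hset (by simp [isOpen_Iio.interior_eq])
  have hν : ν₁ = ν₂ := by
    refine Measure.ext_of_charFun (funext fun t => ?_)
    rw [← complexMGF_id_mul_I, ← complexMGF_id_mul_I]
    exact eqOn_complexMGF_of_mgf hmgf_eq (by simpa using hmem)
  have hae := (withDensity_eq_iff (by fun_prop) (by fun_prop) (by rw [hM1]; simp)).1 hν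
  filter_upwards [hae] with x hx hx0
  have hx1 : N x = 1 := indicator_of_mem hx0 _
  rw [hx1] at hx
  exact (ENNReal.mul_right_inj (by simpa using exp_pos (-x)) ENNReal.ofReal_ne_top).1 hx

lemma lintegral_exp_neg_mul_conv {G K : ℝ → ℝ≥0∞} (hG : Measurable G) (hK : Measurable K) (p : ℝ) :
    ∫⁻ x, ENNReal.ofReal (rexp (-p * x)) * ∫⁻ y, G (x - y) * K y =
      (∫⁻ x, ENNReal.ofReal (rexp (-p * x)) * G x) *
        ∫⁻ y, ENNReal.ofReal (rexp (-p * y)) * K y := by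
  calc _ = ∫⁻ x, ∫⁻ y, (ENNReal.ofReal (rexp (-p * (x - y))) * G (x - y)) *
        (ENNReal.ofReal (rexp (-p * y)) * K y) := by
        refine lintegral_congr fun x => ?_
        rw [← lintegral_const_mul' _ _ ENNReal.ofReal_ne_top]
        refine lintegral_congr fun y => ?_
        rw [mul_mul_mul_comm, ofReal_exp_mul_ofReal_exp]
        ring_nf
    _ = ∫⁻ y, ∫⁻ x, (ENNReal.ofReal (rexp (-p * (x - y))) * G (x - y)) *
        (ENNReal.ofReal (rexp (-p * y)) * K y) := lintegral_lintegral_swap (by fun_prop)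
    _ = ∫⁻ y, (∫⁻ x, ENNReal.ofReal (rexp (-p * x)) * G x) *
        (ENNReal.ofReal (rexp (-p * y)) * K y) := by
        refine lintegral_congr fun y => ?_
        rw [lintegral_mul_const _ (by fun_prop),
          lintegral_sub_right_eq_self (fun x => ENNReal.ofReal (rexp (-p * x)) * G x) y]
    _ = _ := lintegral_const_mul _ (by fun_prop)

/-- The two kernels form a Sonine pair. -/
lemma ae_conv_kernels_eq_one [IsFiniteMeasure m] (hm : ∀ᵐ α ∂m, α ∈ Ioo (0 : ℝ) 1) (hm0 : m ≠ 0) :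
    ∀ᵐ x : ℝ, 0 < x → ∫⁻ y, ENNReal.ofReal ((Ioi 0).indicator (integralKernel m) (x - y)) *
      ENNReal.ofReal ((Ioi 0).indicator (derivativeKernel m) y) = 1 := by
  have hg := (measurable_integralKernel m).indicator (measurableSet_Ioi (a := (0 : ℝ)))
  have hk := (measurable_derivativeKernel m).indicator (measurableSet_Ioi (a := (0 : ℝ)))
  have hind : ∀ (f : ℝ → ℝ) (p : ℝ),
      ∫⁻ t, ENNReal.ofReal (rexp (-p * t)) * ENNReal.ofReal ((Ioi 0).indicator f t) =
      ∫⁻ t in Ioi (0 : ℝ), ENNReal.ofReal (rexp (-p * t)) * ENNReal.ofReal (f t) := by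
    intro f p
    rw [← lintegral_indicator measurableSet_Ioi]
    refine lintegral_congr fun t => ?_
    by_cases ht : t ∈ Ioi (0 : ℝ) <;> simp [ht]
  have hmeas : Measurable fun z : ℝ × ℝ =>
      ENNReal.ofReal ((Ioi 0).indicator (integralKernel m) (z.1 - z.2)) *
      ENNReal.ofReal ((Ioi 0).indicator (derivativeKernel m) z.2) :=
    (hg.comp (by fun_prop)).ennreal_ofReal.mul (hk.comp (by fun_prop)).ennreal_ofReal
  refine ae_eq_one_of_laplace hmeas.lintegral_prod_right' (fun x hx => ?_) fun p hp => ?_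
  · rw [lintegral_eq_zero_of_ae_eq_zero]
    refine ae_of_all _ fun y => ?_
    by_cases hy : 0 < y
    · simp [show y < x ↔ False by simp; linarith]
    · simp [hy]
  · have hpos : 0 < ∫ α, p ^ α ∂m := integral_pos_of_pos_on_Ioo hm hm0
      (Real.continuous_const_rpow hp.ne').continuousOn fun α _ => rpow_pos_of_pos hp α
    rw [lintegral_exp_neg_mul_conv hg.ennreal_ofReal hk.ennreal_ofReal, hind, hind,
      lintegral_exp_neg_mul_integralKernel hm hm0 hp, lintegral_exp_neg_mul_derivativeKernel hm hp,
      ← ENNReal.ofReal_mul (by positivity)]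
    congr 1
    field_simp

end Laplace

section Inversion

/-- If `G * K = 1` on the half-line, then `G * (K * v)` is the primitive of `v`. -/
lemma integral_conv_conv {G K v : ℝ → ℝ} (hG : Measurable G) (hK : Measurable K)
    (hG0 : ∀ x, 0 ≤ G x) (hK0 : ∀ x, 0 ≤ K x)
    (h : ∀ᵐ x : ℝ, 0 < x → ∫⁻ y, ENNReal.ofReal (G (x - y)) * ENNReal.ofReal (K y) = 1)
    (hv : Integrable v) {t : ℝ} (hvt : ∀ s, t ≤ s → v s = 0) :
    ∫ τ, G (t - τ) * ∫ s, K (τ - s) * v s = ∫ s, v s := by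
  have hae : ∀ᵐ s : ℝ, s < t →
      ∫⁻ τ, ENNReal.ofReal (G (t - τ)) * ENNReal.ofReal (K (τ - s)) = 1 := by
    filter_upwards [(Measure.measurePreserving_sub_left volume t).quasiMeasurePreserving.ae h]
      with s hs hst
    rw [← hs (by linarith), ← lintegral_sub_right_eq_self
      (fun y => ENNReal.ofReal (G (t - s - y)) * ENNReal.ofReal (K y)) s]
    simp
  have hmeas : AEStronglyMeasurable (fun z : ℝ × ℝ => G (t - z.2) * K (z.2 - z.1) * v z.1)
      (volume.prod volume) := by
    refine AEStronglyMeasurable.mul (Measurable.aestronglyMeasurable ?_)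
      hv.aestronglyMeasurable.comp_fst
    exact (hG.comp (by fun_prop)).mul (hK.comp (by fun_prop))
  have hnorm : ∀ᵐ s : ℝ, ∫⁻ τ, ‖G (t - τ) * K (τ - s) * v s‖ₑ = ‖v s‖ₑ := by
    filter_upwards [hae] with s hs
    rcases lt_or_ge s t with hst | hst
    · have : ∀ τ, ‖G (t - τ) * K (τ - s) * v s‖ₑ =
          ENNReal.ofReal (G (t - τ)) * ENNReal.ofReal (K (τ - s)) * ‖v s‖ₑ := fun τ => by
        rw [enorm_mul, enorm_mul, Real.enorm_of_nonneg (hG0 _), Real.enorm_of_nonneg (hK0 _)]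
      simp_rw [this]
      rw [lintegral_mul_const' _ _ enorm_ne_top, hs hst, one_mul]
    · simp [hvt s hst]
  have hint : Integrable (Function.uncurry fun s τ : ℝ => G (t - τ) * K (τ - s) * v s)
      (volume.prod volume) := by
    refine ⟨hmeas, ?_⟩
    simp only [hasFiniteIntegral_iff_enorm, Function.uncurry]
    rw [lintegral_prod _ hmeas.enorm, lintegral_congr_ae hnorm]
    exact hv.2
  calc ∫ τ, G (t - τ) * ∫ s, K (τ - s) * v s
      = ∫ τ, ∫ s, G (t - τ) * K (τ - s) * v s := by
        simp_rw [mul_assoc, integral_const_mul]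
    _ = ∫ s, ∫ τ, G (t - τ) * K (τ - s) * v s := (integral_integral_swap hint).symm
    _ = ∫ s, v s := by
        refine integral_congr_ae ?_
        filter_upwards [hae] with s hs
        rcases lt_or_ge s t with hst | hst
        · rw [integral_mul_const, integral_eq_lintegral_of_nonneg_ae
            (ae_of_all _ fun τ => mul_nonneg (hG0 _) (hK0 _))
            ((hG.comp (by fun_prop)).mul (hK.comp (by fun_prop))).aestronglyMeasurable]
          simp_rw [ENNReal.ofReal_mul (hG0 _)]
          rw [hs hst, ENNReal.toReal_one, one_mul]
        · simp [hvt s hst]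

lemma intervalIntegral_conv_conv [IsFiniteMeasure m] (hm : ∀ᵐ α ∂m, α ∈ Ioo (0 : ℝ) 1)
    (hm0 : m ≠ 0) {g k v : ℝ → ℝ} (hg : ∀ t, 0 < t → g t = integralKernel m t)
    (hk : ∀ t, 0 < t → k t = derivativeKernel m t) {t : ℝ} (ht : 0 ≤ t)
    (hv : IntegrableOn v (Ioo 0 t)) :
    ∫ τ in (0 : ℝ)..t, g (t - τ) * ∫ s in (0 : ℝ)..τ, k (τ - s) * v s =
      ∫ s in (0 : ℝ)..t, v s := by
  have hg0 : ∀ x, 0 ≤ (Ioi 0).indicator (integralKernel m) x :=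
    indicator_nonneg fun x _ => integralKernel_nonneg hm x
  have hk0 : ∀ x, 0 ≤ (Ioi 0).indicator (derivativeKernel m) x :=
    indicator_nonneg fun x hx => derivativeKernel_nonneg hm hx
  have key := integral_conv_conv
    ((measurable_integralKernel m).indicator measurableSet_Ioi)
    ((measurable_derivativeKernel m).indicator measurableSet_Ioi) hg0 hk0
    (ae_conv_kernels_eq_one hm hm0) (hv.integrable_indicator measurableSet_Ioo) (t := t)
    fun s hs => indicator_of_notMem (fun h => absurd h.2 (not_lt.2 hs)) _
  rw [integral_indicator measurableSet_Ioo] at key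
  rw [intervalIntegral.integral_of_le ht, intervalIntegral.integral_of_le ht,
    integral_Ioc_eq_integral_Ioo, integral_Ioc_eq_integral_Ioo, ← key,
    ← integral_indicator measurableSet_Ioo]
  congr 1 with τ
  by_cases hτ : τ ∈ Ioo 0 t
  · rw [indicator_of_mem hτ, indicator_of_mem (show t - τ ∈ Ioi 0 from sub_pos.2 hτ.2),
      hg _ (sub_pos.2 hτ.2), intervalIntegral.integral_of_le hτ.1.le,
      integral_Ioc_eq_integral_Ioo, ← integral_indicator measurableSet_Ioo]
    congr 2 with s
    by_cases hs : s ∈ Ioo 0 τ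
    · rw [indicator_of_mem hs, indicator_of_mem (show τ - s ∈ Ioi 0 from sub_pos.2 hs.2),
        indicator_of_mem (show s ∈ Ioo 0 t from ⟨hs.1, hs.2.trans hτ.2⟩), hk _ (sub_pos.2 hs.2)]
    · rw [indicator_of_notMem hs]
      rcases le_or_gt s 0 with h | h
      · rw [indicator_of_notMem (fun h' : s ∈ Ioo 0 t => absurd h'.1 (not_lt.2 h)), mul_zero]
      · rw [indicator_of_notMem (fun h' : τ - s ∈ Ioi 0 => hs ⟨h, sub_pos.1 h'⟩), zero_mul]
  · rw [indicator_of_notMem hτ]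
    rcases lt_or_ge τ t with h | h
    · have h0 : τ ≤ 0 := not_lt.1 fun h' => hτ ⟨h', h⟩
      rw [integral_eq_zero_of_ae, mul_zero]
      refine ae_of_all _ fun s => ?_
      by_cases hs : s ∈ Ioo 0 t
      · simp [show s < τ ↔ False by simp; linarith [hs.1]]
      · simp [hs]
    · rw [indicator_of_notMem (fun h' : t - τ ∈ Ioi 0 => absurd (sub_pos.1 h') (not_lt.2 h)),
        zero_mul]

end Inversion

end DistributedOrder

/-- For every `u ∈ AC[0,T]`, i.e. `u(t) = u(0) + ∫₀ᵗ u'(s) ds` with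
`u' ∈ L¹(0,T)`, one has `(g * (k * u'))(t) = u(t) - u(0)` for every `t ∈ [0,T]`;
that is, `I^{(μ)} D^{(μ)} u = u - u(0)`. -/
theorem stmt_10 (μ : ℝ → ℝ)
    (hμ_int : IntegrableOn μ (Ioo 0 1))
    (hμ_nonneg : ∀ α ∈ Ioo (0:ℝ) 1, 0 ≤ μ α)
    (hμ_ne : ¬ (∀ᵐ α ∂(volume.restrict (Ioo (0:ℝ) 1)), μ α = 0))
    (k : ℝ → ℝ)
    (hk : ∀ t : ℝ, 0 < t → k t = ∫ α in Ioo (0:ℝ) 1, t ^ (-α) * μ α / Real.Gamma (1 - α))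
    (S C g : ℝ → ℝ)
    (hS : ∀ r : ℝ, S r = ∫ α in Ioo (0:ℝ) 1, Real.sin (π * α) * r ^ α * μ α)
    (hC : ∀ r : ℝ, C r = ∫ α in Ioo (0:ℝ) 1, Real.cos (π * α) * r ^ α * μ α)
    (hg : ∀ t : ℝ, 0 < t →
      g t = (1/π) * ∫ r in Ioi (0:ℝ), Real.exp (-r * t) * S r / ((S r)^2 + (C r)^2))
    (T : ℝ) (hT : 0 < T)
    (u u' : ℝ → ℝ)
    (hu' : IntegrableOn u' (Ioo 0 T))
    (hu : ∀ t ∈ Icc (0:ℝ) T, u t = u 0 + ∫ s in (0:ℝ)..t, u' s) :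
    ∀ t ∈ Icc (0:ℝ) T,
      (∫ τ in (0:ℝ)..t, g (t - τ) * ∫ s in (0:ℝ)..τ, k (τ - s) * u' s) = u t - u 0 := by
  intro t ht
  set m : Measure ℝ := (volume.restrict (Ioo 0 1)).withDensity fun α => ENNReal.ofReal (μ α) with hm_def
  have hae : AEMeasurable (fun α => ENNReal.ofReal (μ α)) (volume.restrict (Ioo 0 1)) :=
    hμ_int.aestronglyMeasurable.aemeasurable.ennreal_ofReal
  have hfin : IsFiniteMeasure m := isFiniteMeasure_withDensity_ofReal hμ_int.2
  have hm : ∀ᵐ α ∂m, α ∈ Ioo (0 : ℝ) 1 :=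
    (withDensity_absolutelyContinuous _ _).ae_le (ae_restrict_mem measurableSet_Ioo)
  have hm0 : m ≠ 0 := by
    rw [hm_def, Ne, withDensity_eq_zero_iff hae]
    refine fun h => hμ_ne ?_
    filter_upwards [h, ae_restrict_mem measurableSet_Ioo] with α h1 h2
    exact le_antisymm (ENNReal.ofReal_eq_zero.1 h1) (hμ_nonneg α h2)
  have hint : ∀ f : ℝ → ℝ, ∫ α, f α ∂m = ∫ α in Ioo (0 : ℝ) 1, f α * μ α := by
    intro f
    rw [hm_def, integral_withDensity_eq_integral_toReal_smul₀ hae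
      (ae_of_all _ fun _ => ENNReal.ofReal_lt_top)]
    refine setIntegral_congr_fun measurableSet_Ioo fun α hα => ?_
    simp only [ENNReal.toReal_ofReal (hμ_nonneg α hα), smul_eq_mul, mul_comm]
  have hg' : ∀ t, 0 < t → g t = DistributedOrder.integralKernel m t := by
    intro t ht
    simp only [hg t ht, DistributedOrder.integralKernel, DistributedOrder.stieltjesDensity, hint,
      hS, hC, mul_div_assoc]
  have hk' : ∀ t, 0 < t → k t = DistributedOrder.derivativeKernel m t := by
    intro t ht
    simp only [hk t ht, DistributedOrder.derivativeKernel, hint, div_eq_mul_inv, mul_right_comm]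
  rw [DistributedOrder.intervalIntegral_conv_conv hm hm0 hg' hk' ht.1
    (hu'.mono_set (Ioo_subset_Ioo_right ht.2)), hu t ht, add_sub_cancel_left]
end

section
/- Let t ∈ (0,1] and let w ∈ AC[0,t]. Then ∫₀¹ ( ∫₀ᵗ (d/dτ)(I^{1-α} w)(τ) · w(τ) dτ ) μ(α) dα ≥ (c_μ (1-γ) / (4 Γ(γ))) · t^{-γ} · ∫₀ᵗ |w(τ)|² dτ. -/
open MeasureTheory Real Set

/-- The kernel `r ↦ r^{-α}`, extended by zero to `r ≤ 0`. -/
noncomputable def powKernel (α r : ℝ) : ℝ := if 0 < r then r ^ (-α) else 0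

/-- The distribution function `x ↦ ∫_{s < x} f dν`. -/
noncomputable def cumul (ν : Measure ℝ) (f : ℝ → ℝ) (x : ℝ) : ℝ :=
  ∫ s, (if s < x then f s else 0) ∂ν

lemma powKernel_nonneg (α r : ℝ) : 0 ≤ powKernel α r := by
  unfold powKernel
  split_ifs with h
  · exact rpow_nonneg h.le _
  · exact le_rfl

lemma measurable_powKernel_uncurry : Measurable fun p : ℝ × ℝ => powKernel p.1 p.2 := by
  unfold powKernel
  exact Measurable.ite (measurableSet_lt measurable_const measurable_snd)
    (measurable_snd.pow measurable_fst.neg) measurable_const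

lemma measurable_powKernel (α : ℝ) : Measurable (powKernel α) :=
  measurable_powKernel_uncurry.comp (measurable_const.prodMk measurable_id)

lemma powKernel_eq_indicator (α : ℝ) :
    powKernel α = (Ioi 0).indicator fun r => r ^ (-α) := by
  ext r
  simp [powKernel, indicator_apply]

lemma integrableOn_powKernel_Iic {α : ℝ} (hα : α < 1) {T : ℝ} (hT : 0 ≤ T) :
    IntegrableOn (powKernel α) (Iic T) := by
  rw [powKernel_eq_indicator, IntegrableOn, integrable_indicator_iff measurableSet_Ioi,
    IntegrableOn, Measure.restrict_restrict measurableSet_Ioi, Ioi_inter_Iic]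
  exact (intervalIntegrable_iff_integrableOn_Ioc_of_le hT).1
    (intervalIntegral.intervalIntegrable_rpow' (by linarith))

lemma integral_powKernel_Iic {α : ℝ} (hα : α < 1) {T : ℝ} (hT : 0 ≤ T) :
    ∫ r in Iic T, powKernel α r = T ^ (1 - α) / (1 - α) := by
  rw [powKernel_eq_indicator, integral_indicator measurableSet_Ioi,
    Measure.restrict_restrict measurableSet_Ioi, Ioi_inter_Iic,
    ← intervalIntegral.integral_of_le hT, integral_rpow (Or.inl (by linarith))]
  rw [zero_rpow (by linarith)]
  ring_nf

lemma integrable_powKernel_sub {α : ℝ} (hα : α < 1) {T s : ℝ} (hT : 0 ≤ T) (hs : 0 ≤ s) :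
    Integrable (fun r => powKernel α (r - s)) (volume.restrict (Ioc 0 T)) := by
  have h : IntegrableOn (fun r => powKernel α (r - s)) (Iic (T + s)) := by
    have := (integrableOn_powKernel_Iic hα hT)
    rw [← integrable_indicator_iff measurableSet_Iic] at this ⊢
    refine (this.comp_sub_right s).congr (Filter.Eventually.of_forall fun r => ?_)
    simp [indicator_apply]
  exact h.mono_set fun r hr => by simp at hr ⊢; linarith

lemma integral_powKernel_sub_le {α : ℝ} (hα : α < 1) {T s : ℝ} (hT : 0 ≤ T) (hs : 0 ≤ s) :
    ∫ r in Ioc 0 T, powKernel α (r - s) ≤ T ^ (1 - α) / (1 - α) := by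
  rw [← integral_powKernel_Iic hα hT, ← integral_indicator measurableSet_Ioc,
    ← integral_indicator measurableSet_Iic,
    ← integral_sub_right_eq_self ((Iic T).indicator (powKernel α)) s]
  refine integral_mono ((integrable_indicator_iff measurableSet_Ioc).2
    (integrable_powKernel_sub hα hT hs)) (((integrable_indicator_iff measurableSet_Iic).2
    (integrableOn_powKernel_Iic hα hT)).comp_sub_right s) fun r => ?_
  simp only [indicator_apply, mem_Ioc, mem_Iic]
  split_ifs with h1 h2
  · exact le_rfl
  · exact absurd (by linarith) h2
  · exact powKernel_nonneg _ _
  · exact le_rfl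

/-- The layer at height `a` in the decomposition `r^{-α} = ∫_{a ≥ r} α a^{-α-1} da`. -/
noncomputable def powLayer (α r a : ℝ) : ℝ :=
  if 0 < r ∧ r ≤ a then α * a ^ (-α - 1) else 0

lemma powLayer_nonneg {α : ℝ} (hα : 0 ≤ α) (r a : ℝ) : 0 ≤ powLayer α r a := by
  unfold powLayer
  split_ifs with h
  · exact mul_nonneg hα (rpow_nonneg (h.1.le.trans h.2) _)
  · exact le_rfl

lemma measurable_powLayer (α : ℝ) : Measurable fun p : ℝ × ℝ => powLayer α p.1 p.2 := by
  unfold powLayer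
  refine Measurable.ite ((measurableSet_lt measurable_const measurable_fst).inter
    (measurableSet_le measurable_fst measurable_snd))
    ((measurable_snd.pow_const _).const_mul α) measurable_const

lemma integral_Ici_rpow_neg {α : ℝ} (hα : 0 < α) {r : ℝ} (hr : 0 < r) :
    ∫ a in Ici r, α * a ^ (-α - 1) = r ^ (-α) := by
  rw [integral_Ici_eq_integral_Ioi, integral_const_mul,
    integral_Ioi_rpow_of_lt (by linarith) hr]
  rw [show -α - 1 + 1 = -α by ring]
  field_simp

lemma integrableOn_Ici_rpow_neg {α : ℝ} (hα : 0 < α) {r : ℝ} (hr : 0 < r) :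
    IntegrableOn (fun a => α * a ^ (-α - 1)) (Ici r) := by
  rw [integrableOn_Ici_iff_integrableOn_Ioi]
  exact (integrableOn_Ioi_rpow_of_lt (by linarith) hr).const_mul α

lemma powLayer_eq_indicator (α : ℝ) {r : ℝ} (hr : 0 < r) :
    powLayer α r = (Ici r).indicator fun a => α * a ^ (-α - 1) := by
  ext a
  simp [powLayer, indicator_apply, hr]

lemma powLayer_of_nonpos (α : ℝ) {r : ℝ} (hr : r ≤ 0) : powLayer α r = 0 := by
  ext a
  simp [powLayer, not_lt.2 hr]

lemma integrableOn_powLayer {α : ℝ} (hα : 0 < α) (r : ℝ) :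
    IntegrableOn (powLayer α r) (Ioi 0) := by
  rcases lt_or_ge 0 r with hr | hr
  · rw [powLayer_eq_indicator α hr]
    exact ((integrable_indicator_iff measurableSet_Ici).2
      (integrableOn_Ici_rpow_neg hα hr)).integrableOn
  · rw [powLayer_of_nonpos α hr]
    exact integrableOn_zero

lemma integral_powLayer {α : ℝ} (hα : 0 < α) (r : ℝ) :
    ∫ a in Ioi 0, powLayer α r a = powKernel α r := by
  rcases lt_or_ge 0 r with hr | hr
  · rw [powLayer_eq_indicator α hr, setIntegral_indicator measurableSet_Ici,
      inter_eq_self_of_subset_right (Ici_subset_Ioi.2 hr), integral_Ici_rpow_neg hα hr]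
    simp [powKernel, hr]
  · simp [powLayer_of_nonpos α hr, powKernel, not_lt.2 hr]

section Cumul

variable {ν : Measure ℝ} {f : ℝ → ℝ}

lemma abs_cumul_le (hf : Integrable f ν) (x : ℝ) : |cumul ν f x| ≤ ∫ s, |f s| ∂ν := by
  unfold cumul
  refine (abs_integral_le_integral_abs).trans (integral_mono_of_nonneg
    (Filter.Eventually.of_forall fun _ => abs_nonneg _) hf.abs
    (Filter.Eventually.of_forall fun s => ?_))
  dsimp only
  split_ifs <;> simp

lemma integrable_ite_lt (hf : Integrable f ν) (x : ℝ) :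
    Integrable (fun s => if s < x then f s else 0) ν :=
  (hf.indicator (measurableSet_Iio (a := x))).congr
    (Filter.Eventually.of_forall fun s => by simp [indicator_apply])

lemma cumul_eq_zero (hν : ∀ᵐ s ∂ν, 0 ≤ s) {x : ℝ} (hx : x ≤ 0) : cumul ν f x = 0 := by
  unfold cumul
  refine integral_eq_zero_of_ae ?_
  filter_upwards [hν] with s hs
  simp [not_lt.2 (hx.trans hs)]

lemma integral_powLayer_sub_mul (hf : Integrable f ν) (α τ : ℝ) {a : ℝ} (ha : 0 < a) :
    ∫ s, powLayer α (τ - s) a * f s ∂ν =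
      α * a ^ (-α - 1) * (cumul ν f τ - cumul ν f (τ - a)) := by
  unfold cumul
  rw [← integral_sub (integrable_ite_lt hf τ) (integrable_ite_lt hf (τ - a)),
    ← integral_const_mul]
  refine integral_congr_ae (Filter.Eventually.of_forall fun s => ?_)
  simp only [powLayer]
  by_cases h1 : s < τ
  · by_cases h2 : s < τ - a
    · have h3 : ¬ (0 < τ - s ∧ τ - s ≤ a) := fun h => by linarith [h.2]
      rw [if_neg h3, if_pos h1, if_pos h2, sub_self, mul_zero, zero_mul]
    · rw [if_pos ⟨by linarith, by linarith⟩, if_pos h1, if_neg h2, sub_zero]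
  · have h2 : ¬ (s < τ - a) := by linarith
    have h3 : ¬ (0 < τ - s ∧ τ - s ≤ a) := fun h => by linarith [h.1]
    rw [if_neg h3, if_neg h1, if_neg h2, sub_self, mul_zero, zero_mul]

lemma integral_cumul_mul_sub_of_ge (hν : ∀ᵐ s ∂ν, 0 ≤ s) {a T : ℝ} (ha : T ≤ a) :
    ∫ x in Ioc 0 T, cumul ν f x * (cumul ν f x - cumul ν f (x - a)) =
      ∫ x in Ioc 0 T, cumul ν f x ^ 2 := by
  refine setIntegral_congr_fun measurableSet_Ioc fun x hx => ?_
  simp only [cumul_eq_zero hν (show x - a ≤ 0 by linarith [hx.2])]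
  ring

variable [IsFiniteMeasure ν]

lemma measurable_cumul (hf : Integrable f ν) : Measurable (cumul ν f) := by
  have h : cumul ν f = cumul ν (hf.1.mk f) := by
    ext x
    refine integral_congr_ae ?_
    filter_upwards [hf.1.ae_eq_mk] with s hs
    rw [hs]
  rw [h]
  have h2 : StronglyMeasurable fun p : ℝ × ℝ => if p.2 < p.1 then hf.1.mk f p.2 else 0 :=
    StronglyMeasurable.ite (measurableSet_lt measurable_snd measurable_fst)
      (hf.1.stronglyMeasurable_mk.comp_measurable measurable_snd) stronglyMeasurable_const
  exact (h2.integral_prod_right' (ν := ν)).measurable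

lemma integrable_powKernel_sub_mul {α : ℝ} (hα : α < 1) {T : ℝ} (hT : 0 ≤ T)
    (hf : Integrable f ν) (hν : ∀ᵐ s ∂ν, 0 ≤ s) :
    Integrable (fun p : ℝ × ℝ => powKernel α (p.1 - p.2) * f p.2)
      ((volume.restrict (Ioc 0 T)).prod ν) := by
  have hm : AEStronglyMeasurable (fun p : ℝ × ℝ => powKernel α (p.1 - p.2) * f p.2)
      ((volume.restrict (Ioc 0 T)).prod ν) :=
    ((measurable_powKernel α).comp (measurable_fst.sub measurable_snd)).aestronglyMeasurable.mul
      hf.1.comp_snd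
  rw [integrable_prod_iff' hm]
  refine ⟨?_, ?_⟩
  · filter_upwards [hν] with s hs
    exact (integrable_powKernel_sub hα hT hs).mul_const _
  · refine (hf.abs.const_mul (T ^ (1 - α) / (1 - α))).mono' hm.norm.prod_swap.integral_prod_right' ?_
    filter_upwards [hν] with s hs
    rw [Real.norm_of_nonneg (integral_nonneg fun _ => norm_nonneg _)]
    simp only [norm_mul, Real.norm_eq_abs, abs_of_nonneg (powKernel_nonneg _ _)]
    rw [integral_mul_const]
    gcongr
    exact integral_powKernel_sub_le hα hT hs

lemma integral_abs_powKernel_sub_mul_le {α : ℝ} (hα : α < 1) {T : ℝ} (hT : 0 ≤ T)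
    (hf : Integrable f ν) (hν : ∀ᵐ s ∂ν, 0 ≤ s) :
    ∫ p : ℝ × ℝ, |powKernel α (p.1 - p.2) * f p.2| ∂((volume.restrict (Ioc 0 T)).prod ν) ≤
      T ^ (1 - α) / (1 - α) * ∫ s, |f s| ∂ν := by
  have hI := (integrable_powKernel_sub_mul hα hT hf hν).abs
  rw [integral_prod_symm _ hI, ← integral_const_mul]
  refine integral_mono_ae hI.integral_prod_right (hf.abs.const_mul _) ?_
  filter_upwards [hν] with s hs
  simp only [abs_mul, abs_of_nonneg (powKernel_nonneg _ _)]
  rw [integral_mul_const]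
  gcongr
  exact integral_powKernel_sub_le hα hT hs

/-- Convolving the kernel with a distribution function gives the primitive of the kernel
convolved with the density. -/
lemma integral_powKernel_mul_cumul {α : ℝ} (hα : α < 1) {T : ℝ} (hT : 0 ≤ T)
    (hf : Integrable f ν) (hν : ∀ᵐ s ∂ν, 0 ≤ s) :
    ∫ x in Ioc 0 T, powKernel α (T - x) * cumul ν f x =
      ∫ r in Ioc 0 T, ∫ s, powKernel α (r - s) * f s ∂ν := by
  have hK : Integrable (fun x => powKernel α (T - x)) (volume.restrict (Ioc 0 T)) := by
    have := ((integrable_indicator_iff measurableSet_Iic).2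
      (integrableOn_powKernel_Iic hα hT)).comp_sub_left T
    rw [← IntegrableOn, ← integrable_indicator_iff measurableSet_Ioc]
    refine (this.indicator (measurableSet_Ioc (a := (0:ℝ)) (b := T))).congr
      (Filter.Eventually.of_forall fun x => ?_)
    simp only [indicator_apply, mem_Ioc, mem_Iic]
    split_ifs with h1 h2
    · rfl
    · exact absurd (by linarith) h2
    · rfl
  have hI : Integrable (fun p : ℝ × ℝ => powKernel α (T - p.1) * (if p.2 < p.1 then f p.2 else 0))
      ((volume.restrict (Ioc 0 T)).prod ν) := by
    refine ((hK.mul_prod hf).indicator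
      (measurableSet_lt measurable_snd measurable_fst)).congr
      (Filter.Eventually.of_forall fun p => ?_)
    simp only [indicator_apply, mem_ofPred_eq]
    split_ifs <;> simp
  have h1 : ∫ x in Ioc 0 T, powKernel α (T - x) * cumul ν f x =
      ∫ x in Ioc 0 T, ∫ s, powKernel α (T - x) * (if s < x then f s else 0) ∂ν := by
    simp only [cumul, integral_const_mul]
  rw [h1, integral_integral_swap hI,
    integral_integral_swap (f := fun r s => powKernel α (r - s) * f s)
      (integrable_powKernel_sub_mul hα hT hf hν)]
  refine integral_congr_ae ?_
  filter_upwards [hν] with s hs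
  rw [← integral_indicator measurableSet_Ioc, ← integral_indicator measurableSet_Ioc,
    ← integral_sub_left_eq_self _ volume (T + s)]
  refine integral_congr_ae ?_
  have hT' : ∀ᵐ x : ℝ, x ≠ T := by simp [ae_iff, measure_singleton]
  filter_upwards [hT'] with x hx
  simp only [indicator_apply, mem_Ioc, powKernel]
  rw [show T - (T + s - x) = x - s by ring]
  by_cases h1 : s < x
  · by_cases h2 : x < T
    · rw [if_pos ⟨by linarith, by linarith⟩, if_pos (by linarith), if_pos (by linarith),
        if_pos ⟨by linarith, h2.le⟩]
    · have : T < x := lt_of_le_of_ne (not_lt.1 h2) hx.symm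
      have h3 : ¬ (0 < x ∧ x ≤ T) := fun h => by linarith [h.2]
      have h4 : ¬ (s < T + s - x) := by linarith
      rw [if_neg h3, if_neg h4]
      simp
  · have : ¬ (0 < x - s) := by linarith
    simp [this]

lemma integrable_layers {α : ℝ} (hα : α ∈ Ioo (0:ℝ) 1) {T : ℝ} (hT : 0 ≤ T)
    (hf : Integrable f ν) (hν : ∀ᵐ s ∂ν, 0 ≤ s) :
    Integrable (fun q : (ℝ × ℝ) × ℝ =>
        cumul ν f q.1.1 * (powLayer α (q.1.1 - q.1.2) q.2 * f q.1.2))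
      (((volume.restrict (Ioc 0 T)).prod ν).prod (volume.restrict (Ioi 0))) := by
  have hm : AEStronglyMeasurable (fun q : (ℝ × ℝ) × ℝ =>
        cumul ν f q.1.1 * (powLayer α (q.1.1 - q.1.2) q.2 * f q.1.2))
      (((volume.restrict (Ioc 0 T)).prod ν).prod (volume.restrict (Ioi 0))) := by
    refine AEStronglyMeasurable.mul ?_ (AEStronglyMeasurable.mul ?_ ?_)
    · exact ((measurable_cumul hf).comp
        (measurable_fst.comp measurable_fst)).aestronglyMeasurable
    · exact ((measurable_powLayer α).comp
        (Measurable.prodMk (by fun_prop) measurable_snd)).aestronglyMeasurable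
    · exact hf.1.comp_snd.comp_fst
  rw [integrable_prod_iff hm]
  refine ⟨Filter.Eventually.of_forall fun p =>
    ((integrableOn_powLayer hα.1 (p.1 - p.2)).mul_const (f p.2)).const_mul (cumul ν f p.1), ?_⟩
  have hI := (integrable_powKernel_sub_mul hα.2 hT hf hν).abs.const_mul (∫ s, |f s| ∂ν)
  refine hI.mono' hm.norm.integral_prod_right' (Filter.Eventually.of_forall fun p => ?_)
  rw [Real.norm_of_nonneg (integral_nonneg fun _ => norm_nonneg _)]
  simp only [norm_mul, Real.norm_eq_abs, abs_of_nonneg (powLayer_nonneg hα.1.le _ _), abs_mul,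
    abs_of_nonneg (powKernel_nonneg _ _)]
  rw [integral_const_mul, integral_mul_const, integral_powLayer hα.1]
  gcongr
  · exact mul_nonneg (powKernel_nonneg _ _) (abs_nonneg _)
  · exact abs_cumul_le hf _

lemma integrable_cumul_mul_powKernel {α : ℝ} (hα : α < 1) {T : ℝ} (hT : 0 ≤ T)
    (hf : Integrable f ν) (hν : ∀ᵐ s ∂ν, 0 ≤ s) :
    Integrable (fun p : ℝ × ℝ => cumul ν f p.1 * (powKernel α (p.1 - p.2) * f p.2))
      ((volume.restrict (Ioc 0 T)).prod ν) :=
  (integrable_powKernel_sub_mul hα hT hf hν).bdd_mul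
    ((measurable_cumul hf).comp measurable_fst).aestronglyMeasurable
    (Filter.Eventually.of_forall fun p => abs_cumul_le hf p.1)

lemma integrableOn_cumul_sub_sq (hf : Integrable f ν) (a T : ℝ) :
    IntegrableOn (fun x => cumul ν f (x - a) ^ 2) (Ioc 0 T) := by
  refine Integrable.of_bound (((measurable_cumul hf).comp
    (measurable_id.sub_const a)).pow_const 2).aestronglyMeasurable ((∫ s, |f s| ∂ν) ^ 2)
    (Filter.Eventually.of_forall fun x => ?_)
  rw [norm_pow]
  gcongr
  exact abs_cumul_le hf _

lemma integrableOn_cumul_mul_sub (hf : Integrable f ν) (a T : ℝ) :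
    IntegrableOn (fun x => cumul ν f x * (cumul ν f x - cumul ν f (x - a))) (Ioc 0 T) := by
  have hm := measurable_cumul hf
  refine Integrable.of_bound (hm.mul (hm.sub (hm.comp
    (measurable_id.sub_const a)))).aestronglyMeasurable
    ((∫ s, |f s| ∂ν) * ((∫ s, |f s| ∂ν) + ∫ s, |f s| ∂ν))
    (Filter.Eventually.of_forall fun x => ?_)
  rw [norm_mul]
  have h := abs_cumul_le hf
  refine mul_le_mul (h x) ((norm_sub_le _ _).trans (add_le_add (h _) (h _))) (norm_nonneg _)
    ((abs_nonneg _).trans (h x))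

lemma integral_cumul_sub_sq_le (hf : Integrable f ν) (hν : ∀ᵐ s ∂ν, 0 ≤ s) {a : ℝ} (ha : 0 < a)
    (T : ℝ) :
    ∫ x in Ioc 0 T, cumul ν f (x - a) ^ 2 ≤ ∫ x in Ioc 0 T, cumul ν f x ^ 2 := by
  have h0 := integrableOn_cumul_sub_sq hf 0 T
  simp only [sub_zero] at h0
  have ha' := integrableOn_cumul_sub_sq hf a T
  rw [← integrable_indicator_iff measurableSet_Ioc] at h0 ha'
  rw [← integral_indicator measurableSet_Ioc, ← integral_indicator measurableSet_Ioc,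
    ← integral_sub_right_eq_self ((Ioc 0 T).indicator fun x => cumul ν f x ^ 2) a]
  refine integral_mono ha' (h0.comp_sub_right a) fun x => ?_
  simp only [indicator_apply, mem_Ioc]
  split_ifs with h1 h2 h2
  · exact le_rfl
  · have : x - a ≤ 0 := by
      by_contra h
      exact h2 ⟨by linarith, by linarith [h1.2]⟩
    simp [cumul_eq_zero hν this]
  · positivity
  · exact le_rfl

lemma integral_cumul_mul_sub_nonneg (hf : Integrable f ν) (hν : ∀ᵐ s ∂ν, 0 ≤ s) {a : ℝ}
    (ha : 0 < a) (T : ℝ) :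
    0 ≤ ∫ x in Ioc 0 T, cumul ν f x * (cumul ν f x - cumul ν f (x - a)) := by
  have h0 := integrableOn_cumul_sub_sq hf 0 T
  simp only [sub_zero] at h0
  have ha' := integrableOn_cumul_sub_sq hf a T
  have h1 : ∫ x in Ioc 0 T, (1 / 2 : ℝ) * (cumul ν f x ^ 2 - cumul ν f (x - a) ^ 2) ≤
      ∫ x in Ioc 0 T, cumul ν f x * (cumul ν f x - cumul ν f (x - a)) :=
    integral_mono ((h0.sub ha').const_mul _) (integrableOn_cumul_mul_sub hf a T) fun x => by
      nlinarith [sq_nonneg (cumul ν f x - cumul ν f (x - a))]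
  rw [integral_const_mul, integral_sub h0 ha'] at h1
  linarith [integral_cumul_sub_sq_le hf hν ha T]

/-- Coercivity of the fractional derivative, with the layer decomposition of the kernel. -/
lemma rpow_mul_integral_cumul_sq_le {α : ℝ} (hα : α ∈ Ioo (0:ℝ) 1) {T : ℝ} (hT : 0 < T)
    (hf : Integrable f ν) (hν : ∀ᵐ s ∂ν, 0 ≤ s) :
    T ^ (-α) * ∫ x in Ioc 0 T, cumul ν f x ^ 2 ≤
      ∫ p : ℝ × ℝ, cumul ν f p.1 * (powKernel α (p.1 - p.2) * f p.2)
        ∂((volume.restrict (Ioc 0 T)).prod ν) := by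
  have hG := integrable_layers hα hT.le hf hν
  have h1 : ∫ p : ℝ × ℝ, cumul ν f p.1 * (powKernel α (p.1 - p.2) * f p.2)
        ∂((volume.restrict (Ioc 0 T)).prod ν) =
      ∫ a in Ioi 0, ∫ p : ℝ × ℝ, cumul ν f p.1 * (powLayer α (p.1 - p.2) a * f p.2)
        ∂((volume.restrict (Ioc 0 T)).prod ν) := by
    rw [← integral_prod_symm _ hG, integral_prod _ hG]
    simp only [integral_const_mul, integral_mul_const, integral_powLayer hα.1]
  have h2 : (fun a => ∫ p : ℝ × ℝ, cumul ν f p.1 * (powLayer α (p.1 - p.2) a * f p.2)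
        ∂((volume.restrict (Ioc 0 T)).prod ν)) =ᵐ[volume.restrict (Ioi 0)]
      fun a => α * a ^ (-α - 1) *
        ∫ x in Ioc 0 T, cumul ν f x * (cumul ν f x - cumul ν f (x - a)) := by
    filter_upwards [hG.prod_left_ae, ae_restrict_mem measurableSet_Ioi] with a ha ha0
    rw [integral_prod _ ha, ← integral_const_mul]
    refine integral_congr_ae (Filter.Eventually.of_forall fun x => ?_)
    simp only [integral_const_mul, integral_powLayer_sub_mul hf α _ ha0]
    ring
  have hI := hG.integral_prod_right.congr h2
  rw [h1, integral_congr_ae h2]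
  calc T ^ (-α) * ∫ x in Ioc 0 T, cumul ν f x ^ 2
      = ∫ a in Ici T, α * a ^ (-α - 1) *
        ∫ x in Ioc 0 T, cumul ν f x * (cumul ν f x - cumul ν f (x - a)) := by
        rw [← integral_Ici_rpow_neg hα.1 hT, ← integral_mul_const]
        refine setIntegral_congr_fun measurableSet_Ici fun a ha => ?_
        simp only [integral_cumul_mul_sub_of_ge hν ha]
    _ ≤ _ := by
        refine setIntegral_mono_set hI ?_ (Ici_subset_Ioi.2 hT).eventuallyLE
        filter_upwards [ae_restrict_mem measurableSet_Ioi] with a ha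
        exact mul_nonneg (mul_nonneg hα.1.le (rpow_nonneg (le_of_lt ha) _))
          (integral_cumul_mul_sub_nonneg hf hν ha T)

lemma ae_deriv_integral_rpow_mul_eq {α : ℝ} (hα : α ∈ Ioo (0:ℝ) 1) {T : ℝ} (hT : 0 < T)
    (hf : Integrable f ν) (hν : ∀ᵐ s ∂ν, 0 ≤ s) {w : ℝ → ℝ}
    (hw : ∀ x ∈ Ioc 0 T, w x = cumul ν f x) (c : ℝ) :
    ∀ᵐ τ ∂(volume.restrict (Ioc 0 T)),
      deriv (fun σ : ℝ => c * ∫ s in (0:ℝ)..σ, (σ - s) ^ (-α) * w s) τ =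
        c * ∫ s, powKernel α (τ - s) * f s ∂ν := by
  have hg : IntervalIntegrable (fun r => ∫ s, powKernel α (r - s) * f s ∂ν) volume 0 T :=
    (intervalIntegrable_iff_integrableOn_Ioc_of_le hT.le).2
      (integrable_powKernel_sub_mul hα.2 hT.le hf hν).integral_prod_left
  have hne : ∀ᵐ x : ℝ, x ≠ T := by simp [ae_iff, measure_singleton]
  filter_upwards [ae_restrict_of_ae hg.ae_hasDerivAt_integral, ae_restrict_of_ae hne,
    ae_restrict_mem measurableSet_Ioc] with τ hτ hτT hτm
  rw [uIcc_of_le hT.le] at hτ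
  have hd := (hτ ⟨hτm.1.le, hτm.2⟩ 0 ⟨le_rfl, hT.le⟩).const_mul c
  refine (hd.congr_of_eventuallyEq ?_).deriv
  filter_upwards [Ioo_mem_nhds hτm.1 (lt_of_le_of_ne hτm.2 hτT)] with σ hσ
  rw [intervalIntegral.integral_of_le hσ.1.le, intervalIntegral.integral_of_le hσ.1.le,
    ← integral_powKernel_mul_cumul hα.2 hσ.1.le hf hν]
  congr 1
  refine setIntegral_congr_fun measurableSet_Ioc fun x hx => ?_
  rw [hw x ⟨hx.1, hx.2.trans hσ.2.le⟩, powKernel]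
  split_ifs with h
  · rfl
  · rw [show σ - x = 0 by linarith [hx.2], zero_rpow (neg_ne_zero.2 hα.1.ne')]

lemma integral_deriv_mul_eq {α : ℝ} (hα : α ∈ Ioo (0:ℝ) 1) {T : ℝ} (hT : 0 < T)
    (hf : Integrable f ν) (hν : ∀ᵐ s ∂ν, 0 ≤ s) {w : ℝ → ℝ}
    (hw : ∀ x ∈ Ioc 0 T, w x = cumul ν f x) (c : ℝ) :
    ∫ τ in (0:ℝ)..T,
        deriv (fun σ : ℝ => c * ∫ s in (0:ℝ)..σ, (σ - s) ^ (-α) * w s) τ * w τ =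
      c * ∫ p : ℝ × ℝ, cumul ν f p.1 * (powKernel α (p.1 - p.2) * f p.2)
        ∂((volume.restrict (Ioc 0 T)).prod ν) := by
  rw [intervalIntegral.integral_of_le hT.le,
    integral_prod _ (integrable_cumul_mul_powKernel hα.2 hT.le hf hν), ← integral_const_mul]
  refine integral_congr_ae ?_
  filter_upwards [ae_deriv_integral_rpow_mul_eq hα hT hf hν hw c,
    ae_restrict_mem measurableSet_Ioc] with τ h1 h2
  rw [h1, hw τ h2, integral_const_mul]
  ring

lemma aestronglyMeasurable_integral_cumul_mul_powKernel (T : ℝ) (hf : Integrable f ν)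
    (m : Measure ℝ) [SFinite m] :
    AEStronglyMeasurable (fun α => ∫ p : ℝ × ℝ, cumul ν f p.1 * (powKernel α (p.1 - p.2) * f p.2)
      ∂((volume.restrict (Ioc 0 T)).prod ν)) m := by
  have h : AEStronglyMeasurable (fun q : ℝ × (ℝ × ℝ) =>
      cumul ν f q.2.1 * (powKernel q.1 (q.2.1 - q.2.2) * f q.2.2))
      (m.prod ((volume.restrict (Ioc 0 T)).prod ν)) := by
    refine AEStronglyMeasurable.mul ?_ (AEStronglyMeasurable.mul ?_ ?_)
    · exact ((measurable_cumul hf).comp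
        (measurable_fst.comp measurable_snd)).aestronglyMeasurable
    · exact (measurable_powKernel_uncurry.comp
        (measurable_fst.prodMk (by fun_prop))).aestronglyMeasurable
    · exact hf.1.comp_snd.comp_snd
  exact h.integral_prod_right'

lemma abs_integral_cumul_mul_powKernel_le {α : ℝ} (hα : α < 1) {T : ℝ} (hT : 0 ≤ T)
    (hf : Integrable f ν) (hν : ∀ᵐ s ∂ν, 0 ≤ s) :
    |∫ p : ℝ × ℝ, cumul ν f p.1 * (powKernel α (p.1 - p.2) * f p.2)
      ∂((volume.restrict (Ioc 0 T)).prod ν)| ≤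
      (∫ s, |f s| ∂ν) * (T ^ (1 - α) / (1 - α) * ∫ s, |f s| ∂ν) := by
  refine abs_integral_le_integral_abs.trans (le_trans ?_ (mul_le_mul_of_nonneg_left
    (integral_abs_powKernel_sub_mul_le hα hT hf hν) (integral_nonneg fun _ => abs_nonneg _)))
  rw [← integral_const_mul]
  refine integral_mono (integrable_cumul_mul_powKernel hα hT hf hν).abs
    ((integrable_powKernel_sub_mul hα hT hf hν).abs.const_mul _) fun p => ?_
  simp only [abs_mul (cumul ν f p.1)]
  exact mul_le_mul_of_nonneg_right (abs_cumul_le hf _) (abs_nonneg _)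

end Cumul

lemma continuousOn_Gamma_Ioi : ContinuousOn Real.Gamma (Ioi 0) := fun x hx =>
  (Real.differentiableAt_Gamma fun m => by
    have : (0:ℝ) ≤ m := m.cast_nonneg
    have : 0 < x := hx
    linarith).continuousAt.continuousWithinAt

lemma Gamma_le_Gamma_of_le_one {x y : ℝ} (hx : 0 < x) (hxy : x ≤ y) (hy : y < 1) :
    Real.Gamma y ≤ Real.Gamma x := by
  have h1 : Real.Gamma 1 ≤ Real.Gamma x := by
    have h := Real.convexOn_Gamma.slope_mono_adjacent (x := x) (y := 1) (z := 2) hx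
      (by norm_num) (by linarith) (by norm_num)
    rw [Real.Gamma_two, Real.Gamma_one, sub_self, zero_div,
      div_le_iff₀ (by linarith)] at h
    rw [Real.Gamma_one]
    linarith
  exact (Real.convexOn_Gamma.le_max_of_mem_Icc (mem_Ioi.2 hx) (mem_Ioi.2 one_pos)
    ⟨hxy, hy.le⟩).trans (max_le le_rfl h1)

lemma exists_inv_Gamma_two_sub_le :
    ∃ C : ℝ, ∀ α ∈ Ioo (0:ℝ) 1, (Real.Gamma (2 - α))⁻¹ ≤ C := by
  have hc : ContinuousOn (fun α : ℝ => (Real.Gamma (2 - α))⁻¹) (Icc 0 1) := by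
    refine ContinuousOn.inv₀ (continuousOn_Gamma_Ioi.comp (by fun_prop) fun α hα => ?_)
      fun α hα => (Real.Gamma_pos_of_pos (by linarith [hα.2])).ne'
    simp only [mem_Ioi]
    linarith [hα.2]
  obtain ⟨C, hC⟩ := isCompact_Icc.bddAbove_image hc
  exact ⟨C, fun α hα => hC ⟨α, ⟨hα.1.le, hα.2.le⟩, rfl⟩⟩

/-- An absolutely continuous function is the distribution function of a density with respect to
the sum of a point mass at the origin and Lebesgue measure. -/
lemma exists_cumul_eq {T : ℝ} {w w' : ℝ → ℝ} (hw' : IntegrableOn w' (Ioo 0 T))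
    (hw : ∀ s ∈ Icc (0:ℝ) T, w s = w 0 + ∫ σ in (0:ℝ)..s, w' σ) :
    ∃ (ν : Measure ℝ) (_ : IsFiniteMeasure ν) (f : ℝ → ℝ), Integrable f ν ∧
      (∀ᵐ s ∂ν, 0 ≤ s) ∧ ∀ x ∈ Ioc 0 T, w x = cumul ν f x := by
  set f : ℝ → ℝ := fun s => if s = 0 then w 0 else w' s with hfdef
  have hfe : ∀ s ∈ Ioo 0 T, f s = w' s := fun s hs => by simp [hfdef, hs.1.ne']
  have hfi : IntegrableOn f (Ioo 0 T) := hw'.congr_fun (fun s hs => (hfe s hs).symm)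
    measurableSet_Ioo
  have hfd : Integrable f (Measure.dirac 0) := integrable_dirac (by simp)
  have hf : Integrable f (Measure.dirac 0 + volume.restrict (Ioo 0 T)) :=
    hfd.add_measure hfi
  refine ⟨Measure.dirac 0 + volume.restrict (Ioo 0 T), inferInstance, f, hf, ?_, fun x hx => ?_⟩
  · rw [ae_add_measure_iff]
    refine ⟨by simp [ae_dirac_eq], ?_⟩
    filter_upwards [ae_restrict_mem measurableSet_Ioo] with s hs
    exact hs.1.le
  · have hi := integrable_ite_lt hf x
    rw [integrable_add_measure] at hi
    rw [cumul, integral_add_measure hi.1 hi.2, integral_dirac, if_pos hx.1,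
      hw x ⟨hx.1.le, hx.2⟩]
    congr 1
    · simp [hfdef]
    · rw [intervalIntegral.integral_of_le hx.1.le, integral_Ioc_eq_integral_Ioo,
        ← integral_indicator measurableSet_Ioo, ← integral_indicator measurableSet_Ioo]
      congr 1
      ext s
      simp only [indicator_apply, mem_Ioo]
      by_cases h1 : 0 < s ∧ s < x
      · have h2 : 0 < s ∧ s < T := ⟨h1.1, h1.2.trans_le hx.2⟩
        rw [if_pos h1, if_pos h2, if_pos h1.2, hfe s h2]
      · rw [if_neg h1]
        split_ifs with h2 h3
        · exact absurd ⟨h2.1, h3⟩ h1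
        · rfl
        · rfl

/-- For `t ∈ (0,1]` and `w ∈ AC[0,t]`,
`∫₀¹ (∫₀ᵗ (d/dτ)(I^{1-α}w)(τ) · w(τ) dτ) μ(α) dα
  ≥ (c_μ (1-γ)/(4Γ(γ))) t^{-γ} ∫₀ᵗ |w(τ)|² dτ`. -/
theorem stmt_13 (μ : ℝ → ℝ)
    (hμ_int : IntegrableOn μ (Ioo 0 1))
    (hμ_nonneg : ∀ α ∈ Ioo (0:ℝ) 1, 0 ≤ μ α)
    (hμ_ne : ¬ (∀ᵐ α ∂(volume.restrict (Ioo (0:ℝ) 1)), μ α = 0))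
    (hcμ : 0 < ∫ α in Ioo (0:ℝ) 1, μ α)
    (γ : ℝ) (hγ : γ ∈ Ioo (0:ℝ) (1/2))
    (hγμ : (∫ α in Ioo γ (1 - γ), μ α) = ((1 - γ) / 2) * ∫ α in Ioo (0:ℝ) 1, μ α)
    (t : ℝ) (ht : t ∈ Ioc (0:ℝ) 1)
    (w w' : ℝ → ℝ)
    (hw' : IntegrableOn w' (Ioo 0 t))
    (hw : ∀ s ∈ Icc (0:ℝ) t, w s = w 0 + ∫ σ in (0:ℝ)..s, w' σ) :
    ((∫ α in Ioo (0:ℝ) 1, μ α) * (1 - γ) / (4 * Real.Gamma γ)) * t ^ (-γ) *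
        (∫ τ in (0:ℝ)..t, (w τ)^2) ≤
      ∫ α in Ioo (0:ℝ) 1,
        (∫ τ in (0:ℝ)..t,
          deriv (fun σ : ℝ => (Real.Gamma (1 - α))⁻¹ *
            ∫ s in (0:ℝ)..σ, (σ - s) ^ (-α) * w s) τ * w τ) * μ α := by
  obtain ⟨ν, _, f, hf, hν, hwc⟩ := exists_cumul_eq hw' hw
  set E : ℝ → ℝ := fun α => ∫ p : ℝ × ℝ, cumul ν f p.1 * (powKernel α (p.1 - p.2) * f p.2)
    ∂((volume.restrict (Ioc 0 t)).prod ν) with hE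
  set S : ℝ := ∫ τ in (0:ℝ)..t, (w τ) ^ 2 with hS
  have hS0 : 0 ≤ S := intervalIntegral.integral_nonneg ht.1.le fun _ _ => sq_nonneg _
  have hSc : S = ∫ x in Ioc 0 t, cumul ν f x ^ 2 := by
    rw [hS, intervalIntegral.integral_of_le ht.1.le]
    exact setIntegral_congr_fun measurableSet_Ioc fun x hx => by simp only [hwc x hx]
  have hF : ∫ α in Ioo (0:ℝ) 1, (∫ τ in (0:ℝ)..t,
        deriv (fun σ : ℝ => (Real.Gamma (1 - α))⁻¹ *
          ∫ s in (0:ℝ)..σ, (σ - s) ^ (-α) * w s) τ * w τ) * μ α =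
      ∫ α in Ioo (0:ℝ) 1, (Real.Gamma (1 - α))⁻¹ * E α * μ α :=
    setIntegral_congr_fun measurableSet_Ioo fun α hα => by
      simp only [integral_deriv_mul_eq hα ht.1 hf hν hwc, hE]
  rw [hF]
  have hΓ : ∀ α ∈ Ioo (0:ℝ) 1, 0 < Real.Gamma (1 - α) := fun α hα =>
    Real.Gamma_pos_of_pos (by linarith [hα.2])
  have hEge : ∀ α ∈ Ioo (0:ℝ) 1, t ^ (-α) * S ≤ E α := fun α hα => by
    rw [hSc]
    exact rpow_mul_integral_cumul_sq_le hα ht.1 hf hν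
  have hint : IntegrableOn (fun α => (Real.Gamma (1 - α))⁻¹ * E α * μ α) (Ioo 0 1) := by
    obtain ⟨C, hC⟩ := exists_inv_Gamma_two_sub_le
    have hΓc : ContinuousOn (fun α : ℝ => (Real.Gamma (1 - α))⁻¹) (Ioo 0 1) := by
      refine ContinuousOn.inv₀ (continuousOn_Gamma_Ioi.comp (by fun_prop) fun α hα => ?_)
        fun α hα => (hΓ α hα).ne'
      simp only [mem_Ioi]
      linarith [hα.2]
    refine hμ_int.bdd_mul (c := (∫ s, |f s| ∂ν) * (C * ∫ s, |f s| ∂ν))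
      ((hΓc.aestronglyMeasurable measurableSet_Ioo).mul
      (aestronglyMeasurable_integral_cumul_mul_powKernel t hf _)) ?_
    filter_upwards [ae_restrict_mem measurableSet_Ioo] with α hα
    have hα1 : 0 < 1 - α := by linarith [hα.2]
    have hN : 0 ≤ ∫ s, |f s| ∂ν := integral_nonneg fun _ => abs_nonneg _
    rw [norm_mul, Real.norm_of_nonneg (inv_nonneg.2 (hΓ α hα).le)]
    have hΓ2 : Real.Gamma (2 - α) = (1 - α) * Real.Gamma (1 - α) := by
      rw [← Real.Gamma_add_one hα1.ne']
      ring_nf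
    calc (Real.Gamma (1 - α))⁻¹ * ‖E α‖
        ≤ (Real.Gamma (1 - α))⁻¹ *
          ((∫ s, |f s| ∂ν) * (t ^ (1 - α) / (1 - α) * ∫ s, |f s| ∂ν)) :=
          mul_le_mul_of_nonneg_left (abs_integral_cumul_mul_powKernel_le hα.2 ht.1.le hf hν)
            (inv_nonneg.2 (hΓ α hα).le)
      _ ≤ (Real.Gamma (1 - α))⁻¹ *
          ((∫ s, |f s| ∂ν) * (1 / (1 - α) * ∫ s, |f s| ∂ν)) := by
          have := (hΓ α hα).le
          gcongr
          exact rpow_le_one ht.1.le ht.2 hα1.le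
      _ = (∫ s, |f s| ∂ν) * ((Real.Gamma (2 - α))⁻¹ * ∫ s, |f s| ∂ν) := by
          rw [hΓ2, mul_inv]
          ring
      _ ≤ _ := by
          gcongr
          exact hC α hα
  have hΓγ : 0 < Real.Gamma γ := Real.Gamma_pos_of_pos hγ.1
  have hsub : Ioo γ (1 - γ) ⊆ Ioo 0 1 := Ioo_subset_Ioo hγ.1.le (by linarith [hγ.1])
  have htγ : 0 ≤ t ^ (-γ) := rpow_nonneg ht.1.le _
  calc (∫ α in Ioo (0:ℝ) 1, μ α) * (1 - γ) / (4 * Real.Gamma γ) * t ^ (-γ) * S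
      ≤ (Real.Gamma γ)⁻¹ * (t ^ (-γ) * S) * ∫ α in Ioo γ (1 - γ), μ α := by
        rw [hγμ]
        have h : 0 ≤ (∫ α in Ioo (0:ℝ) 1, μ α) * (1 - γ) / (4 * Real.Gamma γ) * t ^ (-γ) * S := by
          have : 0 ≤ 1 - γ := by linarith [hγ.2]
          positivity
        calc _ ≤ 2 * ((∫ α in Ioo (0:ℝ) 1, μ α) * (1 - γ) / (4 * Real.Gamma γ) *
              t ^ (-γ) * S) := by linarith
          _ = _ := by
              field_simp
              ring
    _ = ∫ α in Ioo γ (1 - γ), (Real.Gamma γ)⁻¹ * (t ^ (-γ) * S) * μ α :=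
        (integral_const_mul _ _).symm
    _ ≤ ∫ α in Ioo γ (1 - γ), (Real.Gamma (1 - α))⁻¹ * E α * μ α := by
        refine setIntegral_mono_on ((hμ_int.mono_set hsub).const_mul _) (hint.mono_set hsub)
          measurableSet_Ioo fun α hα => ?_
        refine mul_le_mul_of_nonneg_right ?_ (hμ_nonneg α (hsub hα))
        refine mul_le_mul ?_ (le_trans ?_ (hEge α (hsub hα))) (mul_nonneg htγ hS0)
          (inv_nonneg.2 (hΓ α (hsub hα)).le)
        · exact inv_anti₀ (hΓ α (hsub hα)) (Gamma_le_Gamma_of_le_one hγ.1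
            (by linarith [hα.2]) (by linarith [hα.1, hγ.1]))
        · exact mul_le_mul_of_nonneg_right
            (rpow_le_rpow_of_exponent_ge ht.1 ht.2 (by linarith [hα.1])) hS0
    _ ≤ _ := by
        refine setIntegral_mono_set hint ?_ hsub.eventuallyLE
        filter_upwards [ae_restrict_mem measurableSet_Ioo] with α hα
        exact mul_nonneg (mul_nonneg (inv_nonneg.2 (hΓ α hα).le)
          ((mul_nonneg (rpow_nonneg ht.1.le _) hS0).trans (hEge α hα))) (hμ_nonneg α hα)
end
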